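/- (Artin approximation) Let g_j(t,u) ∈ ℝ{t,u}, 1 ≤ j ≤ j_0, be convergent power series in t = (t_1,…,t_δ) and u = (u_1,…,u_γ). Then for any integer κ ≥ 1 and any formal power series t^f(u) ∈ (ℝ[[u]])^δ satisfying t^f(0) = 0 and g_j(t^f(u), u) ≡ 0 for 1 ≤ j ≤ j_0, there exists a convergent power series t^c(u) ∈ (ℝ{u})^δ satisfying t^c(u) = t^f(u) + O(|u|^κ) and g_j(t^c(u), u) ≡ 0 for 1 ≤ j ≤ j_0. -/

import Mathlib

open scoped BigOperators

noncomputable section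

/-- The polynomial map obtained by truncating to order `< k` the formal power series
(centered at `0`) with coefficient family `c`. -/
def truncPoly (γ δ : ℕ) (c : (Fin γ → ℕ) → (Fin δ → ℝ)) (k : ℕ) :
    (Fin γ → ℝ) → (Fin δ → ℝ) := fun u i =>
  ∑ dd ∈ (Fintype.piFinset fun _ : Fin γ => Finset.range k).filter
      (fun dd => (∑ j, dd j) < k),
    c dd i * ∏ j, (u j) ^ dd j

namespace ArtinApprox

open MvPowerSeries
open scoped ENNReal

section WeightedNorm

variable {σ τ ι : Type*}

/-- The monomial `ρ ^ α` with values in `ℝ≥0∞`. -/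
def mon (ρ : σ → ℝ≥0∞) (α : σ →₀ ℕ) : ℝ≥0∞ := α.prod fun i k => ρ i ^ k

/-- The weighted `ℓ¹`-norm `∑ |f_α| ρ ^ α` of a power series. -/
def wnorm (ρ : σ → ℝ≥0∞) (f : MvPowerSeries σ ℝ) : ℝ≥0∞ := ∑' α, ‖coeff α f‖ₑ * mon ρ α

lemma mon_zero (ρ : σ → ℝ≥0∞) : mon ρ 0 = 1 := by simp [mon]

lemma mon_add (ρ : σ → ℝ≥0∞) (α β : σ →₀ ℕ) : mon ρ (α + β) = mon ρ α * mon ρ β := by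
  classical
  exact Finsupp.prod_add_index' (by simp) (fun _ _ _ => pow_add _ _ _)

lemma mon_single (ρ : σ → ℝ≥0∞) (i : σ) (k : ℕ) : mon ρ (Finsupp.single i k) = ρ i ^ k := by
  simp [mon]

lemma mon_mono {ρ ρ' : σ → ℝ≥0∞} (h : ∀ i, ρ i ≤ ρ' i) (α : σ →₀ ℕ) : mon ρ α ≤ mon ρ' α :=
  Finset.prod_le_prod' fun i _ => pow_le_pow_left' (h i) _

lemma mon_const (r : ℝ≥0∞) (α : σ →₀ ℕ) : mon (fun _ => r) α = r ^ α.degree := by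
  simp only [mon, Finsupp.prod, Finsupp.degree]
  exact Finset.prod_pow_eq_pow_sum _ _ _

lemma mon_smul_pow (c : ℝ≥0∞) (w : σ → ℕ) (ρ : σ → ℝ≥0∞) (α : σ →₀ ℕ) :
    mon (fun i => c ^ w i * ρ i) α = c ^ Finsupp.weight w α * mon ρ α := by
  simp only [mon, Finsupp.prod, Finsupp.weight_apply, Finsupp.sum, mul_pow, ← pow_mul,
    Finset.prod_mul_distrib]
  rw [Finset.prod_pow_eq_pow_sum]
  simp [mul_comm]

lemma wnorm_le_mul {ρ ρ' : σ → ℝ≥0∞} {f : MvPowerSeries σ ℝ} (c : ℝ≥0∞)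
    (h : ∀ α, coeff α f ≠ 0 → mon ρ' α ≤ c * mon ρ α) : wnorm ρ' f ≤ c * wnorm ρ f := by
  rw [wnorm, wnorm, ← ENNReal.tsum_mul_left]
  refine ENNReal.tsum_le_tsum fun α => ?_
  by_cases h0 : coeff α f = 0
  · simp [h0]
  · calc _ ≤ ‖coeff α f‖ₑ * (c * mon ρ α) := by gcongr; exact h α h0
      _ = _ := by ring

lemma wnorm_mono {ρ ρ' : σ → ℝ≥0∞} (h : ∀ i, ρ i ≤ ρ' i) (f : MvPowerSeries σ ℝ) :
    wnorm ρ f ≤ wnorm ρ' f := by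
  simpa using wnorm_le_mul (f := f) (ρ := ρ') (ρ' := ρ) 1 (by simpa using fun α _ => mon_mono h α)

lemma wnorm_weight_le (c : ℝ≥0∞) (hc : c ≤ 1) (w : σ → ℕ) (ρ : σ → ℝ≥0∞)
    {f : MvPowerSeries σ ℝ} {n : ℕ} (hf : n ≤ f.weightedOrder w) :
    wnorm (fun i => c ^ w i * ρ i) f ≤ c ^ n * wnorm ρ f := by
  refine wnorm_le_mul _ fun α hα => ?_
  rw [mon_smul_pow]
  gcongr 1
  refine pow_le_pow_right_of_le_one' hc ?_
  by_contra! h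
  exact hα (coeff_eq_zero_of_lt_weightedOrder w (lt_of_lt_of_le (by exact_mod_cast h) hf))

lemma wnorm_scale_le (c : ℝ≥0∞) (hc : c ≤ 1) (ρ : σ → ℝ≥0∞)
    {f : MvPowerSeries σ ℝ} {n : ℕ} (hf : n ≤ f.order) :
    wnorm (fun i => c * ρ i) f ≤ c ^ n * wnorm ρ f := by
  simpa using wnorm_weight_le c hc (fun _ => 1) ρ (f := f) (n := n) hf

lemma wnorm_add_le (ρ : σ → ℝ≥0∞) (f g : MvPowerSeries σ ℝ) :
    wnorm ρ (f + g) ≤ wnorm ρ f + wnorm ρ g := by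
  rw [wnorm, wnorm, wnorm, ← ENNReal.tsum_add]
  refine ENNReal.tsum_le_tsum fun α => ?_
  rw [← add_mul, map_add]
  gcongr
  exact enorm_add_le _ _

lemma wnorm_neg (ρ : σ → ℝ≥0∞) (f : MvPowerSeries σ ℝ) : wnorm ρ (-f) = wnorm ρ f := by
  simp [wnorm]

lemma wnorm_monomial (ρ : σ → ℝ≥0∞) (α : σ →₀ ℕ) (r : ℝ) :
    wnorm ρ (monomial α r) = ‖r‖ₑ * mon ρ α := by
  classical
  rw [wnorm, tsum_eq_single α]
  · simp
  · intro β h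
    simp [coeff_monomial, h]

lemma wnorm_C (ρ : σ → ℝ≥0∞) (r : ℝ) : wnorm ρ (C r) = ‖r‖ₑ := by
  rw [← monomial_zero_eq_C_apply, wnorm_monomial, mon_zero, mul_one]

lemma wnorm_zero (ρ : σ → ℝ≥0∞) : wnorm ρ 0 = 0 := by simp [wnorm]

lemma wnorm_one (ρ : σ → ℝ≥0∞) : wnorm ρ 1 = 1 := by
  simpa using wnorm_C ρ 1

lemma wnorm_X (ρ : σ → ℝ≥0∞) (i : σ) : wnorm ρ (X i) = ρ i := by
  rw [X, wnorm_monomial, mon_single]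
  simp

lemma wnorm_mul_le (ρ : σ → ℝ≥0∞) (f g : MvPowerSeries σ ℝ) :
    wnorm ρ (f * g) ≤ wnorm ρ f * wnorm ρ g := by
  classical
  have h1 : wnorm ρ f * wnorm ρ g = ∑' p : (σ →₀ ℕ) × (σ →₀ ℕ),
      (‖coeff p.1 f‖ₑ * mon ρ p.1) * (‖coeff p.2 g‖ₑ * mon ρ p.2) := by
    rw [ENNReal.tsum_prod', wnorm, wnorm, ← ENNReal.tsum_mul_right]
    simp_rw [ENNReal.tsum_mul_left]
  rw [h1, ← Finset.HasAntidiagonal.sigmaAntidiagonalEquivProd.tsum_eq, ENNReal.tsum_sigma', wnorm]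
  refine ENNReal.tsum_le_tsum fun α => ?_
  simp only [Finset.HasAntidiagonal.sigmaAntidiagonalEquivProd_apply]
  rw [tsum_fintype, coeff_mul, Finset.sum_coe_sort (Finset.HasAntidiagonal.antidiagonal α)
    (fun p => (‖coeff p.1 f‖ₑ * mon ρ p.1) * (‖coeff p.2 g‖ₑ * mon ρ p.2))]
  calc _ ≤ (∑ p ∈ Finset.HasAntidiagonal.antidiagonal α, ‖coeff p.1 f * coeff p.2 g‖ₑ) * mon ρ α := by
        gcongr; exact enorm_sum_le _ _
    _ = _ := by
        rw [Finset.sum_mul]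
        refine Finset.sum_congr rfl fun p hp => ?_
        rw [← Finset.HasAntidiagonal.mem_antidiagonal.mp hp, mon_add, enorm_mul]
        ring

lemma wnorm_prod_le {κ : Type*} (ρ : σ → ℝ≥0∞) (s : Finset κ) (f : κ → MvPowerSeries σ ℝ) :
    wnorm ρ (∏ i ∈ s, f i) ≤ ∏ i ∈ s, wnorm ρ (f i) := by
  classical
  induction s using Finset.induction_on with
  | empty => simp [wnorm_one]
  | insert i s hi ih =>
    rw [Finset.prod_insert hi, Finset.prod_insert hi]
    exact (wnorm_mul_le _ _ _).trans (by gcongr)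

lemma wnorm_sum_le {κ : Type*} (ρ : σ → ℝ≥0∞) (s : Finset κ) (f : κ → MvPowerSeries σ ℝ) :
    wnorm ρ (∑ i ∈ s, f i) ≤ ∑ i ∈ s, wnorm ρ (f i) := by
  classical
  induction s using Finset.induction_on with
  | empty => simp [wnorm_zero]
  | insert i s hi ih =>
    rw [Finset.sum_insert hi, Finset.sum_insert hi]
    exact (wnorm_add_le _ _ _).trans (by gcongr)

lemma wnorm_pow_le (ρ : σ → ℝ≥0∞) (f : MvPowerSeries σ ℝ) (n : ℕ) :
    wnorm ρ (f ^ n) ≤ wnorm ρ f ^ n := by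
  simpa using wnorm_prod_le ρ (Finset.range n) fun _ => f

lemma wnorm_finsuppProd_le (ρ : τ → ℝ≥0∞) (a : σ → MvPowerSeries τ ℝ) (α : σ →₀ ℕ) :
    wnorm ρ (α.prod fun i k => a i ^ k) ≤ mon (fun i => wnorm ρ (a i)) α :=
  (wnorm_prod_le _ _ _).trans (Finset.prod_le_prod' fun _ _ => wnorm_pow_le _ _ _)

lemma enorm_coeff_subst_le {a : σ → MvPowerSeries τ ℝ} (ha : HasSubst a) (f : MvPowerSeries σ ℝ)
    (β : τ →₀ ℕ) : ‖coeff β (subst a f)‖ₑ ≤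
      ∑' α, ‖coeff α f‖ₑ * ‖coeff β (α.prod fun i k => a i ^ k)‖ₑ := by
  rw [coeff_subst ha, finsum_eq_sum _ (coeff_subst_finite ha f β)]
  refine (enorm_sum_le _ _).trans ?_
  simp_rw [smul_eq_mul, enorm_mul]
  exact ENNReal.sum_le_tsum _

/-- The weighted norm of a composite is dominated by the norm of the outer series, with the
norms of the inner series as weights. -/
lemma wnorm_subst_le (ρ : τ → ℝ≥0∞) {a : σ → MvPowerSeries τ ℝ} (ha : HasSubst a)
    (f : MvPowerSeries σ ℝ) : wnorm ρ (subst a f) ≤ wnorm (fun i => wnorm ρ (a i)) f := by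
  calc wnorm ρ (subst a f)
      ≤ ∑' β, (∑' α, ‖coeff α f‖ₑ * ‖coeff β (α.prod fun i k => a i ^ k)‖ₑ) * mon ρ β :=
        ENNReal.tsum_le_tsum fun β => by gcongr; exact enorm_coeff_subst_le ha f β
    _ = ∑' α, ‖coeff α f‖ₑ * wnorm ρ (α.prod fun i k => a i ^ k) := by
        simp_rw [← ENNReal.tsum_mul_right]
        rw [ENNReal.tsum_comm]
        simp_rw [mul_assoc, ENNReal.tsum_mul_left]
        rfl
    _ ≤ _ := ENNReal.tsum_le_tsum fun α => by gcongr; exact wnorm_finsuppProd_le ρ a α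

end WeightedNorm

section Convergent

variable {σ τ ι : Type*}

/-- A real power series is convergent if its weighted `ℓ¹`-norm is finite for some positive
polyradius. -/
def Conv (f : MvPowerSeries σ ℝ) : Prop := ∃ r : ℝ≥0∞, r ≠ 0 ∧ wnorm (fun _ => r) f ≠ ⊤

lemma Conv.exists_small {f : MvPowerSeries σ ℝ} (hf : Conv f) :
    ∃ r : ℝ≥0∞, r ≠ 0 ∧ r ≤ 1 ∧ ∀ s ≤ r, wnorm (fun _ => s) f ≠ ⊤ := by
  obtain ⟨r, h0, hr⟩ := hf
  exact ⟨min r 1, by simp [h0], min_le_right _ _, fun s hs => ne_top_of_le_ne_top hr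
    (wnorm_mono (fun _ => hs.trans (min_le_left _ _)) f)⟩

lemma exists_common {κ : Type*} [Finite κ] {p : κ → ℝ≥0∞ → Prop}
    (h : ∀ i, ∃ r : ℝ≥0∞, r ≠ 0 ∧ r ≤ 1 ∧ ∀ s ≤ r, p i s) :
    ∃ r : ℝ≥0∞, r ≠ 0 ∧ r ≤ 1 ∧ ∀ s ≤ r, ∀ i, p i s := by
  cases nonempty_fintype κ
  choose r h0 h1 hr using h
  refine ⟨Finset.univ.inf r ⊓ 1, ?_, inf_le_right, fun s hs i => hr i s
    (hs.trans (inf_le_left.trans (Finset.inf_le (Finset.mem_univ i))))⟩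
  rw [← pos_iff_ne_zero, lt_inf_iff]
  refine ⟨?_, one_pos⟩
  rw [Finset.lt_inf_iff (by simp)]
  exact fun i _ => pos_iff_ne_zero.mpr (h0 i)

lemma Conv.of_bound {f : MvPowerSeries σ ℝ} (ρ : σ → ℝ≥0∞) [Finite σ] (h0 : ∀ i, ρ i ≠ 0)
    (h : wnorm ρ f ≠ ⊤) : Conv f := by
  obtain ⟨r, hr0, -, hr⟩ := exists_common (p := fun i s => s ≤ ρ i) fun i =>
    ⟨min (ρ i) 1, by simp [h0 i], min_le_right _ _, fun s hs => hs.trans (min_le_left _ _)⟩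
  exact ⟨r, hr0, ne_top_of_le_ne_top h (wnorm_mono (hr r le_rfl) f)⟩

lemma Conv.add {f g : MvPowerSeries σ ℝ} (hf : Conv f) (hg : Conv g) : Conv (f + g) := by
  obtain ⟨r, h0, -, hr⟩ := hf.exists_small
  obtain ⟨s, h0', -, hs⟩ := hg.exists_small
  exact ⟨min r s, by simp [h0, h0'], ne_top_of_le_ne_top (ENNReal.add_ne_top.mpr
    ⟨hr _ (min_le_left _ _), hs _ (min_le_right _ _)⟩) (wnorm_add_le _ f g)⟩

lemma Conv.mul {f g : MvPowerSeries σ ℝ} (hf : Conv f) (hg : Conv g) : Conv (f * g) := by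
  obtain ⟨r, h0, -, hr⟩ := hf.exists_small
  obtain ⟨s, h0', -, hs⟩ := hg.exists_small
  exact ⟨min r s, by simp [h0, h0'], ne_top_of_le_ne_top (ENNReal.mul_ne_top
    (hr _ (min_le_left _ _)) (hs _ (min_le_right _ _))) (wnorm_mul_le _ f g)⟩

lemma conv_C (r : ℝ) : Conv (C r : MvPowerSeries σ ℝ) :=
  ⟨1, one_ne_zero, by simp [wnorm_C]⟩

variable (σ) in
/-- The algebra of convergent power series. -/
def convergent : Subalgebra ℝ (MvPowerSeries σ ℝ) where
  carrier := {f | Conv f}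
  mul_mem' := Conv.mul
  add_mem' := Conv.add
  algebraMap_mem' r := conv_C r

lemma conv_X (i : σ) : Conv (X i : MvPowerSeries σ ℝ) :=
  ⟨1, one_ne_zero, by simp [wnorm_X]⟩

lemma conv_zero : Conv (0 : MvPowerSeries σ ℝ) := (convergent σ).zero_mem
lemma conv_one : Conv (1 : MvPowerSeries σ ℝ) := (convergent σ).one_mem
lemma Conv.neg {f : MvPowerSeries σ ℝ} (hf : Conv f) : Conv (-f) := (convergent σ).neg_mem hf
lemma Conv.sub {f g : MvPowerSeries σ ℝ} (hf : Conv f) (hg : Conv g) : Conv (f - g) :=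
  (convergent σ).sub_mem hf hg
lemma Conv.pow {f : MvPowerSeries σ ℝ} (hf : Conv f) (n : ℕ) : Conv (f ^ n) :=
  (convergent σ).pow_mem hf n
lemma conv_sum {κ : Type*} {s : Finset κ} {f : κ → MvPowerSeries σ ℝ} (hf : ∀ i ∈ s, Conv (f i)) :
    Conv (∑ i ∈ s, f i) := (convergent σ).sum_mem hf

lemma conv_coe (p : MvPolynomial σ ℝ) : Conv (p : MvPowerSeries σ ℝ) := by
  induction p using MvPolynomial.induction_on with
  | C r => simpa using conv_C r
  | add p q hp hq => simpa using hp.add hq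
  | mul_X p i hp => simpa using hp.mul (conv_X i)

lemma conv_det {κ : Type*} [Fintype κ] [DecidableEq κ] {A : Matrix κ κ (MvPowerSeries σ ℝ)}
    (hA : ∀ i j, Conv (A i j)) : Conv A.det := by
  rw [Matrix.det_apply]
  refine conv_sum fun s _ => ?_
  have h : Conv (∏ i, A (s i) i) := (convergent σ).prod_mem fun i _ => hA _ _
  rcases Int.units_eq_one_or (Equiv.Perm.sign s) with h1 | h1
  · simpa [h1] using h
  · simpa [h1] using h.neg

lemma conv_adjugate {κ : Type*} [Fintype κ] [DecidableEq κ]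
    {A : Matrix κ κ (MvPowerSeries σ ℝ)} (hA : ∀ i j, Conv (A i j)) (i j : κ) :
    Conv (A.adjugate i j) := by
  rw [Matrix.adjugate_apply]
  refine conv_det fun k l => ?_
  rw [Matrix.updateRow_apply]
  split_ifs
  · rw [Pi.single_apply]
    split_ifs
    · exact conv_one
    · exact conv_zero
  · exact hA k l

lemma one_le_order_of_constantCoeff {f : MvPowerSeries σ ℝ} (h : constantCoeff f = 0) :
    ((1 : ℕ) : ℕ∞) ≤ f.order := by
  simpa using one_le_order_iff_constCoeff_eq_zero.mpr h

/-- A convergent power series without constant term is small on small polydiscs. -/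
lemma Conv.exists_wnorm_le {f : MvPowerSeries σ ℝ} (hf : Conv f) (h0 : constantCoeff f = 0)
    {ε : ℝ≥0∞} (hε : ε ≠ 0) :
    ∃ r : ℝ≥0∞, r ≠ 0 ∧ r ≤ 1 ∧ ∀ s ≤ r, wnorm (fun _ => s) f ≤ ε := by
  obtain ⟨r, hr0, hr1, hr⟩ := hf.exists_small
  obtain ⟨c, hc0, hc1⟩ : ∃ c : ℝ≥0∞, c ≠ 0 ∧ c ≤ 1 ∧ c * wnorm (fun _ => r) f ≤ ε := by
    have hN := hr r le_rfl
    refine ⟨min 1 (ε / wnorm (fun _ => r) f), ?_, min_le_left _ _, ?_⟩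
    · rw [← pos_iff_ne_zero, lt_min_iff]
      exact ⟨one_pos, ENNReal.div_pos hε hN⟩
    · calc _ ≤ ε / wnorm (fun _ => r) f * wnorm (fun _ => r) f := by
            gcongr; exact min_le_right _ _
        _ ≤ ε := by rw [mul_comm]; exact ENNReal.mul_div_le
  refine ⟨c * r, mul_ne_zero hc0 hr0, mul_le_one' hc1.1 hr1, fun s hs => ?_⟩
  calc _ ≤ wnorm (fun _ => c * r) f := wnorm_mono (fun _ => hs) f
    _ ≤ c ^ 1 * wnorm (fun _ => r) f :=
        wnorm_scale_le c hc1.1 _ (one_le_order_of_constantCoeff h0)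
    _ ≤ ε := by simpa using hc1.2

lemma Conv.subst [Finite σ] {f : MvPowerSeries σ ℝ} (hf : Conv f) {a : σ → MvPowerSeries τ ℝ}
    (ha : ∀ i, Conv (a i)) (ha0 : ∀ i, constantCoeff (a i) = 0) :
    Conv (MvPowerSeries.subst a f) := by
  obtain ⟨r, hr0, hr⟩ := hf
  obtain ⟨s, hs0, -, hs⟩ := exists_common fun i => (ha i).exists_wnorm_le (ha0 i) hr0
  exact ⟨s, hs0, ne_top_of_le_ne_top hr ((wnorm_subst_le _
    (hasSubst_of_constantCoeff_zero ha0) f).trans (wnorm_mono (hs s le_rfl) f))⟩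

lemma enorm_natCast_succ_mul_pow_le (k n : ℕ) (h : k ≤ n) :
    ‖((k : ℝ) + 1)‖ₑ * (2⁻¹ : ℝ≥0∞) ^ n ≤ 1 := by
  have h1 : ‖((k : ℝ) + 1)‖ₑ = ((k + 1 : ℕ) : ℝ≥0∞) := by
    rw [Real.enorm_of_nonneg (by positivity), ← ENNReal.ofReal_natCast]
    push_cast
    rfl
  have h2 : ((k + 1 : ℕ) : ℝ≥0∞) ≤ 2 ^ n := by
    have : k + 1 ≤ 2 ^ n := (Nat.lt_two_pow_self (n := k)).trans_le (Nat.pow_le_pow_right two_pos h)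
    exact_mod_cast this
  rw [h1]
  calc _ ≤ (2 : ℝ≥0∞) ^ n * 2⁻¹ ^ n := by gcongr
    _ = 1 := by rw [← mul_pow, ENNReal.mul_inv_cancel (by simp) (by simp), one_pow]

lemma Conv.pderiv {f : MvPowerSeries σ ℝ} (hf : Conv f) (i : σ) :
    Conv (MvPowerSeries.pderiv ℝ i f) := by
  obtain ⟨r, h0, hr1, hr⟩ := hf.exists_small
  have hrt : r ≠ ⊤ := ne_top_of_le_ne_top ENNReal.one_ne_top hr1
  refine ⟨2⁻¹ * r, by simp [h0], ne_top_of_le_ne_top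
    (ENNReal.mul_ne_top (ENNReal.inv_ne_top.mpr h0) (hr r le_rfl)) ?_⟩
  calc _ ≤ ∑' α : σ →₀ ℕ, r⁻¹ *
        (‖coeff (α + Finsupp.single i 1) f‖ₑ * mon (fun _ => r) (α + Finsupp.single i 1)) := by
        refine ENNReal.tsum_le_tsum fun α => ?_
        rw [mon_const, mon_add, mon_const, mon_single, coeff_pderiv, enorm_mul, mul_pow, pow_one]
        have h1 : r⁻¹ * r = 1 := ENNReal.inv_mul_cancel h0 hrt
        calc _ = (‖coeff (α + Finsupp.single i 1) f‖ₑ * r ^ α.degree) *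
              (‖((α i : ℝ) + 1)‖ₑ * 2⁻¹ ^ α.degree) := by ring
          _ ≤ (‖coeff (α + Finsupp.single i 1) f‖ₑ * r ^ α.degree) * 1 := by
              gcongr
              exact enorm_natCast_succ_mul_pow_le _ _ (Finsupp.le_degree i α)
          _ = (‖coeff (α + Finsupp.single i 1) f‖ₑ * r ^ α.degree) * (r⁻¹ * r) := by rw [h1]
          _ = _ := by ring
    _ ≤ _ := by
        rw [ENNReal.tsum_mul_left]
        gcongr
        exact ENNReal.tsum_comp_le_tsum_of_injective
          (f := fun α : σ →₀ ℕ => α + Finsupp.single i 1) (add_left_injective _)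
          (fun α => ‖coeff α f‖ₑ * mon (fun _ => r) α)

end Convergent

end ArtinApprox

namespace ArtinApprox

open MvPowerSeries
open scoped ENNReal

section Ideals

variable {σ τ ι : Type*}

/-- The ideal of power series all of whose monomials have `w`-weight at least `n`. -/
def wIdeal (w : σ → ℕ) (n : ℕ) : Ideal (MvPowerSeries σ ℝ) where
  carrier := {f | ∀ α, Finsupp.weight w α < n → coeff α f = 0}
  add_mem' hf hg α hα := by rw [map_add, hf α hα, hg α hα, add_zero]
  zero_mem' := by simp
  smul_mem' c f hf α hα := by
    classical
    rw [smul_eq_mul, coeff_mul]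
    refine Finset.sum_eq_zero fun p hp => ?_
    rw [hf p.2, mul_zero]
    rw [← Finset.HasAntidiagonal.mem_antidiagonal.mp hp, map_add] at hα
    omega

/-- The `n`-th power of the maximal ideal, described through orders. -/
abbrev oIdeal (σ : Type*) (n : ℕ) : Ideal (MvPowerSeries σ ℝ) := wIdeal (fun _ => 1) n

lemma mem_wIdeal {w : σ → ℕ} {n : ℕ} {f : MvPowerSeries σ ℝ} :
    f ∈ wIdeal w n ↔ ∀ α, Finsupp.weight w α < n → coeff α f = 0 := Iff.rfl

lemma weight_one_eq_degree (α : σ →₀ ℕ) : Finsupp.weight (fun _ => 1) α = α.degree := by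
  simp [Finsupp.weight_apply, Finsupp.degree_apply, Finsupp.sum]

lemma mem_oIdeal {n : ℕ} {f : MvPowerSeries σ ℝ} :
    f ∈ oIdeal σ n ↔ ∀ α : σ →₀ ℕ, α.degree < n → coeff α f = 0 := by
  simp [mem_wIdeal, weight_one_eq_degree]

lemma mem_wIdeal_iff_le {w : σ → ℕ} {n : ℕ} {f : MvPowerSeries σ ℝ} :
    f ∈ wIdeal w n ↔ n ≤ f.weightedOrder w :=
  ⟨nat_le_weightedOrder w, fun h _ hα => coeff_eq_zero_of_lt_weightedOrder w
    (lt_of_lt_of_le (by exact_mod_cast hα) h)⟩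

lemma wIdeal_anti {w : σ → ℕ} {m n : ℕ} (h : m ≤ n) : wIdeal w n ≤ wIdeal w m :=
  fun _ hf α hα => hf α (hα.trans_le h)

lemma mem_wIdeal_zero {w : σ → ℕ} (f : MvPowerSeries σ ℝ) : f ∈ wIdeal w 0 :=
  fun _ hα => absurd hα (Nat.not_lt_zero _)

lemma mul_mem_wIdeal {w : σ → ℕ} {m n : ℕ} {f g : MvPowerSeries σ ℝ} (hf : f ∈ wIdeal w m)
    (hg : g ∈ wIdeal w n) : f * g ∈ wIdeal w (m + n) := by
  classical
  intro α hα
  rw [coeff_mul]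
  refine Finset.sum_eq_zero fun p hp => ?_
  rw [← Finset.HasAntidiagonal.mem_antidiagonal.mp hp, map_add] at hα
  by_cases h : Finsupp.weight w p.1 < m
  · rw [hf _ h, zero_mul]
  · rw [hg p.2 (by omega), mul_zero]

lemma pow_mem_wIdeal {w : σ → ℕ} {m : ℕ} {f : MvPowerSeries σ ℝ} (hf : f ∈ wIdeal w m) (k : ℕ) :
    f ^ k ∈ wIdeal w (k * m) := by
  induction k with
  | zero => simpa using mem_wIdeal_zero _
  | succ k ih =>
    rw [pow_succ, Nat.succ_mul]
    exact mul_mem_wIdeal ih hf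

lemma prod_mem_wIdeal {κ : Type*} {w : σ → ℕ} (s : Finset κ) {m : κ → ℕ}
    {f : κ → MvPowerSeries σ ℝ} (hf : ∀ i ∈ s, f i ∈ wIdeal w (m i)) :
    ∏ i ∈ s, f i ∈ wIdeal w (∑ i ∈ s, m i) := by
  classical
  induction s using Finset.induction_on with
  | empty => simpa using mem_wIdeal_zero _
  | insert i s hi ih =>
    rw [Finset.prod_insert hi, Finset.sum_insert hi]
    exact mul_mem_wIdeal (hf i (Finset.mem_insert_self _ _))
      (ih fun j hj => hf j (Finset.mem_insert_of_mem hj))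

lemma eq_zero_of_forall_mem {w : σ → ℕ} {f : MvPowerSeries σ ℝ} (h : ∀ n, f ∈ wIdeal w n) :
    f = 0 := by
  ext α
  simpa using h (Finsupp.weight w α + 1) α (Nat.lt_succ_self _)

lemma mem_oIdeal_one {f : MvPowerSeries σ ℝ} : f ∈ oIdeal σ 1 ↔ constantCoeff f = 0 := by
  rw [mem_oIdeal, ← coeff_zero_eq_constantCoeff_apply]
  refine ⟨fun h => h 0 (by simp), fun h α hα => ?_⟩
  rw [Nat.lt_one_iff, Finsupp.degree_eq_zero_iff] at hα
  rw [hα, h]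

lemma constantCoeff_of_mem_wIdeal {w : σ → ℕ} {n : ℕ} {f : MvPowerSeries σ ℝ}
    (h : f ∈ wIdeal w (n + 1)) : constantCoeff f = 0 := by
  rw [← coeff_zero_eq_constantCoeff_apply]
  exact h 0 (by simp)

lemma X_mem_wIdeal (w : σ → ℕ) (i : σ) : (X i : MvPowerSeries σ ℝ) ∈ wIdeal w (w i) := by
  classical
  intro α hα
  rw [coeff_X, if_neg]
  rintro rfl
  simp [Finsupp.weight_single] at hα

lemma subst_mem_wIdeal {w : σ → ℕ} {w' : τ → ℕ} {n : ℕ} {a : σ → MvPowerSeries τ ℝ}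
    (ha : HasSubst a) (haw : ∀ i, a i ∈ wIdeal w' (w i)) {f : MvPowerSeries σ ℝ}
    (hf : f ∈ wIdeal w n) : subst a f ∈ wIdeal w' n := by
  intro β hβ
  rw [coeff_subst ha]
  refine finsum_eq_zero_of_forall_eq_zero fun α => ?_
  by_cases h : Finsupp.weight w α < n
  · rw [hf α h, zero_smul]
  · have : (α.prod fun i k => a i ^ k) ∈ wIdeal w' (Finsupp.weight w α) := by
      rw [Finsupp.weight_apply]
      exact prod_mem_wIdeal _ fun i _ => pow_mem_wIdeal (haw i) _
    rw [this β (by omega), smul_zero]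

lemma subst_mem_oIdeal [Finite σ] {n : ℕ} {a : σ → MvPowerSeries τ ℝ}
    (ha : ∀ i, constantCoeff (a i) = 0) {f : MvPowerSeries σ ℝ} (hf : f ∈ oIdeal σ n) :
    subst a f ∈ oIdeal τ n :=
  subst_mem_wIdeal (hasSubst_of_constantCoeff_zero ha) (fun i => mem_oIdeal_one.mpr (ha i)) hf

lemma pderiv_mem_oIdeal {n : ℕ} {f : MvPowerSeries σ ℝ} (hf : f ∈ oIdeal σ (n + 1)) (i : σ) :
    pderiv ℝ i f ∈ oIdeal σ n := by
  rw [mem_oIdeal] at *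
  intro α hα
  rw [coeff_pderiv, hf _ (by simpa using hα), zero_mul]

lemma exists_polynomial_sub_mem [Finite σ] (f : MvPowerSeries σ ℝ) (n : ℕ) :
    ∃ p : MvPolynomial σ ℝ, f - p ∈ oIdeal σ n := by
  refine ⟨truncTotal n f, mem_oIdeal.mpr fun α hα => ?_⟩
  rw [map_sub, MvPolynomial.coeff_coe, coeff_truncTotal _ hα, sub_self]

end Ideals

section Taylor

variable {σ τ ι κ : Type}

/-- Substitution of power series without constant term, as an algebra homomorphism. -/
def sb [Finite σ] {a : σ → MvPowerSeries τ ℝ} (ha : ∀ i, constantCoeff (a i) = 0) :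
    MvPowerSeries σ ℝ →ₐ[ℝ] MvPowerSeries τ ℝ :=
  substAlgHom (hasSubst_of_constantCoeff_zero ha)

lemma algebraMap_eq_C (r : ℝ) : algebraMap ℝ (MvPowerSeries σ ℝ) r = C r := rfl

lemma sb_apply [Finite σ] {a : σ → MvPowerSeries τ ℝ} (ha : ∀ i, constantCoeff (a i) = 0)
    (f : MvPowerSeries σ ℝ) : sb ha f = subst a f := by
  rw [sb, coe_substAlgHom]

lemma sb_X [Finite σ] {a : σ → MvPowerSeries τ ℝ} (ha : ∀ i, constantCoeff (a i) = 0)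
    (i : σ) : sb ha (X i) = a i := by
  rw [sb_apply, subst_X (hasSubst_of_constantCoeff_zero ha)]

lemma constantCoeff_sb [Finite σ] {a : σ → MvPowerSeries τ ℝ} (ha : ∀ i, constantCoeff (a i) = 0)
    (f : MvPowerSeries σ ℝ) : constantCoeff (sb ha f) = constantCoeff f := by
  have h1 : f - C (constantCoeff f) ∈ oIdeal σ 1 := mem_oIdeal_one.mpr (by simp)
  have h2 := mem_oIdeal_one.mp (subst_mem_oIdeal ha h1)
  rw [← sb_apply ha, map_sub, map_sub, sub_eq_zero] at h2
  rw [h2, ← algebraMap_eq_C, AlgHom.commutes, algebraMap_eq_C, constantCoeff_C]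

lemma subst_subst [Finite σ] [Finite τ] {a : σ → MvPowerSeries τ ℝ}
    (ha : ∀ i, constantCoeff (a i) = 0) {b : τ → MvPowerSeries κ ℝ}
    (hb : ∀ i, constantCoeff (b i) = 0) (f : MvPowerSeries σ ℝ) :
    subst b (subst a f) = subst (fun i => subst b (a i)) f :=
  subst_comp_subst_apply (hasSubst_of_constantCoeff_zero ha) (hasSubst_of_constantCoeff_zero hb) f

lemma constantCoeff_subst' [Finite σ] {a : σ → MvPowerSeries τ ℝ}
    (ha : ∀ i, constantCoeff (a i) = 0) (f : MvPowerSeries σ ℝ) :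
    constantCoeff (subst a f) = constantCoeff f := by rw [← sb_apply ha, constantCoeff_sb]

lemma pderiv_subst [Fintype σ] {a : σ → MvPowerSeries τ ℝ} (ha : ∀ i, constantCoeff (a i) = 0)
    (f : MvPowerSeries σ ℝ) (k : τ) :
    pderiv ℝ k (subst a f) = ∑ i, subst a (pderiv ℝ i f) * pderiv ℝ k (a i) := by
  classical
  rw [← sub_eq_zero]
  simp only [← sb_apply ha]
  have hpoly : ∀ p : MvPolynomial σ ℝ, pderiv ℝ k (sb ha (p : MvPowerSeries σ ℝ)) =
      ∑ i, sb ha (pderiv ℝ i (p : MvPowerSeries σ ℝ)) * pderiv ℝ k (a i) := by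
    intro p
    induction p using MvPolynomial.induction_on with
    | C r =>
      have h : ((MvPolynomial.C r : MvPolynomial σ ℝ) : MvPowerSeries σ ℝ) =
        algebraMap ℝ _ r := by rw [algebraMap_eq_C, MvPolynomial.coe_C]
      simp only [h, AlgHom.commutes, Derivation.map_algebraMap, map_zero, zero_mul,
        Finset.sum_const_zero]
    | add p q hp hq =>
      simp only [MvPolynomial.coe_add, map_add, hp, hq, add_mul, Finset.sum_add_distrib]
    | mul_X p i hp =>
      simp only [MvPolynomial.coe_mul, MvPolynomial.coe_X, map_mul, Derivation.leibniz,
        smul_eq_mul, map_add, sb_X, hp, add_mul, Finset.sum_add_distrib, Finset.mul_sum]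
      congr 1
      · rw [Finset.sum_eq_single i]
        · simp
        · intro j _ hj
          simp [pderiv_X_of_ne hj.symm]
        · simp
      · exact Finset.sum_congr rfl fun j _ => by ring
  refine eq_zero_of_forall_mem (w := fun _ => 1) fun n => ?_
  obtain ⟨p, hp⟩ := exists_polynomial_sub_mem f (n + 1)
  have hf : f = p + (f - p) := by ring
  rw [hf]
  simp only [map_add, add_mul, Finset.sum_add_distrib, hpoly]
  rw [add_sub_add_left_eq_sub]
  refine Ideal.sub_mem _ (pderiv_mem_oIdeal ?_ k) (Ideal.sum_mem _ fun i _ =>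
    Ideal.mul_mem_right _ _ ?_)
  · rw [sb_apply]
    exact subst_mem_oIdeal ha hp
  · rw [sb_apply]
    exact subst_mem_oIdeal ha (pderiv_mem_oIdeal hp i)

lemma exists_split [Finite κ] [Fintype ι] (f : MvPowerSeries (κ ⊕ ι) ℝ) :
    ∃ F : ι → MvPowerSeries (κ ⊕ ι) ℝ, (Conv f → ∀ j, Conv (F j)) ∧
      f = rename Sum.inl (killCompl (Function.Embedding.inl) f) + ∑ j, X (Sum.inr j) * F j := by
  classical
  let P : (κ ⊕ ι →₀ ℕ) → ι → Prop := fun α j => α (Sum.inr j) ≠ 0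
  let ch : (κ ⊕ ι →₀ ℕ) → Option ι := fun α => if h : ∃ j, P α j then some h.choose else none
  have hch : ∀ α j, ch α = some j → α (Sum.inr j) ≠ 0 := by
    intro α j h
    simp only [ch] at h
    split_ifs at h with h'
    simp only [Option.some.injEq] at h
    exact h ▸ h'.choose_spec
  let F : ι → MvPowerSeries (κ ⊕ ι) ℝ := fun j β =>
    if ch (β + Finsupp.single (Sum.inr j) 1) = some j then
      coeff (β + Finsupp.single (Sum.inr j) 1) f else 0
  have hF : ∀ j β, coeff β (F j) = if ch (β + Finsupp.single (Sum.inr j) 1) = some j then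
      coeff (β + Finsupp.single (Sum.inr j) 1) f else 0 := fun j β => rfl
  have hXF : ∀ j α, coeff α (X (Sum.inr j) * F j) = if ch α = some j then coeff α f else 0 := by
    intro j α
    rw [X, coeff_monomial_mul]
    by_cases h : α (Sum.inr j) = 0
    · rw [if_neg, if_neg]
      · exact fun h' => hch α j h' h
      · simp [h]
    · have hle : Finsupp.single (Sum.inr j) 1 ≤ α := by
        simpa using Nat.one_le_iff_ne_zero.mpr h
      rw [if_pos hle, one_mul, hF, tsub_add_cancel_of_le hle]
  refine ⟨F, fun hf j => ?_, ?_⟩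
  · obtain ⟨r, h0, hr1, hr⟩ := hf.exists_small
    have hrt : r ≠ ⊤ := ne_top_of_le_ne_top ENNReal.one_ne_top hr1
    refine ⟨r, h0, ne_top_of_le_ne_top (ENNReal.mul_ne_top (ENNReal.inv_ne_top.mpr h0)
      (hr r le_rfl)) ?_⟩
    calc _ ≤ ∑' α : κ ⊕ ι →₀ ℕ, r⁻¹ * (‖coeff (α + Finsupp.single (Sum.inr j) 1) f‖ₑ *
          mon (fun _ => r) (α + Finsupp.single (Sum.inr j) 1)) := by
          refine ENNReal.tsum_le_tsum fun α => ?_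
          rw [hF, mon_add, mon_single, pow_one]
          split_ifs
          · rw [mul_comm (mon _ _), mul_left_comm, ← mul_assoc r⁻¹ r,
              ENNReal.inv_mul_cancel h0 hrt, one_mul]
          · simp
      _ ≤ _ := by
          rw [ENNReal.tsum_mul_left]
          gcongr
          exact ENNReal.tsum_comp_le_tsum_of_injective
            (f := fun α : κ ⊕ ι →₀ ℕ => α + Finsupp.single (Sum.inr j) 1) (add_left_injective _)
            (fun α => ‖coeff α f‖ₑ * mon (fun _ => r) α)
  · ext α
    rw [map_add, map_sum]
    simp only [hXF]
    by_cases h : ∃ j, P α j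
    · have h1 : ch α = some h.choose := by simp [ch, h]
      have h2 : coeff α (rename Sum.inl (killCompl Function.Embedding.inl f)) = 0 := by
        refine coeff_rename_eq_zero _ _ ?_
        rintro ⟨β, rfl⟩
        refine h.choose_spec (Finsupp.mapDomain_of_notMem_range _ _ (by simp))
      rw [h2, zero_add, Finset.sum_eq_single h.choose]
      · simp [h1]
      · intro j _ hj
        rw [if_neg]
        rw [h1]
        simpa using hj.symm
      · simp
    · have h1 : ch α = none := by simp [ch, h]
      have h2 : ∃ β : κ →₀ ℕ, Finsupp.embDomain Function.Embedding.inl β = α := by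
        refine ⟨α.comapDomain Sum.inl Sum.inl_injective.injOn, ?_⟩
        ext (i | j)
        · exact (Finsupp.embDomain_apply_self Function.Embedding.inl _ i).trans (by simp)
        · rw [Finsupp.embDomain_of_notMem_range _ _ _ (by simp)]
          by_contra h'
          exact h ⟨j, fun h0 => h' h0.symm⟩
      obtain ⟨β, hβ⟩ := h2
      simp only [h1, reduceCtorEq, if_false, Finset.sum_const_zero, add_zero]
      rw [← hβ]
      exact (((coeff_embDomain_rename Function.Embedding.inl _ β).trans (coeff_killCompl _ _))).symm

end Taylor
end ArtinApprox

namespace ArtinApprox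

open MvPowerSeries
open scoped ENNReal

section Taylor

variable {σ τ ι κ : Type}

lemma constantCoeff_sumElim {x : σ → MvPowerSeries κ ℝ} {w : τ → MvPowerSeries κ ℝ}
    (hx : ∀ i, constantCoeff (x i) = 0) (hw : ∀ i, constantCoeff (w i) = 0) (k : σ ⊕ τ) :
    constantCoeff (Sum.elim x w k) = 0 := by
  rcases k with i | i
  · exact hx i
  · exact hw i

lemma rename_eq_sb [Finite σ] (e : σ → τ) (f : MvPowerSeries σ ℝ) :
    rename e f = subst (fun i => X (e i) : σ → MvPowerSeries τ ℝ) f := rename_eq_subst e f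

lemma subst_rename [Finite σ] [Finite τ] (e : σ → τ) {a : τ → MvPowerSeries κ ℝ}
    (ha : ∀ i, constantCoeff (a i) = 0) (f : MvPowerSeries σ ℝ) :
    subst a (rename e f) = subst (fun i => a (e i)) f := by
  rw [rename_eq_sb, subst_subst (by simp) ha]
  simp only [subst_X (hasSubst_of_constantCoeff_zero ha)]

lemma subst_X_eq_self (f : MvPowerSeries σ ℝ) :
    subst (fun i => X i : σ → MvPowerSeries σ ℝ) f = f := congrFun subst_self f

lemma exists_taylor_one [Fintype σ] (f : MvPowerSeries σ ℝ) :
    ∃ F : σ → MvPowerSeries (σ ⊕ σ) ℝ, (Conv f → ∀ j, Conv (F j)) ∧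
      ∀ (τ : Type) (x w : σ → MvPowerSeries τ ℝ), (∀ i, constantCoeff (x i) = 0) →
        (∀ i, constantCoeff (w i) = 0) → subst (fun i => x i + w i) f =
          subst x f + ∑ j, w j * subst (Sum.elim x w) (F j) := by
  have h0 : ∀ i : σ, constantCoeff (X (Sum.inl i) + X (Sum.inr i) : MvPowerSeries (σ ⊕ σ) ℝ) = 0 :=
    by simp
  obtain ⟨F, hF, h⟩ := exists_split (subst (fun i : σ =>
    (X (Sum.inl i) + X (Sum.inr i) : MvPowerSeries (σ ⊕ σ) ℝ)) f)
  refine ⟨F, fun hf => hF (hf.subst (fun i => (conv_X _).add (conv_X _)) h0),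
    fun τ x w hx hw => ?_⟩
  have hz : ∀ i : σ, constantCoeff ((0 : σ → MvPowerSeries τ ℝ) i) = 0 := by simp
  have key : ∀ y : σ → MvPowerSeries τ ℝ, (∀ i, constantCoeff (y i) = 0) →
      subst (fun i => x i + y i) f = subst x (killCompl Function.Embedding.inl
        (subst (fun i : σ => (X (Sum.inl i) + X (Sum.inr i) : MvPowerSeries (σ ⊕ σ) ℝ)) f)) +
        ∑ j, y j * subst (Sum.elim x y) (F j) := by
    intro y hy
    have := congrArg (subst (Sum.elim x y)) h
    have hxy := constantCoeff_sumElim hx hy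
    rw [subst_subst h0 hxy] at this
    simp only [← sb_apply hxy, map_add, map_sum, map_mul, sb_X] at this
    simp only [sb_apply] at this
    rw [subst_rename _ hxy] at this
    exact this
  have h1 := key w hw
  have h2 := key 0 hz
  simp only [Pi.zero_apply, add_zero, zero_mul, Finset.sum_const_zero] at h2
  rw [h1, ← h2]

lemma subst_sub_subst_mem [Finite σ] (I : Ideal (MvPowerSeries τ ℝ)) {x y : σ → MvPowerSeries τ ℝ}
    (hx : ∀ i, constantCoeff (x i) = 0) (hy : ∀ i, constantCoeff (y i) = 0)
    (h : ∀ i, x i - y i ∈ I) (f : MvPowerSeries σ ℝ) : subst x f - subst y f ∈ I := by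
  cases nonempty_fintype σ
  obtain ⟨F, -, hF⟩ := exists_taylor_one f
  have := hF τ y (fun i => x i - y i) hy (by simp [hx, hy])
  simp only [add_sub_cancel] at this
  rw [this, add_sub_cancel_left]
  exact Ideal.sum_mem _ fun j _ => Ideal.mul_mem_right _ _ (h j)

lemma exists_taylor_two [Fintype σ] (f : MvPowerSeries σ ℝ) :
    ∃ q : σ → σ → MvPowerSeries (σ ⊕ σ) ℝ, (Conv f → ∀ j k, Conv (q j k)) ∧
      ∀ (τ : Type) (x w : σ → MvPowerSeries τ ℝ), (∀ i, constantCoeff (x i) = 0) →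
        (∀ i, constantCoeff (w i) = 0) → subst (fun i => x i + w i) f =
          subst x f + ∑ j, w j * subst x (pderiv ℝ j f) +
            ∑ j, ∑ k, w j * w k * subst (Sum.elim x w) (q j k) := by
  classical
  obtain ⟨F, hF, h⟩ := exists_taylor_one f
  choose q hq hs using fun j => exists_split (F j)
  refine ⟨q, fun hf j => hq j (hF hf j), fun τ x w hx hw => ?_⟩
  have hz : ∀ i : σ, constantCoeff ((fun _ => 0 : σ → MvPowerSeries σ ℝ) i) = 0 := by simp
  have hX : ∀ i : σ, constantCoeff (X i : MvPowerSeries σ ℝ) = 0 := by simp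
  have hd : ∀ j, killCompl Function.Embedding.inl (F j) = pderiv ℝ j f := by
    intro j
    have h1 := h (σ ⊕ σ) (fun i => X (Sum.inl i)) (fun i => X (Sum.inr i)) (by simp) (by simp)
    have h2 := congrArg (pderiv ℝ (Sum.inr j)) h1
    have hself : (Sum.elim (fun i => X (Sum.inl i)) (fun i => X (Sum.inr i)) :
        σ ⊕ σ → MvPowerSeries (σ ⊕ σ) ℝ) = X := by
      ext1 (i | i) <;> rfl
    rw [pderiv_subst (by simp), map_add, pderiv_subst (by simp), hself] at h2
    simp only [subst_self, id, map_sum, map_add, Derivation.leibniz, smul_eq_mul] at h2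
    have h3 : ∀ i : σ, pderiv ℝ (Sum.inr j) (X (Sum.inl i) : MvPowerSeries (σ ⊕ σ) ℝ) = 0 :=
      fun i => pderiv_X_of_ne (by simp)
    have h4 : ∀ i : σ, pderiv ℝ (Sum.inr j) (X (Sum.inr i) : MvPowerSeries (σ ⊕ σ) ℝ) =
        if i = j then 1 else 0 := by
      intro i
      split_ifs with hij
      · rw [hij, pderiv_X_self]
      · exact pderiv_X_of_ne (by simpa using hij)
    simp only [h3, h4, zero_add, mul_zero, Finset.sum_const_zero, mul_ite, mul_one,
      Finset.sum_ite_eq', Finset.mem_univ, if_true, Finset.sum_add_distrib] at h2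
    have hXz := constantCoeff_sumElim hX hz
    have h5 := congrArg (subst (Sum.elim X fun _ => 0 : σ ⊕ σ → MvPowerSeries σ ℝ)) h2
    rw [subst_subst (by simp) hXz] at h5
    simp only [← sb_apply hXz, map_add, map_sum, map_mul, sb_X, Sum.elim_inl, Sum.elim_inr,
      zero_mul, Finset.sum_const_zero, zero_add, add_zero] at h5
    rw [subst_X_eq_self] at h5
    have h6 := congrArg (sb hXz) (hs j)
    simp only [map_add, map_sum, map_mul, sb_X, Sum.elim_inr, zero_mul, Finset.sum_const_zero,
      add_zero] at h6
    rw [h5, h6, sb_apply, subst_rename _ hXz]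
    exact (subst_X_eq_self _).symm
  have hxw := constantCoeff_sumElim hx hw
  rw [h τ x w hx hw, add_assoc, ← Finset.sum_add_distrib]
  congr 1
  refine Finset.sum_congr rfl fun j _ => ?_
  have := congrArg (subst (Sum.elim x w)) (hs j)
  rw [hd] at this
  rw [this]
  simp only [← sb_apply hxw, map_add, map_sum, map_mul, sb_X, Sum.elim_inr, mul_add,
    Finset.mul_sum, mul_assoc]
  congr 1
  rw [sb_apply, subst_rename _ hxw]
  rfl

end Taylor
end ArtinApprox

namespace ArtinApprox

open MvPowerSeries
open scoped ENNReal

section FixedPoint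

variable {σ τ ι κ : Type}

lemma exists_fixedPoint {w : τ → ℕ} (T : (ι → MvPowerSeries τ ℝ) → ι → MvPowerSeries τ ℝ)
    (P : (ι → MvPowerSeries τ ℝ) → Prop) (v₀ : ι → MvPowerSeries τ ℝ) (h₀ : P v₀)
    (hT : ∀ v, P v → P (T v))
    (hcon : ∀ n v v', P v → P v' → (∀ i, v i - v' i ∈ wIdeal w n) →
      ∀ i, T v i - T v' i ∈ wIdeal w (n + 1))
    (hcl : ∀ u, (∀ n, ∃ v, P v ∧ ∀ i, u i - v i ∈ wIdeal w n) → P u) :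
    ∃ v, P v ∧ T v = v := by
  let s : ℕ → ι → MvPowerSeries τ ℝ := fun n => T^[n] v₀
  have hs1 : ∀ n, s (n + 1) = T (s n) := fun n => Function.iterate_succ_apply' _ _ _
  have hP : ∀ n, P (s n) := fun n => by
    induction n with
    | zero => exact h₀
    | succ n ih => rw [hs1]; exact hT _ ih
  have hstep : ∀ n i, s (n + 1) i - s n i ∈ wIdeal w n := fun n => by
    induction n with
    | zero => exact fun i => mem_wIdeal_zero _
    | succ n ih =>
      rw [hs1 (n + 1), hs1 n] at *
      exact hcon n _ _ (hT _ (hP n)) (hP n) ih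
  have hcauchy : ∀ n k i, s (n + k) i - s n i ∈ wIdeal w n := fun n k i => by
    induction k with
    | zero => simp
    | succ k ih =>
      have := Ideal.add_mem _ (wIdeal_anti (Nat.le_add_right n k) (hstep (n + k) i)) ih
      simpa [add_assoc] using this
  let u : ι → MvPowerSeries τ ℝ := fun i α => coeff α (s (Finsupp.weight w α + 1) i)
  have hu : ∀ n i, u i - s n i ∈ wIdeal w n := fun n i α hα => by
    have h1 := hcauchy (Finsupp.weight w α + 1) (n - (Finsupp.weight w α + 1)) i α
      (Nat.lt_succ_self _)
    rw [Nat.add_sub_cancel' hα, map_sub, sub_eq_zero] at h1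
    rw [map_sub, h1, sub_eq_zero]
    rfl
  have hPu : P u := hcl u fun n => ⟨s n, hP n, hu n⟩
  refine ⟨u, hPu, funext fun i => ?_⟩
  rw [← sub_eq_zero]
  refine eq_zero_of_forall_mem (w := w) fun n => ?_
  have h1 := hcon n _ _ hPu (hP n) (hu n) i
  have h2 := hu (n + 1) i
  rw [hs1] at h2
  have h3 := Ideal.sub_mem _ h1 h2
  rw [sub_sub_sub_cancel_right] at h3
  exact wIdeal_anti (Nat.le_succ n) h3

lemma eq_of_contracting {w : τ → ℕ} (T : (ι → MvPowerSeries τ ℝ) → ι → MvPowerSeries τ ℝ)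
    (P : (ι → MvPowerSeries τ ℝ) → Prop)
    (hcon : ∀ n v v', P v → P v' → (∀ i, v i - v' i ∈ wIdeal w n) →
      ∀ i, T v i - T v' i ∈ wIdeal w (n + 1)) {v v' : ι → MvPowerSeries τ ℝ} (hv : P v)
    (hv' : P v') (h : T v = v) (h' : T v' = v') : v = v' := by
  have key : ∀ n i, v i - v' i ∈ wIdeal w n := fun n => by
    induction n with
    | zero => exact fun i => mem_wIdeal_zero _
    | succ n ih =>
      rw [← h, ← h']
      exact hcon n _ _ hv hv' ih
  exact funext fun i => sub_eq_zero.mp (eq_zero_of_forall_mem fun n => key n i)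

lemma wnorm_le_of_approx {w : τ → ℕ} {ρ : τ → ℝ≥0∞} {C : ℝ≥0∞} {f : MvPowerSeries τ ℝ}
    (h : ∀ n, ∃ g, f - g ∈ wIdeal w n ∧ wnorm ρ g ≤ C) : wnorm ρ f ≤ C := by
  rw [wnorm, ENNReal.tsum_eq_iSup_sum]
  refine iSup_le fun s => ?_
  obtain ⟨g, hg, hC⟩ := h (s.sup (Finsupp.weight w) + 1)
  refine le_trans ?_ ((ENNReal.sum_le_tsum s).trans hC)
  refine Finset.sum_le_sum fun α hα => ?_
  have h1 := hg α (Nat.lt_succ_of_le (Finset.le_sup (f := Finsupp.weight w) hα))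
  rw [map_sub, sub_eq_zero] at h1
  rw [h1]

lemma exists_mul_le {M ε : ℝ≥0∞} (hM : M ≠ ⊤) (hε : ε ≠ 0) :
    ∃ c : ℝ≥0∞, c ≠ 0 ∧ c ≤ 1 ∧ M * c ≤ ε := by
  refine ⟨min 1 (ε / M), ?_, min_le_left _ _, ?_⟩
  · rw [← pos_iff_ne_zero, lt_min_iff]
    exact ⟨one_pos, ENNReal.div_pos hε hM⟩
  · calc _ ≤ M * (ε / M) := by
          gcongr; exact min_le_right _ _
      _ ≤ ε := ENNReal.mul_div_le

end FixedPoint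

section Newton

variable {ι τ : Type} [Fintype ι]

/-- One step of the Newton iteration. -/
def newtonMap (q : ι → ι → ι → MvPowerSeries (ι ⊕ ι) ℝ) (A : ι → ι → MvPowerSeries τ ℝ)
    (D : MvPowerSeries τ ℝ) (x ζ v : ι → MvPowerSeries τ ℝ) (i : ι) : MvPowerSeries τ ℝ :=
  ∑ k, A i k * (ζ k - ∑ j, ∑ l, v j * v l * subst (Sum.elim x fun i => D * v i) (q k j l))

variable {q : ι → ι → ι → MvPowerSeries (ι ⊕ ι) ℝ} {A : ι → ι → MvPowerSeries τ ℝ}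
    {D : MvPowerSeries τ ℝ} {x ζ : ι → MvPowerSeries τ ℝ}

lemma newtonMap_contracting {w : τ → ℕ} (hx : ∀ i, constantCoeff (x i) = 0) (n : ℕ)
    (v v' : ι → MvPowerSeries τ ℝ) (hv : ∀ i, v i ∈ wIdeal w 1) (hv' : ∀ i, v' i ∈ wIdeal w 1)
    (h : ∀ i, v i - v' i ∈ wIdeal w n) (i : ι) :
    newtonMap q A D x ζ v i - newtonMap q A D x ζ v' i ∈ wIdeal w (n + 1) := by
  rw [newtonMap, newtonMap, ← Finset.sum_sub_distrib]
  refine Ideal.sum_mem _ fun k _ => ?_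
  rw [← mul_sub, sub_sub_sub_cancel_left, ← Finset.sum_sub_distrib]
  refine Ideal.mul_mem_left _ _ (Ideal.sum_mem _ fun j _ => ?_)
  rw [← Finset.sum_sub_distrib]
  refine Ideal.sum_mem _ fun l _ => ?_
  set Q := subst (Sum.elim x fun i => D * v i) (q k j l)
  set Q' := subst (Sum.elim x fun i => D * v' i) (q k j l)
  have hc : ∀ i, constantCoeff (v i) = 0 := fun i => constantCoeff_of_mem_wIdeal (hv i)
  have hc' : ∀ i, constantCoeff (v' i) = 0 := fun i => constantCoeff_of_mem_wIdeal (hv' i)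
  have hQ : Q' - Q ∈ wIdeal w n := by
    refine subst_sub_subst_mem _ (constantCoeff_sumElim hx (by simp [hc']))
      (constantCoeff_sumElim hx (by simp [hc])) ?_ _
    rintro (i | i)
    · simp
    · simp only [Sum.elim_inr, ← mul_sub]
      refine Ideal.mul_mem_left _ _ ?_
      rw [← neg_sub]
      exact Ideal.neg_mem_iff _ |>.mpr (h i)
  have e : v' j * v' l * Q' - v j * v l * Q =
      v' l * (v j - v' j) * (-Q) + v j * (v l - v' l) * (-Q) + v' l * (Q' - Q) * v' j := by ring
  rw [e, Nat.add_comm n 1]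
  exact Ideal.add_mem _ (Ideal.add_mem _
    (Ideal.mul_mem_right _ _ (mul_mem_wIdeal (hv' l) (h j)))
    (Ideal.mul_mem_right _ _ (mul_mem_wIdeal (hv j) (h l))))
    (Ideal.mul_mem_right _ _ (mul_mem_wIdeal (hv' l) hQ))

lemma newtonMap_mem {w : τ → ℕ} {v : ι → MvPowerSeries τ ℝ} (hζ : ∀ i, ζ i ∈ wIdeal w 1)
    (hv : ∀ i, v i ∈ wIdeal w 1) (i : ι) : newtonMap q A D x ζ v i ∈ wIdeal w 1 :=
  Ideal.sum_mem _ fun _ _ => Ideal.mul_mem_left _ _ (Ideal.sub_mem _ (hζ _)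
    (Ideal.sum_mem _ fun _ _ => Ideal.sum_mem _ fun _ _ => Ideal.mul_mem_right _ _
      (Ideal.mul_mem_right _ _ (hv _))))

lemma wnorm_newtonMap_le {ρ : τ → ℝ≥0∞} {v : ι → MvPowerSeries τ ℝ} {r s t : ℝ≥0∞}
    (hx0 : ∀ i, constantCoeff (x i) = 0) (hv0 : ∀ i, constantCoeff (v i) = 0)
    (hx : ∀ i, wnorm ρ (x i) ≤ r) (hζ : ∀ i, wnorm ρ (ζ i) ≤ s) (hv : ∀ i, wnorm ρ (v i) ≤ t)
    (hD : wnorm ρ D * t ≤ r) (i : ι) :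
    wnorm ρ (newtonMap q A D x ζ v i) ≤ (∑ k, wnorm ρ (A i k)) *
      (s + t * t * ∑ k, ∑ j, ∑ l, wnorm (fun _ => r) (q k j l)) := by
  rw [newtonMap, Finset.sum_mul]
  refine (wnorm_sum_le _ _ _).trans (Finset.sum_le_sum fun k _ => (wnorm_mul_le _ _ _).trans ?_)
  gcongr
  rw [sub_eq_add_neg]
  refine (wnorm_add_le _ _ _).trans (add_le_add (hζ k) ?_)
  rw [wnorm_neg, Finset.mul_sum]
  refine le_trans ?_ (Finset.single_le_sum (fun _ _ => zero_le) (Finset.mem_univ k))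
  rw [Finset.mul_sum]
  refine (wnorm_sum_le _ _ _).trans (Finset.sum_le_sum fun j _ => ?_)
  rw [Finset.mul_sum]
  refine (wnorm_sum_le _ _ _).trans (Finset.sum_le_sum fun l _ => ?_)
  refine (wnorm_mul_le _ _ _).trans (mul_le_mul' ((wnorm_mul_le _ _ _).trans
    (mul_le_mul' (hv j) (hv l))) ?_)
  have h0 := constantCoeff_sumElim hx0 (w := fun i => D * v i) (by simp [hv0])
  refine (wnorm_subst_le _ (hasSubst_of_constantCoeff_zero h0) _).trans (wnorm_mono ?_ _)
  rintro (i | i)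
  · exact hx i
  · exact (wnorm_mul_le _ _ _).trans ((mul_le_mul' le_rfl (hv i)).trans hD)

variable [DecidableEq ι]

/-- The Jacobian matrix. -/
def jac (f : ι → MvPowerSeries ι ℝ) : Matrix ι ι (MvPowerSeries ι ℝ) :=
  fun i j => pderiv ℝ j (f i)

lemma sum_subst_adjugate {x : ι → MvPowerSeries τ ℝ} (hx : ∀ i, constantCoeff (x i) = 0)
    (M : Matrix ι ι (MvPowerSeries ι ℝ)) (i k : ι) :
    ∑ j, subst x (M i j) * subst x (M.adjugate j k) = if i = k then subst x M.det else 0 := by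
  have := congrArg (sb hx) (congrFun (congrFun M.mul_adjugate i) k)
  rw [Matrix.mul_apply, map_sum, Matrix.smul_apply, Matrix.one_apply] at this
  simp only [map_mul, smul_eq_mul, mul_ite, mul_one, mul_zero] at this
  simp only [← sb_apply hx, this]
  split_ifs <;> simp

lemma sum_adjugate_subst {x : ι → MvPowerSeries τ ℝ} (hx : ∀ i, constantCoeff (x i) = 0)
    (M : Matrix ι ι (MvPowerSeries ι ℝ)) (i k : ι) :
    ∑ j, subst x (M.adjugate i j) * subst x (M j k) = if i = k then subst x M.det else 0 := by
  have := congrArg (sb hx) (congrFun (congrFun M.adjugate_mul i) k)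
  rw [Matrix.mul_apply, map_sum, Matrix.smul_apply, Matrix.one_apply] at this
  simp only [map_mul, smul_eq_mul, mul_ite, mul_one, mul_zero] at this
  simp only [← sb_apply hx, this]
  split_ifs <;> simp

lemma mulVec_of_eq {R : Type} [CommRing R] {J A : ι → ι → R} {D : R}
    (h : ∀ i k, ∑ j, J i j * A j k = if i = k then D else 0) {v y : ι → R}
    (hv : ∀ j, ∑ k, A j k * y k = v j) (i : ι) : ∑ j, J i j * v j = D * y i := by
  calc _ = ∑ j, ∑ k, J i j * A j k * y k := by
        refine Finset.sum_congr rfl fun j _ => ?_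
        rw [← hv, Finset.mul_sum]
        exact Finset.sum_congr rfl fun k _ => (mul_assoc _ _ _).symm
    _ = _ := by
        rw [Finset.sum_comm]
        simp only [← Finset.sum_mul, h]
        simp

omit [DecidableEq ι] in
lemma newtonMap_eq_mul {J : ι → ι → MvPowerSeries τ ℝ} {v : ι → MvPowerSeries τ ℝ}
    {f : ι → MvPowerSeries ι ℝ}
    (hq : ∀ (i : ι) (x w : ι → MvPowerSeries τ ℝ), (∀ i, constantCoeff (x i) = 0) →
        (∀ i, constantCoeff (w i) = 0) → subst (fun i => x i + w i) (f i) =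
          subst x (f i) + ∑ j, w j * subst x (pderiv ℝ j (f i)) +
            ∑ j, ∑ k, w j * w k * subst (Sum.elim x w) (q i j k))
    (hx : ∀ i, constantCoeff (x i) = 0) (hv : ∀ i, constantCoeff (v i) = 0)
    (hJ : ∀ i j, subst x (pderiv ℝ j (f i)) = J i j) (i : ι) :
    subst (fun i => x i + D * v i) (f i) = subst x (f i) +
      D * ∑ j, J i j * v j +
      D ^ 2 * ∑ j, ∑ l, v j * v l * subst (Sum.elim x fun i => D * v i) (q i j l) := by
  have h1 : ∑ j, D * v j * subst x (pderiv ℝ j (f i)) = D * ∑ j, J i j * v j := by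
    rw [Finset.mul_sum]
    exact Finset.sum_congr rfl fun j _ => by rw [hJ]; ring
  have h2 : ∑ j, ∑ l, D * v j * (D * v l) * subst (Sum.elim x fun i => D * v i) (q i j l) =
      D ^ 2 * ∑ j, ∑ l, v j * v l * subst (Sum.elim x fun i => D * v i) (q i j l) := by
    simp only [Finset.mul_sum]
    exact Finset.sum_congr rfl fun j _ => Finset.sum_congr rfl fun k _ => by ring
  rw [hq i x (fun i => D * v i) hx (by simp [hv]), h1, h2]

/-- Fixed points of the Newton map solve `f (x + D v) = f x + D ^ 2 ζ`, where `D` is the Jacobian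
determinant at `x`; the converse holds if `D` is nonzero. -/
lemma newtonMap_fixed_iff {f : ι → MvPowerSeries ι ℝ}
    (hq : ∀ (i : ι) (x w : ι → MvPowerSeries τ ℝ), (∀ i, constantCoeff (x i) = 0) →
        (∀ i, constantCoeff (w i) = 0) → subst (fun i => x i + w i) (f i) =
          subst x (f i) + ∑ j, w j * subst x (pderiv ℝ j (f i)) +
            ∑ j, ∑ k, w j * w k * subst (Sum.elim x w) (q i j k))
    (hx : ∀ i, constantCoeff (x i) = 0) {v : ι → MvPowerSeries τ ℝ}
    (hv : ∀ i, constantCoeff (v i) = 0) (hD : subst x (jac f).det = D) :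
    (newtonMap q (fun i k => subst x ((jac f).adjugate i k)) D x ζ v = v →
      ∀ i, subst (fun i => x i + D * v i) (f i) = subst x (f i) + D ^ 2 * ζ i) ∧
    (D ≠ 0 → (∀ i, subst (fun i => x i + D * v i) (f i) = subst x (f i) + D ^ 2 * ζ i) →
      newtonMap q (fun i k => subst x ((jac f).adjugate i k)) D x ζ v = v) := by
  have hT := newtonMap_eq_mul (D := D) hq hx hv (J := fun i j => subst x (jac f i j))
    fun i j => rfl
  have h1 := sum_subst_adjugate hx (jac f)
  have h2 := sum_adjugate_subst hx (jac f)
  rw [hD] at h1 h2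
  refine ⟨fun h i => ?_, fun hD0 h => funext fun i => ?_⟩
  · rw [hT, mulVec_of_eq h1 fun j => congrFun h j]
    ring
  · refine mul_left_cancel₀ hD0 ?_
    rw [newtonMap, ← mulVec_of_eq h2 (v := fun j => ∑ k, subst x (jac f j k) * v k)
      (fun _ => rfl) i, Finset.mul_sum]
    refine Finset.sum_congr rfl fun k _ => ?_
    have h3 := h k
    rw [hT] at h3
    refine mul_left_cancel₀ hD0 ?_
    linear_combination (-subst x ((jac f).adjugate i k)) * h3

lemma newton_unique {f : ι → MvPowerSeries ι ℝ} (hx : ∀ i, constantCoeff (x i) = 0)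
    (hD : subst x (jac f).det = D) (hD0 : D ≠ 0) {v v' : ι → MvPowerSeries τ ℝ}
    (hv : ∀ i, constantCoeff (v i) = 0) (hv' : ∀ i, constantCoeff (v' i) = 0)
    (h : ∀ i, subst (fun i => x i + D * v i) (f i) = subst x (f i) + D ^ 2 * ζ i)
    (h' : ∀ i, subst (fun i => x i + D * v' i) (f i) = subst x (f i) + D ^ 2 * ζ i) : v = v' := by
  choose q _ hq using fun i => exists_taylor_two (f i)
  have hq' := fun i => hq i τ
  exact eq_of_contracting (w := fun _ => 1) (newtonMap q _ D x ζ) _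
    (fun n v v' hv hv' => newtonMap_contracting hx n v v' hv hv')
    (fun i => mem_oIdeal_one.mpr (hv i)) (fun i => mem_oIdeal_one.mpr (hv' i))
    ((newtonMap_fixed_iff hq' hx hv hD).2 hD0 h) ((newtonMap_fixed_iff hq' hx hv' hD).2 hD0 h')

/-- Universal convergent solution of `f (x + D v) = f x + D ^ 2 ζ`. -/
lemma exists_newton (f : ι → MvPowerSeries ι ℝ) (hf : ∀ i, Conv (f i)) :
    ∃ V : ι → MvPowerSeries (ι ⊕ ι) ℝ, (∀ i, Conv (V i)) ∧
      (∀ i, V i ∈ wIdeal (Sum.elim (fun _ => 0) fun _ => 1) 1) ∧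
      ∀ (τ : Type) (x ζ : ι → MvPowerSeries τ ℝ), (∀ i, constantCoeff (x i) = 0) →
        (∀ i, constantCoeff (ζ i) = 0) → ∀ i,
        subst (fun i => x i + subst x (jac f).det * subst (Sum.elim x ζ) (V i)) (f i) =
          subst x (f i) + subst x (jac f).det ^ 2 * ζ i := by
  choose q hqc hq using fun i => exists_taylor_two (f i)
  have hqc' := fun i => hqc i (hf i)
  have hJ : ∀ i j, Conv (jac f i j) := fun i j => (hf i).pderiv j
  obtain ⟨r₁, h₁, -, hr₁⟩ := exists_common fun p : ι × ι =>
    (conv_adjugate hJ p.1 p.2).exists_small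
  obtain ⟨r₂, h₂, -, hr₂⟩ := (conv_det hJ).exists_small
  obtain ⟨r₃, h₃, -, hr₃⟩ := exists_common fun p : ι × ι × ι =>
    (hqc' p.1 p.2.1 p.2.2).exists_small
  set r := min r₁ (min r₂ r₃) with hr
  have hr0 : r ≠ 0 := by simp [hr, h₁, h₂, h₃]
  replace hr₁ := hr₁ r (min_le_left _ _)
  replace hr₂ := hr₂ r ((min_le_right _ _).trans (min_le_left _ _))
  replace hr₃ := hr₃ r ((min_le_right _ _).trans (min_le_right _ _))
  set x : ι → MvPowerSeries (ι ⊕ ι) ℝ := fun i => X (Sum.inl i) with hxdef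
  set ζ : ι → MvPowerSeries (ι ⊕ ι) ℝ := fun i => X (Sum.inr i) with hζdef
  have hx : ∀ i, constantCoeff (x i) = 0 := by simp [hxdef]
  set M := (∑ i, ∑ k, wnorm (fun _ => r) ((jac f).adjugate i k)) +
    wnorm (fun _ => r) (jac f).det with hM
  set K := ∑ k, ∑ j, ∑ l, wnorm (fun _ => r) (q k j l) with hK
  have hMt : M ≠ ⊤ := by
    refine ENNReal.add_ne_top.mpr ⟨?_, hr₂⟩
    exact ENNReal.sum_ne_top.mpr fun i _ => ENNReal.sum_ne_top.mpr fun k _ => hr₁ (i, k)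
  have hKt : K ≠ ⊤ := ENNReal.sum_ne_top.mpr fun i _ => ENNReal.sum_ne_top.mpr fun j _ =>
    ENNReal.sum_ne_top.mpr fun k _ => hr₃ (i, j, k)
  obtain ⟨t, ht0, ht1, ht⟩ := exists_mul_le (M := M + M * K) (ε := min r 2⁻¹)
    (ENNReal.add_ne_top.mpr ⟨hMt, ENNReal.mul_ne_top hMt hKt⟩) (by simp [hr0])
  obtain ⟨s, hs0, -, hs⟩ := exists_mul_le (M := M) (ε := 2⁻¹ * t) hMt (by simp [ht0])
  have ht_r : M * t ≤ r := (mul_le_mul' le_self_add le_rfl).trans (ht.trans (min_le_left _ _))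
  have ht_2 : M * K * t ≤ 2⁻¹ :=
    (mul_le_mul' le_add_self le_rfl).trans (ht.trans (min_le_right _ _))
  set ρ : ι ⊕ ι → ℝ≥0∞ := Sum.elim (fun _ => r) fun _ => s with hρ
  have hxr : ∀ i, wnorm ρ (x i) ≤ r := fun i => by simp [hxdef, wnorm_X, hρ]
  have hζs : ∀ i, wnorm ρ (ζ i) ≤ s := fun i => by simp [hζdef, wnorm_X, hρ]
  have hsub : ∀ g, wnorm ρ (subst x g) ≤ wnorm (fun _ => r) g := fun g =>
    (wnorm_subst_le _ (hasSubst_of_constantCoeff_zero hx) g).trans (wnorm_mono hxr g)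
  set w : ι ⊕ ι → ℕ := Sum.elim (fun _ => 0) fun _ => 1 with hw
  set D := subst x (jac f).det with hD
  obtain ⟨V, hV, hfix⟩ := exists_fixedPoint (w := w)
    (newtonMap q (fun i k => subst x ((jac f).adjugate i k)) D x ζ)
    (fun v => (∀ i, v i ∈ wIdeal w 1) ∧ ∀ i, wnorm ρ (v i) ≤ t) 0
    ⟨fun i => Ideal.zero_mem _, fun i => by simp [wnorm_zero]⟩
    (fun v hv => ⟨newtonMap_mem (fun i => by simpa [hw] using X_mem_wIdeal w (Sum.inr i)) hv.1,
      fun i => by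
        refine (wnorm_newtonMap_le hx (fun i => constantCoeff_of_mem_wIdeal (hv.1 i)) hxr hζs hv.2
          ?_ i).trans ?_
        · exact (mul_le_mul' ((hsub _).trans le_add_self) le_rfl).trans ht_r
        · calc _ ≤ M * (s + t * t * K) := by
                gcongr
                refine (Finset.sum_le_sum fun k _ => hsub _).trans ?_
                refine le_trans ?_ le_self_add
                exact Finset.single_le_sum (f := fun i => ∑ k, wnorm (fun _ => r)
                  ((jac f).adjugate i k)) (fun _ _ => zero_le) (Finset.mem_univ i)
            _ = M * s + (M * K * t) * t := by ring
            _ ≤ 2⁻¹ * t + 2⁻¹ * t := by gcongr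
            _ = t := by rw [← add_mul, ENNReal.inv_two_add_inv_two, one_mul]⟩)
    (fun n v v' hv hv' => newtonMap_contracting hx n v v' hv.1 hv'.1)
    (fun u hu => ⟨fun i => by
        obtain ⟨v, hv, h⟩ := hu 1
        have := Ideal.add_mem _ (h i) (hv.1 i)
        rwa [sub_add_cancel] at this,
      fun i => wnorm_le_of_approx fun n => by
        obtain ⟨v, hv, h⟩ := hu n
        exact ⟨v i, h i, hv.2 i⟩⟩)
  have hV0 : ∀ i, constantCoeff (V i) = 0 := fun i => constantCoeff_of_mem_wIdeal (hV.1 i)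
  refine ⟨V, fun i => Conv.of_bound ρ ?_ (ne_top_of_le_ne_top
    (ne_top_of_le_ne_top ENNReal.one_ne_top ht1) (hV.2 i)), hV.1, fun τ y ξ hy hξ i => ?_⟩
  · rintro (i | i)
    · exact hr0
    · exact hs0
  · have h1 := (newtonMap_fixed_iff (fun i => hq i (ι ⊕ ι)) hx hV0 hD.symm).1 hfix i
    have hyξ := constantCoeff_sumElim hy hξ
    have h2 := congrArg (sb hyξ) h1
    have hsx : ∀ g, sb hyξ (subst x g) = subst y g := fun g => by
      rw [sb_apply, subst_subst hx hyξ]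
      simp only [hxdef, subst_X (hasSubst_of_constantCoeff_zero hyξ), Sum.elim_inl]
    rw [sb_apply, subst_subst (by simp [hx, hV0]) hyξ] at h2
    simp only [← sb_apply hyξ, map_add, map_mul, map_pow] at h2
    simp only [hD, hsx] at h2
    simp only [hxdef, hζdef, sb_X, Sum.elim_inl, Sum.elim_inr] at h2
    simp only [sb_apply] at h2
    exact h2

end Newton
end ArtinApprox

namespace ArtinApprox

open MvPowerSeries
open scoped ENNReal

section Path

variable {σ τ ι : Type}

lemma mem_wIdeal_succ_of_pderiv {w : σ → ℕ} (hw : ∀ k, w k ≤ 1) {f : MvPowerSeries σ ℝ} {n : ℕ}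
    (h1 : f ∈ wIdeal w 1) (h : ∀ k, w k = 1 → pderiv ℝ k f ∈ wIdeal w n) :
    f ∈ wIdeal w (n + 1) := by
  classical
  intro α hα
  by_cases h0 : ∃ k, w k = 1 ∧ α k ≠ 0
  · obtain ⟨k, hk, hk0⟩ := h0
    have hs : Finsupp.single k 1 ≤ α := by
      rw [Finsupp.single_le_iff]
      exact Nat.one_le_iff_ne_zero.mpr hk0
    obtain ⟨β, rfl⟩ := exists_add_of_le hs
    rw [map_add, Finsupp.weight_single, hk, smul_eq_mul, one_mul, Nat.add_comm] at hα
    have h2 := h k hk β (by omega)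
    rw [coeff_pderiv, add_comm β] at h2
    exact (mul_eq_zero.mp h2).resolve_right (by positivity)
  · refine h1 α ?_
    push Not at h0
    rw [Finsupp.weight_apply, Finsupp.sum, Finset.sum_eq_zero, Nat.lt_one_iff]
    intro k _
    have := hw k
    by_cases hk : w k = 1
    · simp [h0 k hk]
    · simp [show w k = 0 by omega]

lemma sum_det_updateRow_mul {R : Type} [CommRing R] [Fintype ι] [DecidableEq ι]
    (A : Matrix ι ι R) (b : ι → R) (j : ι) :
    ∑ i, (A.updateRow i b).det * A i j = A.det * b j := by
  have := congrFun (Matrix.mulVec_cramer A.transpose b) j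
  rw [Matrix.det_transpose, Pi.smul_apply, smul_eq_mul] at this
  rw [← this, Matrix.mulVec, dotProduct]
  refine Finset.sum_congr rfl fun i _ => ?_
  rw [Matrix.cramer_transpose_apply, Matrix.transpose_apply, mul_comm]

variable [Fintype ι] [DecidableEq ι]

/-- The determinant obtained from the Jacobian of `f` by replacing `f k` by `p`. -/
def jacDet (f : ι → MvPowerSeries ι ℝ) (k : ι) (p : MvPowerSeries ι ℝ) : MvPowerSeries ι ℝ :=
  ((jac f).updateRow k fun j => pderiv ℝ j p).det

omit [Fintype ι] [DecidableEq ι] in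
lemma conv_jac {f : ι → MvPowerSeries ι ℝ} (hf : ∀ i, Conv (f i)) (i j : ι) :
    Conv (jac f i j) := (hf i).pderiv j

lemma conv_jacDet {f : ι → MvPowerSeries ι ℝ} (hf : ∀ i, Conv (f i)) (k : ι)
    {p : MvPowerSeries ι ℝ} (hp : Conv p) : Conv (jacDet f k p) := by
  refine conv_det fun i j => ?_
  rw [Matrix.updateRow_apply]
  split_ifs
  · exact hp.pderiv j
  · exact conv_jac hf i j

lemma subst_det_mul_pderiv {T : ι → MvPowerSeries τ ℝ} (hT : ∀ i, constantCoeff (T i) = 0)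
    (f : ι → MvPowerSeries ι ℝ) (p : MvPowerSeries ι ℝ) (k : τ) :
    subst T (jac f).det * pderiv ℝ k (subst T p) =
      ∑ i, subst T (jacDet f i p) * pderiv ℝ k (subst T (f i)) := by
  have h : ∀ j, subst T (jac f).det * subst T (pderiv ℝ j p) =
      ∑ i, subst T (jacDet f i p) * subst T (pderiv ℝ j (f i)) := fun j => by
    have := congrArg (sb hT) (sum_det_updateRow_mul (jac f) (fun j => pderiv ℝ j p) j)
    rw [map_sum] at this
    simp only [map_mul, sb_apply] at this
    exact this.symm
  simp only [pderiv_subst hT, Finset.mul_sum]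
  rw [Finset.sum_comm]
  refine Finset.sum_congr rfl fun j _ => ?_
  rw [← mul_assoc, h, Finset.sum_mul]
  exact Finset.sum_congr rfl fun i _ => mul_assoc _ _ _

omit [DecidableEq ι] in
lemma exists_unit_subst {x v : ι → MvPowerSeries τ ℝ} (hx : ∀ i, constantCoeff (x i) = 0)
    (hv : ∀ i, constantCoeff (v i) = 0) (p : MvPowerSeries ι ℝ) (D : MvPowerSeries τ ℝ) :
    ∃ e, constantCoeff e = 0 ∧ subst (fun i => x i + D * v i) p = subst x p + D * e := by
  obtain ⟨F, -, hF⟩ := exists_taylor_one p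
  refine ⟨∑ j, v j * subst (Sum.elim x fun i => D * v i) (F j), by simp [hv], ?_⟩
  rw [hF τ x _ hx (by simp [hv]), Finset.mul_sum]
  simp only [mul_assoc]

lemma path_vanish [Finite σ] {a : ι → MvPowerSeries σ ℝ} (ha : ∀ i, constantCoeff (a i) = 0)
    {S : Set ι} {f : ι → MvPowerSeries ι ℝ} (hf : ∀ i, Conv (f i))
    (hD : subst a (jac f).det ≠ 0)
    (hmax : ∀ k ∉ S, ∀ p, Conv p → subst a p = 0 → subst a (jacDet f k p) = 0)
    {v ζ : ι → MvPowerSeries σ ℝ} (hv : ∀ i, constantCoeff (v i) = 0)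
    (hζ : ∀ i, constantCoeff (ζ i) = 0) (hζS : ∀ i ∈ S, ζ i = 0)
    (h : ∀ i, subst (fun i => a i + subst a (jac f).det * v i) (f i) =
      subst a (f i) + subst a (jac f).det ^ 2 * ζ i)
    {p : MvPowerSeries ι ℝ} (hp : Conv p) (hpa : subst a p = 0) :
    subst (fun i => a i + subst a (jac f).det * v i) p = 0 := by
  classical
  obtain ⟨V, -, hVw, hV⟩ := exists_newton f hf
  have hV0 : ∀ i, constantCoeff (V i) = 0 := fun i => constantCoeff_of_mem_wIdeal (hVw i)
  set w : ι ⊕ σ → ℕ := Sum.elim (fun _ => 1) fun _ => 0 with hw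
  set A : ι → MvPowerSeries (ι ⊕ σ) ℝ := fun i => rename Sum.inr (a i) with hA
  set χ : ι → MvPowerSeries (ι ⊕ σ) ℝ := fun i => if i ∈ S then 0 else X (Sum.inl i) with hχ
  have hr0 : ∀ i : σ, constantCoeff (X (Sum.inr i) : MvPowerSeries (ι ⊕ σ) ℝ) = 0 := by simp
  have hA0 : ∀ i, constantCoeff (A i) = 0 := fun i => by
    simp only [hA, rename_eq_sb]
    rw [constantCoeff_subst' hr0, ha]
  have hχ0 : ∀ i, constantCoeff (χ i) = 0 := fun i => by
    simp only [hχ]; split_ifs <;> simp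
  have hAsub : ∀ g, subst A g = rename Sum.inr (subst a g) := fun g => by
    simp only [hA, rename_eq_sb]
    rw [subst_subst ha hr0]
  set D := subst A (jac f).det with hDdef
  have hD0 : D ≠ 0 := by
    rw [hDdef, hAsub]
    exact fun h0 => hD (rename_injective (Function.Embedding.inr (α := ι)) (h0.trans (map_zero _).symm))
  set U : ι → MvPowerSeries (ι ⊕ σ) ℝ := fun i => subst (Sum.elim A χ) (V i) with hU
  have hU0 : ∀ i, constantCoeff (U i) = 0 := fun i => by
    simp only [hU]; rw [constantCoeff_subst' (constantCoeff_sumElim hA0 hχ0), hV0]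
  set T : ι → MvPowerSeries (ι ⊕ σ) ℝ := fun i => A i + D * U i with hT
  have hT0 : ∀ i, constantCoeff (T i) = 0 := by simp [hT, hA0, hU0]
  have hUw : ∀ i, U i ∈ wIdeal w 1 := fun i => by
    refine subst_mem_wIdeal (hasSubst_of_constantCoeff_zero (constantCoeff_sumElim hA0 hχ0)) ?_
      (hVw i)
    rintro (j | j)
    · exact mem_wIdeal_zero _
    · simp only [Sum.elim_inr, hχ]
      split_ifs
      · exact Ideal.zero_mem _
      · simpa [hw] using X_mem_wIdeal w (Sum.inl j)
  have hfT : ∀ i, subst T (f i) = subst A (f i) + D ^ 2 * χ i := hV _ A χ hA0 hχ0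
  have hdren : ∀ g : MvPowerSeries σ ℝ, ∀ k : ι,
      pderiv ℝ (Sum.inl k) (rename (Sum.inr : σ → ι ⊕ σ) g) = 0 := fun g k => by
    cases nonempty_fintype σ
    rw [rename_eq_sb, pderiv_subst hr0]
    refine Finset.sum_eq_zero fun i _ => ?_
    rw [pderiv_X]
    simp
  have hdf : ∀ i k, pderiv ℝ (Sum.inl k) (subst T (f i)) =
      if i = k ∧ k ∉ S then D ^ 2 else 0 := fun i k => by
    have hdD : pderiv ℝ (Sum.inl k) (D ^ 2) = 0 := by
      rw [hDdef, hAsub, ← map_pow, hdren]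
    rw [hfT, map_add, hAsub, hdren, Derivation.leibniz, hdD]
    simp only [hχ]
    by_cases hk : i ∈ S
    · by_cases hik : i = k
      · subst hik; simp [hk]
      · simp [hk, hik]
    · by_cases hik : i = k
      · subst hik; simp [hk]
      · simp [hk, hik]
  obtain ⟨e, he0, he⟩ := exists_unit_subst hA0 hU0 (jac f).det D
  have hDT : subst T (jac f).det = D * (1 + e) := by
    rw [mul_add, mul_one]; exact he
  have hunit : IsUnit (1 + e) := by
    rw [isUnit_iff_constantCoeff]; simp [he0]
  have key : ∀ n p, Conv p → subst a p = 0 → subst T p ∈ wIdeal w n := by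
    have base : ∀ p, Conv p → subst a p = 0 → subst T p ∈ wIdeal w 1 := fun p hp hpa => by
      have := subst_sub_subst_mem (wIdeal w 1) hT0 hA0 (fun i => by
        simp only [hT, add_sub_cancel_left]
        exact Ideal.mul_mem_left _ _ (hUw i)) p
      rwa [hAsub, hpa, map_zero, sub_zero] at this
    intro n
    induction n with
    | zero => exact fun p _ _ => mem_wIdeal_zero _
    | succ n ih =>
      intro p hp hpa
      refine mem_wIdeal_succ_of_pderiv (by rintro (i | i) <;> simp [hw]) (base p hp hpa) ?_
      rintro (k | k) hk
      · have h1 := subst_det_mul_pderiv hT0 f p (Sum.inl k)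
        have h2 : (1 + e) * pderiv ℝ (Sum.inl k) (subst T p) =
            if k ∈ S then 0 else D * subst T (jacDet f k p) := by
          refine mul_left_cancel₀ hD0 ?_
          rw [← mul_assoc, ← hDT, h1, Finset.sum_eq_single k]
          · rw [hdf]
            by_cases hkS : k ∈ S
            · simp [hkS]
            · rw [if_pos ⟨rfl, hkS⟩, if_neg hkS]; ring
          · intro i _ hik
            rw [hdf, if_neg (fun h => hik h.1), mul_zero]
          · simp
        have h3 : (1 + e) * pderiv ℝ (Sum.inl k) (subst T p) ∈ wIdeal w n := by
          rw [h2]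
          split_ifs with hkS
          · exact Ideal.zero_mem _
          · exact Ideal.mul_mem_left _ _ (ih _ (conv_jacDet hf k hp) (hmax k hkS p hp hpa))
        exact (Ideal.unit_mul_mem_iff_mem _ hunit).mp h3
      · simp [hw] at hk
  have hz : subst T p = 0 := eq_zero_of_forall_mem fun n => key n p hp hpa
  have hB := constantCoeff_sumElim hζ (w := fun i : σ => (X i : MvPowerSeries σ ℝ)) (by simp)
  have hBA : ∀ i, sb hB (A i) = a i := fun i => by
    rw [sb_apply, hA, subst_rename _ hB]
    simp only [Sum.elim_inr]
    exact subst_X_eq_self _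
  have hBD : sb hB D = subst a (jac f).det := by
    rw [sb_apply, hDdef, subst_subst hA0 hB]
    simp only [← sb_apply hB, hBA]
  have hBχ : ∀ i, sb hB (χ i) = ζ i := fun i => by
    simp only [hχ]
    split_ifs with hi
    · rw [map_zero, hζS i hi]
    · rw [sb_X, Sum.elim_inl]
  have hBU : ∀ i, sb hB (U i) = subst (Sum.elim a ζ) (V i) := fun i => by
    rw [sb_apply, hU, subst_subst (constantCoeff_sumElim hA0 hχ0) hB]
    congr 1
    funext j
    rcases j with j | j
    · rw [Sum.elim_inl, Sum.elim_inl, ← sb_apply hB, hBA]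
    · rw [Sum.elim_inr, Sum.elim_inr, ← sb_apply hB, hBχ]
  have hveq : v = fun i => subst (Sum.elim a ζ) (V i) :=
    newton_unique ha rfl hD hv (fun i => by
      rw [constantCoeff_subst' (constantCoeff_sumElim ha hζ), hV0]) h (hV _ a ζ ha hζ)
  have h4 := congrArg (sb hB) hz
  rw [map_zero, sb_apply, subst_subst hT0 hB] at h4
  simp only [← sb_apply hB, hT, map_add, map_mul, hBA, hBD, hBU] at h4
  rw [hveq]
  exact h4

end Path
end ArtinApprox

namespace ArtinApprox

open MvPowerSeries
open scoped ENNReal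

section Shift

variable {σ τ : Type}

/-- Setting the first variable equal to zero. -/
def kc : MvPowerSeries (Option σ) ℝ →ₐ[ℝ] MvPowerSeries σ ℝ := killCompl Function.Embedding.some

/-- Dividing by the first variable, up to remainder. -/
def sh : MvPowerSeries (Option σ) ℝ →ₗ[ℝ] MvPowerSeries (Option σ) ℝ where
  toFun f := fun α => coeff (α + Finsupp.single none 1) f
  map_add' f g := by ext; exact map_add (coeff _) f g
  map_smul' c f := by ext; exact map_smul (coeff _) c f

lemma coeff_sh (f : MvPowerSeries (Option σ) ℝ) (α : Option σ →₀ ℕ) :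
    coeff α (sh f) = coeff (α + Finsupp.single none 1) f := rfl

lemma kc_X : kc (X none : MvPowerSeries (Option σ) ℝ) = 0 :=
  killCompl_X_eq_zero (by simp)

lemma X_none_ne_zero : (X none : MvPowerSeries (Option σ) ℝ) ≠ 0 := fun h => by
  classical
  have := congrArg (coeff (Finsupp.single none 1)) h
  simp [coeff_X] at this

lemma constantCoeff_kc (f : MvPowerSeries (Option σ) ℝ) :
    constantCoeff (kc f) = constantCoeff f := by
  rw [← coeff_zero_eq_constantCoeff_apply, ← coeff_zero_eq_constantCoeff_apply, kc,
    coeff_killCompl, Finsupp.embDomain_zero]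

lemma sh_mem_wIdeal {w : Option σ → ℕ} (hw : w none = 0) {n : ℕ} {f : MvPowerSeries (Option σ) ℝ}
    (hf : f ∈ wIdeal w n) : sh f ∈ wIdeal w n := fun α hα => by
  rw [coeff_sh]
  exact hf _ (by simpa [Finsupp.weight_single, hw] using hα)

lemma iterate_sh_mem_wIdeal {w : Option σ → ℕ} (hw : w none = 0) {n : ℕ}
    {f : MvPowerSeries (Option σ) ℝ} (hf : f ∈ wIdeal w n) (d : ℕ) : sh^[d] f ∈ wIdeal w n := by
  induction d with
  | zero => exact hf
  | succ d ih =>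
    rw [Function.iterate_succ_apply']
    exact sh_mem_wIdeal hw ih

lemma wnorm_sh_le (ρ : Option σ → ℝ≥0∞) (f : MvPowerSeries (Option σ) ℝ) :
    wnorm ρ (sh f) * ρ none ≤ wnorm ρ f := by
  have h := ENNReal.tsum_comp_le_tsum_of_injective
    (add_left_injective (Finsupp.single (none : Option σ) 1)) fun α => ‖coeff α f‖ₑ * mon ρ α
  refine le_trans (le_of_eq ?_) h
  rw [wnorm, ← ENNReal.tsum_mul_right]
  refine tsum_congr fun α => ?_
  rw [mon_add, mon_single, coeff_sh, pow_one, mul_assoc]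

lemma wnorm_iterate_sh_le (ρ : Option σ → ℝ≥0∞) (f : MvPowerSeries (Option σ) ℝ) (d : ℕ) :
    wnorm ρ (sh^[d] f) * ρ none ^ d ≤ wnorm ρ f := by
  induction d with
  | zero => simp
  | succ d ih =>
    rw [Function.iterate_succ_apply', pow_succ', ← mul_assoc]
    exact (mul_le_mul' (wnorm_sh_le _ _) le_rfl).trans ih

lemma Conv.sh {f : MvPowerSeries (Option σ) ℝ} (hf : Conv f) : Conv (sh f) := by
  obtain ⟨r, h0, h⟩ := hf
  refine ⟨r, h0, fun ht => h (top_le_iff.mp ?_)⟩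
  have := wnorm_sh_le (fun _ => r) f
  rwa [ht, ENNReal.top_mul h0] at this

lemma Conv.iterate_sh {f : MvPowerSeries (Option σ) ℝ} (hf : Conv f) (d : ℕ) :
    Conv (ArtinApprox.sh^[d] f) := by
  induction d with
  | zero => exact hf
  | succ d ih =>
    rw [Function.iterate_succ_apply']
    exact ih.sh

variable [Finite σ]

/-- Power series in the last variables, as power series in all variables. -/
def ren : MvPowerSeries σ ℝ →ₐ[ℝ] MvPowerSeries (Option σ) ℝ := rename some

lemma ren_X (i : σ) : ren (X i : MvPowerSeries σ ℝ) = X (some i) := rename_X some i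

lemma ren_eq_subst (f : MvPowerSeries σ ℝ) :
    ren f = subst (fun i => X (some i) : σ → MvPowerSeries (Option σ) ℝ) f := rename_eq_sb some f

lemma constantCoeff_ren (f : MvPowerSeries σ ℝ) : constantCoeff (ren f) = constantCoeff f :=
  constantCoeff_rename some f

lemma Conv.ren {f : MvPowerSeries σ ℝ} (hf : Conv f) : Conv (ren f) := by
  rw [ren_eq_subst]
  exact hf.subst (fun _ => conv_X _) (by simp)

lemma kc_ren (f : MvPowerSeries σ ℝ) : kc (ren f) = f :=
  killCompl_rename_app (e := Function.Embedding.some) f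

lemma sh_add_ren (f : MvPowerSeries (Option σ) ℝ) : X none * sh f + ren (kc f) = f := by
  classical
  ext α
  rw [map_add]
  by_cases h : α none = 0
  · have h1 : coeff α (X none * sh f) = 0 := by
      rw [X, coeff_monomial_mul, if_neg]
      rw [Finsupp.single_le_iff]
      omega
    obtain ⟨β, rfl⟩ : ∃ β, Finsupp.embDomain Function.Embedding.some β = α := by
      refine Finsupp.mem_range_embDomain_iff _ _ |>.mpr ?_
      rintro (_ | i) hi
      · simp [h] at hi
      · exact ⟨i, rfl⟩
    rw [h1, zero_add]
    exact coeff_embDomain_rename Function.Embedding.some _ _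
  · obtain ⟨β, rfl⟩ : ∃ β, Finsupp.single none 1 + β = α := by
      have : Finsupp.single none 1 ≤ α := by
        rw [Finsupp.single_le_iff]; omega
      obtain ⟨β, hβ⟩ := exists_add_of_le this
      exact ⟨β, hβ.symm⟩
    have h2 : coeff (Finsupp.single none 1 + β) (ren (kc f)) = 0 := by
      refine coeff_rename_eq_zero _ _ ?_
      rintro ⟨γ, hγ⟩
      have := DFunLike.congr_fun hγ none
      rw [Finsupp.mapDomain_of_notMem_range _ _ (by simp)] at this
      simp at this
      omega
    rw [h2, X, coeff_add_monomial_mul, one_mul, coeff_sh, add_comm β, add_zero]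

lemma sh_X_mul (f : MvPowerSeries (Option σ) ℝ) : sh (X none * f) = f := by
  have := sh_add_ren (X none * f)
  rw [map_mul kc, kc_X, zero_mul, map_zero, add_zero] at this
  exact mul_left_cancel₀ X_none_ne_zero this

lemma sh_ren (f : MvPowerSeries σ ℝ) : sh (ren f) = 0 := by
  have := sh_add_ren (ren f)
  rw [kc_ren, add_eq_right] at this
  exact (mul_eq_zero.mp this).resolve_left X_none_ne_zero

lemma iterate_sh_X_pow_mul (d : ℕ) (f : MvPowerSeries (Option σ) ℝ) :
    sh^[d] (X none ^ d * f) = f := by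
  induction d with
  | zero => simp
  | succ d ih => rw [Function.iterate_succ_apply, pow_succ', mul_assoc, sh_X_mul, ih]

lemma iterate_sh_add_sum (d : ℕ) (f : MvPowerSeries (Option σ) ℝ) :
    X none ^ d * sh^[d] f + ∑ l : Fin d, X none ^ (l : ℕ) * ren (kc (sh^[l] f)) = f := by
  induction d with
  | zero => simp
  | succ d ih =>
    rw [Fin.sum_univ_castSucc, ← add_assoc, add_right_comm, Function.iterate_succ_apply']
    simp only [Fin.val_castSucc, Fin.val_last]
    conv_rhs => rw [← ih]
    rw [pow_succ, mul_assoc, ← mul_add, sh_add_ren]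

lemma Conv.kc {f : MvPowerSeries (Option σ) ℝ} (hf : Conv f) : Conv (kc f) := by
  have h0 : ∀ o : Option σ, constantCoeff (o.elim 0 X : MvPowerSeries σ ℝ) = 0 := by
    rintro (_ | i) <;> simp
  have h1 := congrArg (sb h0) (sh_add_ren f)
  rw [map_add, map_mul, sb_X, Option.elim_none, zero_mul, zero_add, ren_eq_subst, sb_apply,
    subst_subst (by simp) h0, sb_apply] at h1
  simp only [← sb_apply h0, sb_X, Option.elim_some] at h1
  rw [← subst_X_eq_self (ArtinApprox.kc f), h1, sb_apply]
  refine hf.subst ?_ h0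
  rintro (_ | i)
  · exact conv_zero
  · exact conv_X i

/-- The weight counting all variables but the first. -/
def wt : Option σ → ℕ := fun o => o.elim 0 fun _ => 1

lemma ren_mem_wIdeal {f : MvPowerSeries σ ℝ} (hf : constantCoeff f = 0) : ren f ∈ wIdeal wt 1 := by
  rw [ren_eq_subst]
  exact subst_mem_wIdeal (w := fun _ => 1) (hasSubst_of_constantCoeff_zero (by simp))
    (fun i => X_mem_wIdeal wt (some i)) (mem_oIdeal_one.mpr hf)

lemma sum_ren_mem_wIdeal {d : ℕ} {c : Fin d → MvPowerSeries σ ℝ}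
    (hc : ∀ l, constantCoeff (c l) = 0) :
    ∑ l : Fin d, X none ^ (l : ℕ) * ren (c l) ∈ wIdeal (wt (σ := σ)) 1 :=
  Ideal.sum_mem _ fun l _ => Ideal.mul_mem_left _ _ (ren_mem_wIdeal (hc l))

/-- Weierstrass division. -/
lemma exists_div (d : ℕ) {B : MvPowerSeries (Option σ) ℝ} (hB : B ∈ wIdeal wt 1)
    (G : MvPowerSeries (Option σ) ℝ) :
    ∃ q, sh^[d] (G - (X none ^ d + B) * q) = 0 ∧ (Conv G → Conv B → Conv q) := by
  have hcon : ∀ (n : ℕ) (v v' : Unit → MvPowerSeries (Option σ) ℝ),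
      (∀ i, v i - v' i ∈ wIdeal wt n) → ∀ i : Unit, sh^[d] (G - B * v i) - sh^[d] (G - B * v' i) ∈
        wIdeal wt (n + 1) := fun n v v' h i => by
    rw [← iterate_map_sub, sub_sub_sub_cancel_left, ← mul_sub, Nat.add_comm]
    refine iterate_sh_mem_wIdeal rfl (mul_mem_wIdeal hB ?_) d
    rw [← neg_sub]
    exact Ideal.neg_mem_iff _ |>.mpr (h i)
  have hfix : ∀ q, sh^[d] (G - B * q) = q → sh^[d] (G - (X none ^ d + B) * q) = 0 := fun q hq => by
    rw [add_mul, add_comm, ← sub_sub, iterate_map_sub, hq, iterate_sh_X_pow_mul, sub_self]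
  by_cases hc : Conv G ∧ Conv B
  · obtain ⟨r₁, h₁, h₁1, hr₁⟩ := hc.1.exists_small
    obtain ⟨r₂, h₂, -, hr₂⟩ := hc.2.exists_small
    set r := min r₁ r₂ with hr
    have hr0 : r ≠ 0 := by simp [hr, h₁, h₂]
    have hrt : r ≠ ⊤ := ne_top_of_le_ne_top ENNReal.one_ne_top ((min_le_left _ _).trans h₁1)
    have hrd : r ^ d ≠ 0 := pow_ne_zero _ hr0
    have hrdt : r ^ d ≠ ⊤ := ENNReal.pow_ne_top hrt
    replace hr₁ := hr₁ r (min_le_left _ _)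
    replace hr₂ := hr₂ r (min_le_right _ _)
    obtain ⟨c, hc0, hc1, hc2⟩ := exists_mul_le (M := wnorm (fun _ => r) B) (ε := 2⁻¹ * r ^ d)
      hr₂ (by simp [hr0])
    set ρ : Option σ → ℝ≥0∞ := fun i => c ^ wt i * r with hρ
    have hρn : ρ none = r := by simp [hρ, wt]
    have hρr : ∀ i, ρ i ≤ r := fun i => by
      simp only [hρ]
      exact mul_le_of_le_one_left' (pow_le_one' hc1 _)
    have hBρ : wnorm ρ B ≤ 2⁻¹ * r ^ d := by
      refine (wnorm_weight_le c hc1 wt (fun _ => r) (mem_wIdeal_iff_le.mp hB)).trans ?_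
      rwa [pow_one, mul_comm]
    set K := 2 * ((r ^ d)⁻¹ * wnorm ρ G) with hK
    have hKt : K ≠ ⊤ := ENNReal.mul_ne_top (by simp) (ENNReal.mul_ne_top (by simp [hr0])
      (ne_top_of_le_ne_top hr₁ (wnorm_mono hρr G)))
    obtain ⟨v, hv, hTv⟩ := exists_fixedPoint (w := wt)
      (fun v (_ : Unit) => sh^[d] (G - B * v ())) (fun v => wnorm ρ (v ()) ≤ K) 0
      (by simp [wnorm_zero])
      (fun v hv => by
        have h1 := wnorm_iterate_sh_le ρ (G - B * v ()) d
        rw [hρn, ← ENNReal.le_div_iff_mul_le (Or.inl hrd) (Or.inl hrdt), div_eq_mul_inv,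
          mul_comm _ (r ^ d)⁻¹] at h1
        refine h1.trans ?_
        rw [sub_eq_add_neg]
        calc _ ≤ (r ^ d)⁻¹ * (wnorm ρ G + 2⁻¹ * r ^ d * K) := by
              gcongr
              refine (wnorm_add_le _ _ _).trans ?_
              rw [wnorm_neg]
              gcongr
              exact (wnorm_mul_le _ _ _).trans (mul_le_mul' hBρ hv)
          _ = (r ^ d)⁻¹ * wnorm ρ G + ((r ^ d)⁻¹ * r ^ d) * (2⁻¹ * K) := by ring
          _ = K := by
              rw [ENNReal.inv_mul_cancel hrd hrdt, one_mul, hK, ← mul_assoc,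
                ENNReal.inv_mul_cancel (by simp) (by simp), one_mul, two_mul])
      (fun n v v' _ _ h i => hcon n v v' h i)
      (fun u hu => wnorm_le_of_approx fun n => by
        obtain ⟨v, hv, h⟩ := hu n
        exact ⟨v (), h (), hv⟩)
    refine ⟨v (), hfix _ (congrFun hTv ()), fun _ _ => Conv.of_bound ρ (fun i => ?_)
      (ne_top_of_le_ne_top hKt hv)⟩
    simp [hρ, hc0, hr0]
  · obtain ⟨v, -, hTv⟩ := exists_fixedPoint (w := wt)
      (fun v (_ : Unit) => sh^[d] (G - B * v ())) (fun _ => True) 0 trivial (fun _ _ => trivial)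
      (fun n v v' _ _ h i => hcon n v v' h i) (fun _ _ => trivial)
    exact ⟨v (), hfix _ (congrFun hTv ()), fun h h' => absurd ⟨h, h'⟩ hc⟩

lemma eq_zero_of_iterate_sh {d : ℕ} {B : MvPowerSeries (Option σ) ℝ} (hB : B ∈ wIdeal wt 1)
    {q : MvPowerSeries (Option σ) ℝ} (h : sh^[d] ((X none ^ d + B) * q) = 0) : q = 0 := by
  rw [add_mul, iterate_map_add, iterate_sh_X_pow_mul, add_eq_zero_iff_eq_neg] at h
  refine eq_zero_of_forall_mem (w := wt) fun n => ?_
  induction n with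
  | zero => exact mem_wIdeal_zero _
  | succ n ih =>
    rw [h, Nat.add_comm]
    exact Ideal.neg_mem_iff _ |>.mpr (iterate_sh_mem_wIdeal rfl (mul_mem_wIdeal hB ih) d)

/-- Convergent power series with nonzero constant term have convergent inverses. -/
lemma Conv.exists_inv {u : MvPowerSeries σ ℝ} (hu : Conv u) (h0 : constantCoeff u ≠ 0) :
    ∃ v, Conv v ∧ u * v = 1 := by
  set c := constantCoeff u with hc
  set e := C c⁻¹ * u - 1 with he
  have he0 : constantCoeff e = 0 := by simp [he, ← hc, h0]
  have hec : Conv e := ((conv_C _).mul hu).sub conv_one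
  obtain ⟨q, hq, hqc⟩ := exists_div 0 (ren_mem_wIdeal he0) 1
  replace hqc := hqc conv_one hec.ren
  simp only [Function.iterate_zero, id_eq, pow_zero, sub_eq_zero] at hq
  refine ⟨C c⁻¹ * ArtinApprox.kc q, (conv_C _).mul hqc.kc, ?_⟩
  have := congrArg ArtinApprox.kc hq
  rw [map_one, map_mul, map_add, map_one, kc_ren, he, add_sub_cancel] at this
  rw [this]
  ring

/-- Weierstrass preparation. -/
lemma exists_prep {E : MvPowerSeries (Option σ) ℝ} {d : ℕ}
    (h : ∀ l < d, constantCoeff (sh^[l] E) = 0) (hd : constantCoeff (sh^[d] E) ≠ 0) :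
    ∃ w : Fin d → MvPowerSeries σ ℝ, (∀ l, constantCoeff (w l) = 0) ∧
      ∃ u, IsUnit u ∧ X none ^ d + ∑ l : Fin d, X none ^ (l : ℕ) * ren (w l) = E * u := by
  obtain ⟨v, hv⟩ : IsUnit (sh^[d] E) := isUnit_iff_constantCoeff.mpr (Ne.isUnit hd)
  set s := ∑ l : Fin d, X none ^ (l : ℕ) * ren (kc (sh^[l] E)) with hs
  set B := s * (↑v⁻¹ : MvPowerSeries (Option σ) ℝ) with hBdef
  have hsm : s ∈ wIdeal (wt (σ := σ)) 1 := sum_ren_mem_wIdeal fun l => by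
    rw [constantCoeff_kc, h l l.2]
  have hB : B ∈ wIdeal wt 1 := Ideal.mul_mem_right _ _ hsm
  have hE : X none ^ d + B = E * (↑v⁻¹ : MvPowerSeries (Option σ) ℝ) := by
    conv_rhs => rw [← iterate_sh_add_sum d E, ← hs, ← hv, add_mul, mul_assoc, Units.mul_inv,
      mul_one]
  obtain ⟨q, hq, -⟩ := exists_div d hB (X none ^ d)
  set r := X none ^ d - (X none ^ d + B) * q with hr
  have hq1 : 1 - q ∈ wIdeal wt 1 := by
    have h1 : r = X none ^ d * (1 - q) - B * q := by rw [hr]; ring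
    rw [h1, iterate_map_sub, iterate_sh_X_pow_mul, sub_eq_zero] at hq
    rw [hq]
    exact iterate_sh_mem_wIdeal rfl (Ideal.mul_mem_right _ _ hB) d
  have hrm : r ∈ wIdeal wt 1 := by
    have h1 : r = X none ^ d * (1 - q) - B * q := by rw [hr]; ring
    rw [h1]
    exact Ideal.sub_mem _ (Ideal.mul_mem_left _ _ hq1) (Ideal.mul_mem_right _ _ hB)
  have hq0 : IsUnit q := by
    have := constantCoeff_of_mem_wIdeal hq1
    rw [map_sub, map_one, sub_eq_zero] at this
    rw [isUnit_iff_constantCoeff, ← this]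
    exact isUnit_one
  refine ⟨fun l => -kc (sh^[l] r), fun l => ?_, (↑v⁻¹ : MvPowerSeries (Option σ) ℝ) * q, v⁻¹.isUnit.mul hq0, ?_⟩
  · rw [map_neg, constantCoeff_kc, constantCoeff_of_mem_wIdeal (iterate_sh_mem_wIdeal rfl hrm _),
      neg_zero]
  · have h2 := iterate_sh_add_sum d r
    rw [hq, mul_zero, zero_add] at h2
    simp only [map_neg, mul_neg, Finset.sum_neg_distrib]
    rw [h2, ← mul_assoc, ← hE, hr]
    ring

end Shift
end ArtinApprox

namespace ArtinApprox

open MvPowerSeries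

section Specialization

variable {σ π κ : Type} [Finite σ] [Finite π]

/-- The substitution keeping the first variable and replacing the others by the series `c`. -/
def specFam (c : π → MvPowerSeries σ ℝ) (o : Option π) : MvPowerSeries (Option σ) ℝ :=
  o.elim (X none) fun p => ren (c p)

/-- The series obtained from a convergent one by specializing all variables but the first. -/
def CC (c : π → MvPowerSeries σ ℝ) (f : MvPowerSeries (Option σ) ℝ) : Prop :=
  ∃ G : MvPowerSeries (Option π) ℝ, Conv G ∧ subst (specFam c) G = f

variable {c : π → MvPowerSeries σ ℝ}

omit [Finite π] in
lemma constantCoeff_specFam (hc : ∀ p, constantCoeff (c p) = 0) (o : Option π) :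
    constantCoeff (specFam c o) = 0 := by
  rcases o with _ | p
  · exact constantCoeff_X none
  · exact (constantCoeff_ren _).trans (hc p)

lemma spec_ren (hc : ∀ p, constantCoeff (c p) = 0) (g : MvPowerSeries π ℝ) :
    subst (specFam c) (ren g) = ren (subst c g) := by
  rw [ren, subst_rename some (constantCoeff_specFam hc), ren_eq_subst,
    subst_subst hc (by simp)]
  simp only [← ren_eq_subst]
  rfl

lemma spec_eq (hc : ∀ p, constantCoeff (c p) = 0) (G : MvPowerSeries (Option π) ℝ) :
    subst (specFam c) G = X none * subst (specFam c) (sh G) + ren (subst c (kc G)) := by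
  have h0 := constantCoeff_specFam hc
  have h := congrArg (sb h0) (sh_add_ren G)
  rw [map_add, map_mul, sb_X, sb_apply, sb_apply, sb_apply, spec_ren hc] at h
  exact h.symm

lemma sh_spec (hc : ∀ p, constantCoeff (c p) = 0) (G : MvPowerSeries (Option π) ℝ) :
    sh (subst (specFam c) G) = subst (specFam c) (sh G) := by
  rw [spec_eq hc G, map_add, sh_X_mul, sh_ren, add_zero]

lemma kc_spec (hc : ∀ p, constantCoeff (c p) = 0) (G : MvPowerSeries (Option π) ℝ) :
    kc (subst (specFam c) G) = subst c (kc G) := by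
  rw [spec_eq hc G, map_add, map_mul, kc_X, zero_mul, zero_add, kc_ren]

lemma iterate_sh_spec (hc : ∀ p, constantCoeff (c p) = 0) (G : MvPowerSeries (Option π) ℝ)
    (d : ℕ) : sh^[d] (subst (specFam c) G) = subst (specFam c) (sh^[d] G) := by
  induction d generalizing G with
  | zero => rfl
  | succ d ih => rw [Function.iterate_succ_apply, Function.iterate_succ_apply, sh_spec hc, ih]

lemma eq_zero_of_kc_iterate_sh {f : MvPowerSeries (Option σ) ℝ}
    (h : ∀ l, kc (sh^[l] f) = 0) : f = 0 := by
  refine eq_zero_of_forall_mem (w := fun _ => 1) fun n => ?_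
  rw [← iterate_sh_add_sum n f]
  simp only [h, map_zero, mul_zero, Finset.sum_const_zero, add_zero]
  refine Ideal.mul_mem_right _ _ ?_
  simpa using pow_mem_wIdeal (X_mem_wIdeal (fun _ : Option σ => 1) none) n

/-- Vanishing of specializations only depends on the convergent relations between the series. -/
lemma spec_eq_zero {c' : π → MvPowerSeries σ ℝ} (hc : ∀ p, constantCoeff (c p) = 0)
    (hc' : ∀ p, constantCoeff (c' p) = 0) (h : ∀ g, Conv g → subst c g = 0 → subst c' g = 0)
    {G : MvPowerSeries (Option π) ℝ} (hG : Conv G) (h0 : subst (specFam c) G = 0) :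
    subst (specFam c') G = 0 := by
  refine eq_zero_of_kc_iterate_sh fun l => ?_
  rw [iterate_sh_spec hc', kc_spec hc']
  refine h _ (hG.iterate_sh l).kc ?_
  rw [← kc_spec hc, ← iterate_sh_spec hc, h0, iterate_map_zero, map_zero]

lemma Conv.spec {G : MvPowerSeries (Option π) ℝ} (hG : Conv G)
    (hc : ∀ p, constantCoeff (c p) = 0) (h : ∀ p, Conv (c p)) :
    Conv (MvPowerSeries.subst (specFam c) G) := by
  refine hG.subst ?_ (constantCoeff_specFam hc)
  rintro (_ | p)
  · exact conv_X none
  · exact (h p).ren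

lemma CC.add (hc : ∀ p, constantCoeff (c p) = 0) {f g : MvPowerSeries (Option σ) ℝ} (hf : CC c f)
    (hg : CC c g) : CC c (f + g) := by
  obtain ⟨F, hF, rfl⟩ := hf
  obtain ⟨G, hG, rfl⟩ := hg
  exact ⟨F + G, hF.add hG, by simp only [← sb_apply (constantCoeff_specFam hc), map_add]⟩

lemma CC.mul (hc : ∀ p, constantCoeff (c p) = 0) {f g : MvPowerSeries (Option σ) ℝ} (hf : CC c f)
    (hg : CC c g) : CC c (f * g) := by
  obtain ⟨F, hF, rfl⟩ := hf
  obtain ⟨G, hG, rfl⟩ := hg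
  exact ⟨F * G, hF.mul hG, by simp only [← sb_apply (constantCoeff_specFam hc), map_mul]⟩

lemma CC.C (hc : ∀ p, constantCoeff (c p) = 0) (r : ℝ) : CC c (MvPowerSeries.C r) :=
  ⟨MvPowerSeries.C r, conv_C r, by
    rw [← sb_apply (constantCoeff_specFam hc), ← algebraMap_eq_C, AlgHom.commutes]
    rfl⟩

lemma CC.neg (hc : ∀ p, constantCoeff (c p) = 0) {f : MvPowerSeries (Option σ) ℝ} (hf : CC c f) :
    CC c (-f) := by
  obtain ⟨F, hF, rfl⟩ := hf
  exact ⟨-F, hF.neg, by simp only [← sb_apply (constantCoeff_specFam hc), map_neg]⟩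

lemma CC.sum (hc : ∀ p, constantCoeff (c p) = 0) (s : Finset κ)
    {f : κ → MvPowerSeries (Option σ) ℝ} (hf : ∀ k ∈ s, CC c (f k)) : CC c (∑ k ∈ s, f k) := by
  choose! F hF h using hf
  refine ⟨∑ k ∈ s, F k, conv_sum hF, ?_⟩
  rw [← sb_apply (constantCoeff_specFam hc), map_sum]
  exact Finset.sum_congr rfl fun k hk => (sb_apply _ _).trans (h k hk)

lemma CC.subst [Finite κ] (hc : ∀ p, constantCoeff (c p) = 0)
    {b : κ → MvPowerSeries (Option σ) ℝ} (hb : ∀ k, CC c (b k))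
    (hb0 : ∀ k, constantCoeff (b k) = 0) {g : MvPowerSeries κ ℝ} (hg : Conv g) :
    CC c (MvPowerSeries.subst b g) := by
  choose G hG h using hb
  have hG0 : ∀ k, constantCoeff (G k) = 0 := fun k => by
    rw [← constantCoeff_subst' (constantCoeff_specFam hc), h, hb0]
  refine ⟨_, hg.subst hG hG0, ?_⟩
  rw [subst_subst hG0 (constantCoeff_specFam hc)]
  simp only [h]

lemma CC.X_none (hc : ∀ p, constantCoeff (c p) = 0) : CC c (X none) :=
  ⟨X none, conv_X none, by rw [← sb_apply (constantCoeff_specFam hc), sb_X]; rfl⟩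

lemma CC.ren (hc : ∀ p, constantCoeff (c p) = 0) (p : π) : CC c (ren (c p)) :=
  ⟨X (some p), conv_X _, by rw [← sb_apply (constantCoeff_specFam hc), sb_X]; rfl⟩

lemma CC.pow (hc : ∀ p, constantCoeff (c p) = 0) {f : MvPowerSeries (Option σ) ℝ} (hf : CC c f)
    (n : ℕ) : CC c (f ^ n) := by
  obtain ⟨F, hF, rfl⟩ := hf
  exact ⟨F ^ n, hF.pow n, by simp only [← sb_apply (constantCoeff_specFam hc), map_pow]⟩

lemma CC.of_conv (hc : ∀ p, constantCoeff (c p) = 0) (hX : ∀ i, ∃ p, c p = X i)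
    {f : MvPowerSeries (Option σ) ℝ} (hf : Conv f) : CC c f := by
  rw [← subst_X_eq_self f]
  refine CC.subst hc ?_ (by simp) hf
  rintro (_ | i)
  · exact CC.X_none hc
  · obtain ⟨p, hp⟩ := hX i
    rw [← ren_X, ← hp]
    exact CC.ren hc p

lemma CC.exists_inv (hc : ∀ p, constantCoeff (c p) = 0) {f : MvPowerSeries (Option σ) ℝ}
    (hf : CC c f) (h0 : constantCoeff f ≠ 0) : ∃ g, CC c g ∧ f * g = 1 := by
  obtain ⟨F, hF, rfl⟩ := hf
  rw [constantCoeff_subst' (constantCoeff_specFam hc)] at h0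
  obtain ⟨G, hG, h⟩ := hF.exists_inv h0
  refine ⟨_, ⟨G, hG, rfl⟩, ?_⟩
  have := congrArg (sb (constantCoeff_specFam hc)) h
  rwa [map_mul, map_one, sb_apply, sb_apply] at this

lemma CC.of_mul (hc : ∀ p, constantCoeff (c p) = 0) {d : ℕ} (p : Fin d → π)
    {H : MvPowerSeries (Option σ) ℝ}
    (h : CC c ((X none ^ d + ∑ l : Fin d, X none ^ (l : ℕ) * ArtinApprox.ren (c (p l))) * H)) :
    CC c H := by
  have h0 := constantCoeff_specFam hc
  obtain ⟨G, hG, hGe⟩ := h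
  set B : MvPowerSeries (Option π) ℝ :=
    ∑ l : Fin d, X none ^ (l : ℕ) * ArtinApprox.ren (X (p l)) with hB
  have hBm : B ∈ wIdeal wt 1 := sum_ren_mem_wIdeal fun l => constantCoeff_X _
  have hBc : Conv B := conv_sum fun l _ => ((conv_X _).pow _).mul (conv_X _).ren
  have hBs : sb h0 B = ∑ l : Fin d, X none ^ (l : ℕ) * ArtinApprox.ren (c (p l)) := by
    rw [hB, map_sum]
    refine Finset.sum_congr rfl fun l _ => ?_
    rw [map_mul, map_pow, sb_X, ren_X, sb_X]
    rfl
  obtain ⟨q, hq, hqc⟩ := exists_div d hBm G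
  refine ⟨q, hqc hG hBc, ?_⟩
  have h1 := congrArg (sb h0) hq
  rw [map_zero, sb_apply, ← iterate_sh_spec hc, ← sb_apply h0, map_sub, map_mul, map_add, map_pow,
    sb_X, hBs, sb_apply, hGe, sb_apply, specFam, Option.elim_none, ← mul_sub] at h1
  exact (sub_eq_zero.mp (eq_zero_of_iterate_sh (sum_ren_mem_wIdeal fun l => hc (p l)) h1)).symm

end Specialization
end ArtinApprox

namespace ArtinApprox

open MvPowerSeries

section Transport

variable {σ τ ι : Type}

/-- The series `a` can be approximated by convergent series satisfying all convergent
relations between the `a i`. -/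
def Approx (a : ι → MvPowerSeries σ ℝ) : Prop :=
  ∀ N : ℕ, ∃ c : ι → MvPowerSeries σ ℝ, (∀ i, Conv (c i)) ∧ (∀ i, constantCoeff (c i) = 0) ∧
    (∀ i, c i - a i ∈ oIdeal σ N) ∧ ∀ g, Conv g → subst a g = 0 → subst c g = 0

variable (σ) in
/-- Artin approximation for power series in the variables `σ`. -/
def Art : Prop := ∀ (ι : Type) [Finite ι] (a : ι → MvPowerSeries σ ℝ),
  (∀ i, constantCoeff (a i) = 0) → Approx a

lemma Approx.of_subst [Finite σ] [Finite τ] [Finite ι] {a : ι → MvPowerSeries σ ℝ}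
    (ha : ∀ i, constantCoeff (a i) = 0) {s : σ → MvPowerSeries τ ℝ} {s' : τ → MvPowerSeries σ ℝ}
    (hs : ∀ i, constantCoeff (s i) = 0) (hs' : ∀ i, constantCoeff (s' i) = 0)
    (hc : ∀ i, Conv (s' i)) (h : ∀ i, subst s' (s i) = X i)
    (H : Approx fun i => subst s (a i)) : Approx a := fun N => by
  obtain ⟨c, hcc, hc0, hca, hg⟩ := H N
  have hinv : ∀ f : MvPowerSeries σ ℝ, subst s' (subst s f) = f := fun f => by
    rw [subst_subst hs hs']
    simp only [h]
    exact subst_X_eq_self f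
  refine ⟨fun i => subst s' (c i), fun i => (hcc i).subst hc hs',
    fun i => (constantCoeff_subst' hs' _).trans (hc0 i), fun i => ?_, fun g hgc hga => ?_⟩
  · have h1 := subst_mem_oIdeal hs' (hca i)
    rwa [← sb_apply hs', map_sub, sb_apply, sb_apply, hinv] at h1
  · rw [← subst_subst hc0 hs', hg g hgc, ← sb_apply hs', map_zero]
    rw [← subst_subst ha hs, hga, ← sb_apply hs, map_zero]

lemma Art.of_equiv [Finite σ] (e : σ ≃ τ) (h : Art σ) : Art τ := fun ι _ a ha => by
  have := Finite.of_equiv _ e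
  refine Approx.of_subst ha (s := fun i => X (e.symm i)) (s' := fun i => X (e i)) (by simp)
    (by simp) (fun _ => conv_X _) (fun i => ?_)
    (h ι _ fun i => (constantCoeff_subst' (by simp) _).trans (ha i))
  rw [← sb_apply (by simp), sb_X, e.apply_symm_apply]

lemma Art.of_isEmpty [IsEmpty σ] : Art σ := fun ι _ a ha N =>
  ⟨a, fun i => by
    have h : a i = C (constantCoeff (a i)) := by
      ext α
      obtain rfl : α = 0 := Subsingleton.elim _ _
      simp
    rw [h]
    exact conv_C _, ha, fun i => by rw [sub_self]; exact Ideal.zero_mem _, fun _ _ h => h⟩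

end Transport

section Regular

variable {σ : Type} [Finite σ]

/-- The linear change of variables adding multiples of the first variable to the others. -/
def linFam (c : σ → ℝ) (o : Option σ) : MvPowerSeries (Option σ) ℝ :=
  o.elim (X none) fun i => X (some i) + C (c i) * X none

omit [Finite σ] in
lemma constantCoeff_linFam (c : σ → ℝ) (o : Option σ) : constantCoeff (linFam c o) = 0 := by
  rcases o with _ | i <;> simp [linFam]

omit [Finite σ] in
lemma conv_linFam (c : σ → ℝ) (o : Option σ) : Conv (linFam c o) := by
  rcases o with _ | i
  · exact conv_X none
  · exact (conv_X _).add ((conv_C _).mul (conv_X _))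

lemma subst_C {τ : Type} {a : σ → MvPowerSeries τ ℝ}
    (ha : ∀ i, constantCoeff (a i) = 0) (r : ℝ) : subst a (C r : MvPowerSeries σ ℝ) = C r := by
  rw [← sb_apply ha, ← algebraMap_eq_C, AlgHom.commutes, algebraMap_eq_C]

lemma subst_zero_eq {τ : Type} (f : MvPowerSeries σ ℝ) :
    subst (fun _ : σ => (0 : MvPowerSeries τ ℝ)) f = C (constantCoeff f) := by
  have h0 : ∀ _ : σ, constantCoeff (0 : MvPowerSeries τ ℝ) = 0 := fun _ => map_zero _
  rw [← sub_eq_zero, ← subst_C h0, ← sb_apply h0, ← sb_apply h0, ← map_sub, sb_apply]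
  refine eq_zero_of_forall_mem (w := fun _ => 1) fun n => ?_
  refine subst_mem_wIdeal (w := fun _ => n) (hasSubst_of_constantCoeff_zero h0)
    (fun i => Ideal.zero_mem _) (mem_wIdeal.mpr fun α hα => ?_)
  obtain rfl : α = 0 := by
    by_contra hne
    obtain ⟨i, hi⟩ := Finsupp.ne_iff.mp hne
    exact absurd hα (not_lt.mpr (Finsupp.le_weight_of_ne_zero' (fun _ : σ => n) hi))
  simp

lemma subst_linFam (c : σ → ℝ) (o : Option σ) :
    subst (linFam fun i => -c i) (linFam c o) = X o := by
  rw [← sb_apply (constantCoeff_linFam _)]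
  rcases o with _ | i
  · exact sb_X _ none
  · simp only [linFam, Option.elim_some]
    rw [map_add, map_mul, sb_X, sb_X, sb_apply, subst_C (constantCoeff_linFam _)]
    simp [linFam]

omit [Finite σ] in
lemma aeval_C_mul_of_isHomogeneous {τ : Type} {q : MvPolynomial σ ℝ} {n : ℕ}
    (hq : q.IsHomogeneous n) (c : σ → ℝ) (x : MvPowerSeries τ ℝ) :
    MvPolynomial.aeval (fun i => C (c i) * x) q = C (MvPolynomial.eval c q) * x ^ n := by
  classical
  rw [MvPolynomial.aeval_def, MvPolynomial.eval₂_eq, MvPolynomial.eval_eq, map_sum, Finset.sum_mul]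
  refine Finset.sum_congr rfl fun α hα => ?_
  have hd : n = ∑ i ∈ α.support, α i := by
    rw [← hq (MvPolynomial.mem_support_iff.mp hα)]
    exact weight_one_eq_degree α
  rw [algebraMap_eq_C, map_mul, map_prod, mul_assoc, hd, ← Finset.prod_pow_eq_pow_sum,
    ← Finset.prod_mul_distrib]
  simp only [mul_pow, map_pow]

/-- The leading form of a power series. -/
lemma exists_homogeneous_sub_mem {n : ℕ} {f : MvPowerSeries σ ℝ} (hf : f ∈ oIdeal σ n) :
    ∃ q : MvPolynomial σ ℝ, q.IsHomogeneous n ∧ f - q ∈ oIdeal σ (n + 1) := by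
  classical
  obtain ⟨p, hp⟩ := exists_polynomial_sub_mem f (n + 1)
  refine ⟨MvPolynomial.homogeneousComponent n p,
    MvPolynomial.homogeneousComponent_isHomogeneous n p, ?_⟩
  rw [mem_oIdeal] at hp hf ⊢
  intro α hα
  have h1 := hp α hα
  rw [map_sub, MvPolynomial.coeff_coe] at h1
  rw [map_sub, MvPolynomial.coeff_coe, MvPolynomial.coeff_homogeneousComponent]
  split_ifs with hd
  · exact h1
  · rw [sub_zero]
    exact hf α (by omega)

/-- A power series vanishing on all lines with given nonzero first coordinate is zero. -/
lemma eq_zero_of_forall_line {f : MvPowerSeries (Option σ) ℝ}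
    (h : ∀ c : Option σ → ℝ, c none = 1 →
      subst (fun o => C (c o) * X none : Option σ → MvPowerSeries (Option σ) ℝ) f = 0) :
    f = 0 := by
  classical
  refine eq_zero_of_forall_mem (w := fun _ => 1) fun n => ?_
  induction n with
  | zero => exact mem_wIdeal_zero _
  | succ n ih =>
    obtain ⟨q, hqh, hfq⟩ := exists_homogeneous_sub_mem ih
    have hev : ∀ c : Option σ → ℝ, c none = 1 → MvPolynomial.eval c q = 0 := fun c hc => by
      have h0 : ∀ o : Option σ, constantCoeff (C (c o) * X none : MvPowerSeries (Option σ) ℝ) = 0 :=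
        fun o => by simp
      have h1 := subst_mem_oIdeal h0 hfq
      have hs : subst (fun o => C (c o) * X none : Option σ → MvPowerSeries (Option σ) ℝ)
          (q : MvPowerSeries (Option σ) ℝ) = _ := subst_coe q
      rw [← sb_apply h0, map_sub, sb_apply, sb_apply, h c hc, zero_sub, hs,
        aeval_C_mul_of_isHomogeneous hqh] at h1
      have h2 := mem_oIdeal.mp h1 (Finsupp.single none n) (by simp)
      simpa [X_pow_eq, coeff_monomial] using h2
    have hev' : ∀ c : Option σ → ℝ, MvPolynomial.eval c (q * MvPolynomial.X none) = 0 := fun c => by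
      rw [map_mul, MvPolynomial.eval_X]
      by_cases hc : c none = 0
      · rw [hc, mul_zero]
      · have h1 := aeval_C_mul_of_isHomogeneous (τ := σ) hqh (fun o => c o / c none) (C (c none))
        have h2 := hev (fun o => c o / c none) (div_self hc)
        rw [h2, map_zero, zero_mul] at h1
        have h3 : (fun o => C (c o / c none) * C (c none) : Option σ → MvPowerSeries σ ℝ) =
            fun o => algebraMap ℝ _ (c o) := by
          funext o
          rw [← map_mul, div_mul_cancel₀ _ hc, algebraMap_eq_C]
        have h5 := MvPolynomial.aeval_algebraMap_apply (MvPowerSeries σ ℝ) c q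
        rw [h3] at h1
        rw [show (algebraMap ℝ (MvPowerSeries σ ℝ) ∘ c) = fun o => algebraMap ℝ _ (c o) from rfl,
          h1, algebraMap_eq_C] at h5
        have h4 := congrArg constantCoeff h5
        rw [constantCoeff_C, map_zero] at h4
        rw [← MvPolynomial.coe_aeval_eq_eval, RingHom.coe_coe, ← h4, zero_mul]
    have hq0 : q = 0 := by
      have : q * MvPolynomial.X none = 0 := MvPolynomial.funext fun c => by rw [hev' c, map_zero]
      exact (mul_eq_zero.mp this).resolve_right (MvPolynomial.X_ne_zero none)
    rw [hq0, MvPolynomial.coe_zero, sub_zero] at hfq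
    exact hfq

/-- After a linear change of variables, a nonzero series is regular in the first variable. -/
lemma exists_regular {f : MvPowerSeries (Option σ) ℝ} (hf : f ≠ 0) :
    ∃ (c : σ → ℝ) (d : ℕ), (∀ l < d, constantCoeff (sh^[l] (subst (linFam c) f)) = 0) ∧
      constantCoeff (sh^[d] (subst (linFam c) f)) ≠ 0 := by
  classical
  by_contra! H
  refine hf (eq_zero_of_forall_line fun c hc => ?_)
  have hall : ∀ d, constantCoeff (sh^[d] (subst (linFam fun i => c (some i)) f)) = 0 := fun d => by
    induction d using Nat.strong_induction_on with
    | _ d ih => exact H _ d ih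
  have h0 : ∀ p : σ, constantCoeff (0 : MvPowerSeries σ ℝ) = 0 := by simp
  have h1 : subst (specFam fun _ : σ => (0 : MvPowerSeries σ ℝ))
      (subst (linFam fun i => c (some i)) f) = 0 := by
    refine eq_zero_of_kc_iterate_sh fun l => ?_
    rw [iterate_sh_spec h0, kc_spec h0]
    rw [subst_zero_eq, constantCoeff_kc, hall l, map_zero]
  rw [subst_subst (constantCoeff_linFam _) (constantCoeff_specFam h0)] at h1
  rw [← h1]
  have h3 : (fun o => C (c o) * X none : Option σ → MvPowerSeries (Option σ) ℝ) = fun o =>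
      subst (specFam fun _ : σ => (0 : MvPowerSeries σ ℝ)) (linFam (fun i => c (some i)) o) := by
    funext o
    rw [← sb_apply (constantCoeff_specFam h0)]
    rcases o with _ | i
    · simp only [linFam, Option.elim_none]
      rw [sb_X, hc, map_one, one_mul]
      rfl
    · simp only [linFam, Option.elim_some]
      rw [map_add, map_mul, sb_X, sb_X, sb_apply, subst_C (constantCoeff_specFam h0)]
      simp [specFam]
  rw [h3]

end Regular
end ArtinApprox

namespace ArtinApprox

open MvPowerSeries

section Induction

variable {σ τ ι : Type}

/-- A maximal system of convergent relations with nonvanishing Jacobian determinant. -/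
lemma exists_maximal_relations [Fintype ι] [DecidableEq ι] {a : ι → MvPowerSeries τ ℝ}
    (ha : ∀ i, constantCoeff (a i) = 0) :
    ∃ (S : Set ι) (f : ι → MvPowerSeries ι ℝ), (∀ i, Conv (f i)) ∧
      (∀ i ∈ S, subst a (f i) = 0) ∧ (∀ i ∉ S, f i = X i) ∧ subst a (jac f).det ≠ 0 ∧
      ∀ k ∉ S, ∀ p, Conv p → subst a p = 0 → subst a (jacDet f k p) = 0 := by
  set P : Set (Set ι) := {S | ∃ f : ι → MvPowerSeries ι ℝ, (∀ i, Conv (f i)) ∧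
      (∀ i ∈ S, subst a (f i) = 0) ∧ (∀ i ∉ S, f i = X i) ∧ subst a (jac f).det ≠ 0} with hP
  have hne : P.Nonempty := by
    refine ⟨∅, X, conv_X, by simp, by simp, ?_⟩
    have h1 : jac (X : ι → MvPowerSeries ι ℝ) = 1 := by
      ext1 i j
      change pderiv ℝ j (X i : MvPowerSeries ι ℝ) = _
      rw [Matrix.one_apply, pderiv_X, Pi.single_apply]
    rw [h1, Matrix.det_one, ← sb_apply ha, map_one]
    exact one_ne_zero
  obtain ⟨S, hS⟩ := P.toFinite.exists_maximal hne
  obtain ⟨f, hf, hfS, hfX, hD⟩ := hS.prop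
  refine ⟨S, f, hf, hfS, hfX, hD, fun k hk p hp hpa => ?_⟩
  by_contra hne
  refine hk (hS.le_of_ge (y := insert k S) ⟨Function.update f k p, fun i => ?_, fun i hi => ?_,
    fun i hi => ?_, ?_⟩ (Set.subset_insert k S) (Set.mem_insert k S))
  · rcases eq_or_ne i k with rfl | h
    · rwa [Function.update_self]
    · rw [Function.update_of_ne h]
      exact hf i
  · rcases eq_or_ne i k with rfl | h
    · rwa [Function.update_self]
    · rw [Function.update_of_ne h]
      exact hfS i (hi.resolve_left h)
  · rw [Set.mem_insert_iff, not_or] at hi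
    rw [Function.update_of_ne hi.1]
    exact hfX i hi.2
  · have h1 : jac (Function.update f k p) = (jac f).updateRow k fun j => pderiv ℝ j p := by
      ext1 i j
      rw [Matrix.updateRow_apply]
      split_ifs with h
      · change pderiv ℝ j (Function.update f k p i) = _
        rw [h, Function.update_self]
      · change pderiv ℝ j (Function.update f k p i) = pderiv ℝ j (f i)
        rw [Function.update_of_ne h]
    rw [h1]
    exact hne

lemma wIdeal_scale {w : σ → ℕ} {n : ℕ} (M : ℕ) {f : MvPowerSeries σ ℝ} (hf : f ∈ wIdeal w n) :
    f ∈ wIdeal (fun i => M * w i) (M * n) := fun α hα => by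
  refine hf α (lt_of_mul_lt_mul_left' (a := M) (lt_of_eq_of_lt ?_ hα))
  rw [Finsupp.weight_apply, Finsupp.weight_apply, Finsupp.sum, Finsupp.sum, Finset.mul_sum]
  refine Finset.sum_congr rfl fun i _ => ?_
  rw [smul_eq_mul, smul_eq_mul, mul_left_comm]

lemma exists_approx_of_CC [Finite σ] [Finite ι] {π : Type} [Finite π] (h : Art σ)
    {c : π → MvPowerSeries σ ℝ} (hc : ∀ p, constantCoeff (c p) = 0)
    {a : ι → MvPowerSeries (Option σ) ℝ} (ha : ∀ i, constantCoeff (a i) = 0)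
    (hac : ∀ i, CC c (a i)) (N : ℕ) :
    ∃ c : ι → MvPowerSeries (Option σ) ℝ, (∀ i, Conv (c i)) ∧ (∀ i, constantCoeff (c i) = 0) ∧
    (∀ i, c i - a i ∈ oIdeal _ N) ∧ ∀ g, Conv g → subst a g = 0 → subst c g = 0 := by
  choose Φ hΦ hΦa using hac
  have hsc := constantCoeff_specFam hc
  have hΦ0 : ∀ i, constantCoeff (Φ i) = 0 := fun i => by
    rw [← constantCoeff_subst' hsc, hΦa, ha]
  obtain ⟨c', hc'c, hc', hcc, hg⟩ := h π c hc N
  have hsc' := constantCoeff_specFam hc'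
  refine ⟨fun i => subst (specFam c') (Φ i), fun i => (hΦ i).spec hc' hc'c,
    fun i => (constantCoeff_subst' hsc' _).trans (hΦ0 i), fun i => ?_, fun g hgc hga => ?_⟩
  · rw [← hΦa]
    refine subst_sub_subst_mem _ hsc' hsc ?_ _
    rintro (_ | p)
    · exact (sub_self (X none : MvPowerSeries (Option σ) ℝ)).symm ▸ Ideal.zero_mem _
    · change ren (c' p) - ren (c p) ∈ _
      rw [← map_sub, ren_eq_subst]
      exact subst_mem_oIdeal (by simp) (hcc p)
  · rw [← subst_subst hΦ0 hsc']
    refine spec_eq_zero hc hc' hg (hgc.subst hΦ hΦ0) ?_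
    rw [subst_subst hΦ0 hsc]
    simpa only [hΦa] using hga

/-- A solution of a system with regular Jacobian determinant can be approximated by one whose
components are algebraic over finitely many series in fewer variables. -/
lemma exists_CC_approx [Finite σ] [Fintype ι] [DecidableEq ι]
    {a : ι → MvPowerSeries (Option σ) ℝ} (ha : ∀ i, constantCoeff (a i) = 0) {S : Set ι}
    {f : ι → MvPowerSeries ι ℝ} (hf : ∀ i, Conv (f i)) (hfS : ∀ i ∈ S, subst a (f i) = 0)
    (hfX : ∀ i ∉ S, f i = X i) (hD : subst a (jac f).det ≠ 0)
    (hmax : ∀ k ∉ S, ∀ p, Conv p → subst a p = 0 → subst a (jacDet f k p) = 0) {d : ℕ}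
    (hl : ∀ l < d, constantCoeff (sh^[l] (subst a (jac f).det ^ 2)) = 0)
    (hd : constantCoeff (sh^[d] (subst a (jac f).det ^ 2)) ≠ 0) (N : ℕ) :
    ∃ (π : Type) (_ : Finite π) (c : π → MvPowerSeries σ ℝ), (∀ p, constantCoeff (c p) = 0) ∧
      ∃ a' : ι → MvPowerSeries (Option σ) ℝ, (∀ i, CC c (a' i)) ∧
        (∀ i, a' i - a i ∈ oIdeal _ (N + 1)) ∧
        ∀ p, Conv p → subst a p = 0 → subst a' p = 0 := by
  classical
  set D := subst a (jac f).det with hDdef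
  obtain ⟨w, hw, u, hu, hW⟩ := exists_prep hl hd
  obtain ⟨u', huu, -⟩ := isUnit_iff_exists.mp hu
  set W := X none ^ d + ∑ l : Fin d, X none ^ (l : ℕ) * ren (w l) with hWdef
  have hdiv := fun i => exists_div d (sum_ren_mem_wIdeal hw) (a i)
  choose q hq _ using hdiv
  have hpol := fun i => exists_polynomial_sub_mem (q i) (N + 1)
  choose p hp using hpol
  set h : ι → MvPowerSeries (Option σ) ℝ := fun i => q i - p i with hh
  have hh0 : ∀ i, constantCoeff (h i) = 0 := fun i => constantCoeff_of_mem_wIdeal (hp i)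
  set r : ι → MvPowerSeries (Option σ) ℝ := fun i => a i - W * q i with hr
  set t : ι → MvPowerSeries (Option σ) ℝ := fun i => W * p i + r i with ht
  have hta : ∀ i, t i = a i - W * h i := fun i => by simp only [ht, hr, hh]; ring
  have ht0 : ∀ i, constantCoeff (t i) = 0 := fun i => by
    rw [hta, map_sub, map_mul, hh0, ha, mul_zero, sub_zero]
  set c : Fin d ⊕ (ι × Fin d) ⊕ σ → MvPowerSeries σ ℝ := Sum.elim w (Sum.elim
    (fun x => kc (sh^[x.2] (r x.1)) - C (constantCoeff (kc (sh^[x.2] (r x.1))))) X) with hcdef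
  have hc : ∀ x, constantCoeff (c x) = 0 := by
    rintro (l | x | i)
    · exact hw l
    · simp [hcdef]
    · exact constantCoeff_X i
  have hconv : ∀ {g : MvPowerSeries (Option σ) ℝ}, Conv g → CC c g := fun hg =>
    CC.of_conv hc (fun i => ⟨Sum.inr (Sum.inr i), rfl⟩) hg
  have hWc : CC c W := CC.add hc ((CC.X_none hc).pow hc d) (CC.sum hc _ fun l _ =>
    CC.mul hc ((CC.X_none hc).pow hc _) (CC.ren hc (Sum.inl l)))
  have hrc : ∀ i, CC c (r i) := fun i => by
    have h1 := iterate_sh_add_sum d (r i)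
    rw [show sh^[d] (r i) = 0 from hq i, mul_zero, zero_add] at h1
    rw [← h1]
    refine CC.sum hc _ fun l _ => CC.mul hc ((CC.X_none hc).pow hc _) ?_
    have h2 : ren (kc (sh^[l] (r i))) = ren (c (Sum.inr (Sum.inl (i, l)))) +
        C (constantCoeff (kc (sh^[l] (r i)))) := by
      have h3 : c (Sum.inr (Sum.inl (i, l))) =
        kc (sh^[l] (r i)) - C (constantCoeff (kc (sh^[l] (r i)))) := rfl
      rw [h3, map_sub, ren_eq_subst (C _), subst_C (by simp), sub_add_cancel]
    rw [h2]
    exact CC.add hc (CC.ren hc _) (CC.C hc _)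
  have htc : ∀ i, CC c (t i) := fun i => CC.add hc (CC.mul hc hWc (hconv (conv_coe _))) (hrc i)
  have hdiv : ∀ {H : MvPowerSeries (Option σ) ℝ}, CC c (W * H) → CC c H := fun hH =>
    CC.of_mul hc (fun l => Sum.inl l) hH
  set Dt := subst t (jac f).det with hDt
  have hdetc : Conv (jac f).det := conv_det fun i j => conv_jac hf i j
  have hDtc : CC c Dt := CC.subst hc htc ht0 hdetc
  set v₁ : ι → MvPowerSeries (Option σ) ℝ := fun i => -(D * u * h i) with hv₁
  have hv₁0 : ∀ i, constantCoeff (v₁ i) = 0 := fun i => by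
    simp only [hv₁, map_neg, map_mul, hh0, mul_zero, neg_zero]
  have htv : t = fun i => a i + D * v₁ i := by
    funext i
    rw [hta, hW, hv₁]
    ring
  obtain ⟨e, he0, he⟩ := exists_unit_subst ha hv₁0 (jac f).det D
  rw [← htv, ← hDdef, ← hDt] at he
  have hU : Dt ^ 2 = W * (u' * (1 + e) ^ 2) := by
    rw [he, hW, mul_assoc, ← mul_assoc u u', huu]
    ring
  have hu0 : constantCoeff u' ≠ 0 := fun h0 => by
    have := congrArg constantCoeff huu
    rw [map_mul, h0, mul_zero, map_one] at this
    exact zero_ne_one this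
  obtain ⟨Y, hYc, hY⟩ := CC.exists_inv hc (hdiv (hU ▸ hDtc.pow hc 2)) (by simpa [he0] using hu0)
  have hb : ∀ i, ∃ b ∈ oIdeal (Option σ) (N + 1), CC c b ∧ (i ∈ S → subst t (f i) = W * b) ∧
      (i ∉ S → b = 0) := fun i => by
    by_cases hi : i ∈ S
    · obtain ⟨G, -, hG⟩ := exists_taylor_one (f i)
      have h1 := hG (Option σ) a (fun i => D * v₁ i) ha
        (fun i => by rw [map_mul, hv₁0, mul_zero])
      rw [← htv, hfS i hi, zero_add] at h1
      have h2 : subst t (f i) =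
          W * -∑ j, h j * subst (Sum.elim a fun i => D * v₁ i) (G j) := by
        rw [h1, mul_neg, Finset.mul_sum, ← Finset.sum_neg_distrib]
        refine Finset.sum_congr rfl fun j _ => ?_
        rw [hW, hv₁]
        ring
      refine ⟨_, Ideal.neg_mem_iff _ |>.mpr (Ideal.sum_mem _ fun j _ =>
        Ideal.mul_mem_right _ _ (hp j)), hdiv ?_, fun _ => h2, fun h => absurd hi h⟩
      rw [← h2]
      exact CC.subst hc htc ht0 (hf i)
    · exact ⟨0, Ideal.zero_mem _, hconv conv_zero, fun h => absurd h hi, fun _ => rfl⟩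
  choose b hbN hbc hbS hbX using hb
  set ζ : ι → MvPowerSeries (Option σ) ℝ := fun i => -(Y * b i) with hζ
  have hζN : ∀ i, ζ i ∈ oIdeal (Option σ) (N + 1) := fun i =>
    Ideal.neg_mem_iff _ |>.mpr (Ideal.mul_mem_left _ _ (hbN i))
  have hζ0 : ∀ i, constantCoeff (ζ i) = 0 := fun i => constantCoeff_of_mem_wIdeal (hζN i)
  obtain ⟨V, hV, hV1, hVf⟩ := exists_newton f hf
  have hVN : ∀ i, subst (Sum.elim t ζ) (V i) ∈ oIdeal (Option σ) (N + 1) := fun i => by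
    have h1 := wIdeal_scale (N + 1) (hV1 i)
    rw [mul_one] at h1
    refine subst_mem_wIdeal
      (hasSubst_of_constantCoeff_zero (constantCoeff_sumElim ht0 hζ0)) ?_ h1
    rintro (j | j)
    · exact mem_wIdeal_zero _
    · simpa using hζN j
  have hV0 : ∀ i, constantCoeff (subst (Sum.elim t ζ) (V i)) = 0 := fun i =>
    constantCoeff_of_mem_wIdeal (hVN i)
  set v : ι → MvPowerSeries (Option σ) ℝ := fun i =>
    v₁ i + (1 + e) * subst (Sum.elim t ζ) (V i) with hv
  have ha' : (fun i => t i + Dt * subst (Sum.elim t ζ) (V i)) = fun i => a i + D * v i := by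
    funext i
    rw [congrFun htv i, he, hv]
    ring
  have hfa' := hVf (Option σ) t ζ ht0 hζ0
  rw [← hDt, ha'] at hfa'
  refine ⟨_, inferInstance, c, hc, fun i => a i + D * v i, fun i => ?_, fun i => ?_,
    fun p hp hpa => ?_⟩
  · rw [← ha']
    refine CC.add hc (htc i) (CC.mul hc hDtc (CC.subst hc ?_ (constantCoeff_sumElim ht0 hζ0) (hV i)))
    rintro (j | j)
    · exact htc j
    · exact CC.neg hc (CC.mul hc hYc (hbc j))
  · rw [← ha']
    beta_reduce
    rw [hta, add_sub_right_comm, sub_sub_cancel_left]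
    exact Ideal.add_mem _ (Ideal.neg_mem_iff _ |>.mpr (Ideal.mul_mem_left _ _ (hp i)))
      (Ideal.mul_mem_left _ _ (hVN i))
  · refine path_vanish ha hf hD hmax (v := v) (ζ := fun i => if i ∈ S then 0 else -(u * h i))
      (fun i => ?_) (fun i => ?_) (fun i hi => if_pos hi) (fun i => ?_) hp hpa
    · simp only [hv, map_add, map_mul, hv₁0, hV0, mul_zero, add_zero]
    · split_ifs
      · exact map_zero _
      · rw [map_neg, map_mul, hh0, mul_zero, neg_zero]
    · rw [← hDdef, hfa' i, hU]
      split_ifs with hi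
      · rw [hfS i hi, hbS i hi, hζ]
        linear_combination (-(W * b i)) * hY
      · rw [hfX i hi, ← sb_apply ht0, sb_X, ← sb_apply ha, sb_X, hta, hW, hζ]
        simp only [hbX i hi]
        ring

theorem Art.option [Finite σ] (h : Art σ) : Art (Option σ) := fun ι _ a ha => by
  classical
  have := Fintype.ofFinite ι
  obtain ⟨S, f, hf, hfS, hfX, hD, hmax⟩ := exists_maximal_relations ha
  obtain ⟨c, d, hl, hd⟩ := exists_regular (pow_ne_zero 2 hD)
  have hs := constantCoeff_linFam c
  have hs' := constantCoeff_linFam fun i => -c i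
  have hinv : ∀ g, subst (linFam fun i => -c i) (subst (linFam c) g) = g := fun g => by
    rw [subst_subst hs hs']
    simp only [subst_linFam]
    exact subst_X_eq_self g
  have hzero : ∀ g, subst (linFam c) g = 0 ↔ g = 0 := fun g => by
    refine ⟨fun h0 => ?_, fun h0 => ?_⟩
    · rw [← hinv g, h0, ← sb_apply hs', map_zero]
    · rw [h0, ← sb_apply hs, map_zero]
  have hb0 : ∀ i, constantCoeff (subst (linFam c) (a i)) = 0 := fun i =>
    (constantCoeff_subst' hs _).trans (ha i)
  have hsub : ∀ g, subst (fun i => subst (linFam c) (a i)) g = subst (linFam c) (subst a g) :=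
    fun g => (subst_subst ha hs g).symm
  have hpow : subst (linFam c) (subst a (jac f).det ^ 2) =
      subst (fun i => subst (linFam c) (a i)) (jac f).det ^ 2 := by
    rw [hsub, ← sb_apply hs, map_pow, sb_apply]
  rw [hpow] at hl hd
  refine Approx.of_subst ha hs hs' (conv_linFam _) (subst_linFam c) fun N => ?_
  obtain ⟨π, _, c', hc', a', ha'c, ha'N, ha'⟩ := exists_CC_approx hb0 hf
    (fun i hi => by rw [hsub, hzero, hfS i hi]) hfX (by rwa [hsub, Ne, hzero])
    (fun k hk p hp hpa => by
      rw [hsub, hzero] at hpa ⊢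
      exact hmax k hk p hp hpa) hl hd N
  have ha'0 : ∀ i, constantCoeff (a' i) = 0 := fun i => by
    have := constantCoeff_of_mem_wIdeal (ha'N i)
    rwa [map_sub, hb0, sub_zero] at this
  obtain ⟨b, hb, hb0', hbN, hbg⟩ := exists_approx_of_CC h hc' ha'0 ha'c N
  refine ⟨b, hb, hb0', fun i => ?_, fun g hg hga => hbg g hg (ha' g hg hga)⟩
  rw [← sub_add_sub_cancel _ (a' i)]
  exact Ideal.add_mem _ (hbN i) (wIdeal_anti (Nat.le_succ N) (ha'N i))

theorem art [hσ : Finite σ] : Art σ :=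
  Finite.induction_empty_option (P := fun σ => Finite σ → Art σ)
    (fun e h _ => have := Finite.of_equiv _ e.symm; (h this).of_equiv e)
    (fun _ => Art.of_isEmpty) (fun h _ => (h inferInstance).option) σ hσ

end Induction
end ArtinApprox

namespace ArtinApprox

open MvPowerSeries

section WithParameters

variable {σ ι : Type}

/-- Inversion of a convergent change of variables tangent to the identity. -/
lemma exists_compInverse [Finite σ] {s : σ → MvPowerSeries σ ℝ} (hs : ∀ i, Conv (s i))
    {M : ℕ} (hM : 2 ≤ M) (h : ∀ i, s i - X i ∈ oIdeal σ M) :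
    ∃ s' : σ → MvPowerSeries σ ℝ, (∀ i, Conv (s' i)) ∧ (∀ i, constantCoeff (s' i) = 0) ∧
      (∀ i, X i - s' i ∈ oIdeal σ M) ∧ ∀ i, subst s' (s i) = X i := by
  classical
  have := Fintype.ofFinite σ
  obtain ⟨V, hV, hV1, hVs⟩ := exists_newton s hs
  have h0 : ∀ _ : σ, constantCoeff (0 : MvPowerSeries σ ℝ) = 0 := fun _ => map_zero _
  have hX : ∀ i : σ, constantCoeff (X i : MvPowerSeries σ ℝ) = 0 := constantCoeff_X
  have hdet : constantCoeff (jac s).det = 1 := by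
    have h1 : constantCoeff.mapMatrix (jac s) = 1 := by
      ext1 i j
      have h2 := constantCoeff_of_mem_wIdeal (pderiv_mem_oIdeal (wIdeal_anti hM (h i)) j)
      rw [map_sub, map_sub, sub_eq_zero, pderiv_X] at h2
      refine h2.trans ?_
      rw [Matrix.one_apply, Pi.single_apply]
      split_ifs
      · exact map_one _
      · exact map_zero _
    rw [RingHom.map_det, h1, Matrix.det_one]
  set s' : σ → MvPowerSeries σ ℝ := fun i => subst (Sum.elim (fun _ => 0) X) (V i) with hs'
  have h0X := constantCoeff_sumElim h0 hX
  have hs'0 : ∀ i, constantCoeff (s' i) = 0 := fun i => by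
    rw [hs', constantCoeff_subst' h0X, constantCoeff_of_mem_wIdeal (hV1 i)]
  have hs0 : ∀ i, constantCoeff (s i) = 0 := fun i => by
    have := constantCoeff_of_mem_wIdeal (wIdeal_anti (show 0 + 1 ≤ M by omega) (h i))
    rwa [map_sub, hX, sub_zero] at this
  have hinv : ∀ i, subst s' (s i) = X i := fun i => by
    have := hVs σ (fun _ => 0) X h0 hX i
    simpa only [subst_zero_eq, hdet, map_one, one_mul, zero_add, hs0, map_zero, one_pow] using this
  refine ⟨s', fun i => (hV i).subst ?_ h0X, hs'0, fun i => ?_, hinv⟩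
  · rintro (j | j)
    · exact conv_zero
    · exact conv_X j
  · have := subst_mem_oIdeal hs'0 (h i)
    rwa [← sb_apply hs'0, map_sub, sb_X, sb_apply, hinv] at this

/-- Artin approximation for convergent relations involving the variables. -/
theorem exists_conv_approx [Finite σ] [Finite ι] {a : ι → MvPowerSeries σ ℝ}
    (ha : ∀ i, constantCoeff (a i) = 0) (N : ℕ) :
    ∃ c : ι → MvPowerSeries σ ℝ, (∀ i, Conv (c i)) ∧ (∀ i, constantCoeff (c i) = 0) ∧
      (∀ i, c i - a i ∈ oIdeal σ N) ∧
      ∀ g, Conv g → subst (Sum.elim a X) g = 0 → subst (Sum.elim c X) g = 0 := by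
  obtain ⟨b, hb, hb0, hba, hbg⟩ := art (ι ⊕ σ) (Sum.elim a X)
    (constantCoeff_sumElim ha constantCoeff_X) (max N 2)
  obtain ⟨s', hs', hs'0, hs'X, hinv⟩ := exists_compInverse (fun i => hb (Sum.inr i))
    (le_max_right N 2) fun i => hba (Sum.inr i)
  refine ⟨fun i => subst s' (b (Sum.inl i)), fun i => (hb _).subst hs' hs'0,
    fun i => (constantCoeff_subst' hs'0 _).trans (hb0 _), fun i => ?_, fun g hg hga => ?_⟩
  · refine wIdeal_anti (le_max_left N 2) ?_
    rw [← sub_add_sub_cancel _ (b (Sum.inl i))]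
    refine Ideal.add_mem _ ?_ (hba (Sum.inl i))
    have h1 := subst_sub_subst_mem _ hs'0 constantCoeff_X
      (fun i => by rw [← neg_sub]; exact Ideal.neg_mem_iff _ |>.mpr (hs'X i)) (b (Sum.inl i))
    rwa [subst_X_eq_self] at h1
  · have h1 := congrArg (sb hs'0) (hbg g hg hga)
    rw [map_zero, sb_apply, subst_subst hb0 hs'0] at h1
    have h2 : Sum.elim (fun i => subst s' (b (Sum.inl i))) X = fun k => subst s' (b k) := by
      funext k
      rcases k with i | i
      · rfl
      · exact (hinv i).symm
    rw [h2, h1]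

end WithParameters
end ArtinApprox

namespace ArtinApprox

open MvPowerSeries
open scoped ENNReal

section Evaluation

variable {σ τ κ : Type*}

/-- The real number `u ^ α`. -/
def rmon (u : σ → ℝ) (α : σ →₀ ℕ) : ℝ := α.prod fun i k => u i ^ k

/-- The sum of a power series at a point. -/
def ev (f : MvPowerSeries σ ℝ) (u : σ → ℝ) : ℝ := ∑' α, coeff α f * rmon u α

/-- The weighted norm relative to the polyradius `|u|`. -/
def absNorm (u : σ → ℝ) (f : MvPowerSeries σ ℝ) : ℝ≥0∞ := wnorm (fun i => ‖u i‖ₑ) f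

lemma rmon_add (u : σ → ℝ) (α β : σ →₀ ℕ) : rmon u (α + β) = rmon u α * rmon u β := by
  classical
  exact Finsupp.prod_add_index' (by simp) (fun _ _ _ => pow_add _ _ _)

lemma enorm_rmon (u : σ → ℝ) (α : σ →₀ ℕ) : ‖rmon u α‖ₑ = mon (fun i => ‖u i‖ₑ) α := by
  classical
  simp only [rmon, mon, Finsupp.prod]
  induction α.support using Finset.induction_on with
  | empty => simp
  | insert i s hi ih => rw [Finset.prod_insert hi, Finset.prod_insert hi, enorm_mul, ih, enorm_pow]

lemma summable_norm_of_tsum_enorm {f : κ → ℝ} (h : ∑' x, ‖f x‖ₑ ≠ ⊤) :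
    Summable fun x => ‖f x‖ := by
  have := ENNReal.tsum_coe_ne_top_iff_summable.mp h
  simpa using NNReal.summable_coe.mpr this

lemma summable_norm_ev {u : σ → ℝ} {f : MvPowerSeries σ ℝ} (h : absNorm u f ≠ ⊤) :
    Summable fun α => ‖coeff α f * rmon u α‖ := by
  refine summable_norm_of_tsum_enorm ?_
  simp only [enorm_mul, enorm_rmon]
  exact h

lemma enorm_ev_le (u : σ → ℝ) (f : MvPowerSeries σ ℝ) : ‖ev f u‖ₑ ≤ absNorm u f := by
  by_cases h : absNorm u f = ⊤
  · simp [h]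
  · refine enorm_tsum_le_tsum_enorm.trans ?_
    simp only [enorm_mul, enorm_rmon]
    exact le_rfl

lemma ev_monomial (u : σ → ℝ) (α : σ →₀ ℕ) (r : ℝ) : ev (monomial α r) u = r * rmon u α := by
  classical
  rw [ev, tsum_eq_single α]
  · simp
  · intro β h
    simp [coeff_monomial, h]

lemma ev_C (u : σ → ℝ) (r : ℝ) : ev (C r) u = r := by
  rw [← monomial_zero_eq_C_apply, ev_monomial]
  simp [rmon]

lemma ev_one (u : σ → ℝ) : ev 1 u = 1 := by simpa using ev_C u 1

lemma ev_zero (u : σ → ℝ) : ev 0 u = 0 := by simp [ev]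

lemma ev_X (u : σ → ℝ) (i : σ) : ev (X i) u = u i := by
  rw [X, ev_monomial]
  simp [rmon]

lemma ev_sub {u : σ → ℝ} {f g : MvPowerSeries σ ℝ} (hf : absNorm u f ≠ ⊤)
    (hg : absNorm u g ≠ ⊤) : ev (f - g) u = ev f u - ev g u := by
  simp only [ev, map_sub, sub_mul]
  exact (summable_norm_ev hf).of_norm.tsum_sub (summable_norm_ev hg).of_norm

lemma ev_add {u : σ → ℝ} {f g : MvPowerSeries σ ℝ} (hf : absNorm u f ≠ ⊤)
    (hg : absNorm u g ≠ ⊤) : ev (f + g) u = ev f u + ev g u := by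
  simp only [ev, map_add, add_mul]
  exact (summable_norm_ev hf).of_norm.tsum_add (summable_norm_ev hg).of_norm

lemma tsum_mul_tsum_eq_of_norm {A : Type*} [AddCommMonoid A] [Finset.HasAntidiagonal A]
    {f g : A → ℝ} (hf : Summable fun a => ‖f a‖) (hg : Summable fun a => ‖g a‖) :
    (∑' a, f a) * ∑' a, g a = ∑' a, ∑ p ∈ Finset.HasAntidiagonal.antidiagonal a, f p.1 * g p.2 :=
  hf.of_norm.tsum_mul_tsum_eq_tsum_sum_antidiagonal hg.of_norm
    (summable_mul_of_summable_norm hf hg)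

lemma ev_mul {u : σ → ℝ} {f g : MvPowerSeries σ ℝ} (hf : absNorm u f ≠ ⊤)
    (hg : absNorm u g ≠ ⊤) : ev (f * g) u = ev f u * ev g u := by
  classical
  have hf' := summable_norm_ev hf
  have hg' := summable_norm_ev hg
  calc ev (f * g) u = ∑' α, ∑ p ∈ Finset.HasAntidiagonal.antidiagonal α,
        (coeff p.1 f * rmon u p.1) * (coeff p.2 g * rmon u p.2) := by
        refine tsum_congr fun α => ?_
        rw [coeff_mul, Finset.sum_mul]
        refine Finset.sum_congr rfl fun p hp => ?_
        rw [← Finset.HasAntidiagonal.mem_antidiagonal.mp hp, rmon_add]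
        ring
    _ = ev f u * ev g u := by
        exact (tsum_mul_tsum_eq_of_norm hf' hg').symm

lemma absNorm_prod_ne_top {u : σ → ℝ} (s : Finset κ) {f : κ → MvPowerSeries σ ℝ}
    (hf : ∀ i, absNorm u (f i) ≠ ⊤) : absNorm u (∏ i ∈ s, f i) ≠ ⊤ :=
  ne_top_of_le_ne_top (ENNReal.prod_ne_top fun i _ => hf i) (wnorm_prod_le _ _ _)

lemma ev_prod {u : σ → ℝ} (s : Finset κ) {f : κ → MvPowerSeries σ ℝ}
    (hf : ∀ i, absNorm u (f i) ≠ ⊤) : ev (∏ i ∈ s, f i) u = ∏ i ∈ s, ev (f i) u := by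
  classical
  induction s using Finset.induction_on with
  | empty => simp [ev_one]
  | insert i s hi ih =>
    rw [Finset.prod_insert hi, Finset.prod_insert hi, ev_mul (hf i) (absNorm_prod_ne_top s hf), ih]

lemma absNorm_pow_ne_top {u : σ → ℝ} {f : MvPowerSeries σ ℝ} (hf : absNorm u f ≠ ⊤) (n : ℕ) :
    absNorm u (f ^ n) ≠ ⊤ := by
  simpa using absNorm_prod_ne_top (Finset.range n) fun _ => hf

lemma ev_pow {u : σ → ℝ} {f : MvPowerSeries σ ℝ} (hf : absNorm u f ≠ ⊤) (n : ℕ) :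
    ev (f ^ n) u = ev f u ^ n := by
  simpa using ev_prod (Finset.range n) fun _ => hf

lemma ev_finsuppProd {u : τ → ℝ} {a : σ → MvPowerSeries τ ℝ} (ha : ∀ i, absNorm u (a i) ≠ ⊤)
    (α : σ →₀ ℕ) : ev (α.prod fun i k => a i ^ k) u = rmon (fun i => ev (a i) u) α := by
  rw [Finsupp.prod, ev_prod _ fun i => absNorm_pow_ne_top (ha i) _]
  exact Finset.prod_congr rfl fun i _ => ev_pow (ha i) _

lemma absNorm_coe_ne_top (u : σ → ℝ) (p : MvPolynomial σ ℝ) :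
    absNorm u (p : MvPowerSeries σ ℝ) ≠ ⊤ := by
  induction p using MvPolynomial.induction_on with
  | C r => simp [absNorm, wnorm_C]
  | add p q hp hq =>
    rw [MvPolynomial.coe_add]
    exact ne_top_of_le_ne_top (ENNReal.add_ne_top.mpr ⟨hp, hq⟩) (wnorm_add_le _ _ _)
  | mul_X p i hp =>
    rw [MvPolynomial.coe_mul, MvPolynomial.coe_X]
    refine ne_top_of_le_ne_top (ENNReal.mul_ne_top hp ?_) (wnorm_mul_le _ _ _)
    simp [wnorm_X]

lemma ev_coe (u : σ → ℝ) (p : MvPolynomial σ ℝ) :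
    ev (p : MvPowerSeries σ ℝ) u = MvPolynomial.eval u p := by
  induction p using MvPolynomial.induction_on with
  | C r => simp [ev_C]
  | add p q hp hq =>
    rw [MvPolynomial.coe_add, ev_add (absNorm_coe_ne_top u p) (absNorm_coe_ne_top u q), hp, hq,
      map_add]
  | mul_X p i hp =>
    rw [MvPolynomial.coe_mul, ev_mul (absNorm_coe_ne_top u p) (absNorm_coe_ne_top u _), hp,
      MvPolynomial.coe_X, ev_X, map_mul, MvPolynomial.eval_X]

/-- Substitution of power series is compatible with evaluation. -/
lemma ev_subst {u : τ → ℝ} {a : σ → MvPowerSeries τ ℝ} (ha : HasSubst a)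
    (ha' : ∀ i, absNorm u (a i) ≠ ⊤) {f : MvPowerSeries σ ℝ}
    (hf : wnorm (fun i => absNorm u (a i)) f ≠ ⊤) :
    ev (subst a f) u = ev f fun i => ev (a i) u := by
  have hs : Summable (Function.uncurry fun (β : τ →₀ ℕ) (α : σ →₀ ℕ) =>
      coeff α f * coeff β (α.prod fun i k => a i ^ k) * rmon u β) := by
    refine Summable.of_norm (summable_norm_of_tsum_enorm ?_)
    refine ne_top_of_le_ne_top hf ?_
    rw [ENNReal.tsum_prod', ENNReal.tsum_comm]
    refine ENNReal.tsum_le_tsum fun α => ?_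
    simp only [Function.uncurry_apply_pair, enorm_mul, enorm_rmon, mul_assoc]
    rw [ENNReal.tsum_mul_left]
    gcongr
    exact wnorm_finsuppProd_le _ a α
  calc ev (subst a f) u
      = ∑' β, ∑' α, coeff α f * coeff β (α.prod fun i k => a i ^ k) * rmon u β := by
        refine tsum_congr fun β => ?_
        rw [coeff_subst ha, ← tsum_eq_finsum (L := .unconditional _) (coeff_subst_finite ha f β),
          tsum_mul_right]
        rfl
    _ = ∑' α, ∑' β, coeff α f * coeff β (α.prod fun i k => a i ^ k) * rmon u β :=
        hs.tsum_comm.symm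
    _ = _ := by
        refine tsum_congr fun α => ?_
        simp only [mul_assoc]
        rw [tsum_mul_left, ← ev_finsuppProd ha']
        rfl

end Evaluation

end ArtinApprox

namespace ArtinApprox

open MvPowerSeries Filter Topology Asymptotics
open scoped ENNReal

section NearZero

variable {σ τ ι : Type}

lemma eventually_enorm_le [Finite σ] {r : ℝ≥0∞} (hr : r ≠ 0) :
    ∀ᶠ u : σ → ℝ in 𝓝 0, ∀ i, ‖u i‖ₑ ≤ r := by
  refine eventually_all.mpr fun i => ?_
  have h : Tendsto (fun u : σ → ℝ => ‖u i‖ₑ) (𝓝 0) (𝓝 0) := by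
    have : Continuous fun u : σ → ℝ => ‖u i‖ₑ := (continuous_apply i).enorm
    simpa using this.tendsto 0
  exact h.eventually_le_const (pos_iff_ne_zero.mpr hr)

lemma Conv.eventually_ne_top [Finite σ] {f : MvPowerSeries σ ℝ} (hf : Conv f) :
    ∀ᶠ u in 𝓝 0, absNorm u f ≠ ⊤ := by
  obtain ⟨r, hr0, hr⟩ := hf
  filter_upwards [eventually_enorm_le hr0] with u hu
  exact ne_top_of_le_ne_top hr (wnorm_mono hu f)

lemma Conv.eventually_absNorm_le [Finite σ] {f : MvPowerSeries σ ℝ} (hf : Conv f)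
    (h0 : constantCoeff f = 0) {ε : ℝ≥0∞} (hε : ε ≠ 0) : ∀ᶠ u in 𝓝 0, absNorm u f ≤ ε := by
  obtain ⟨r, hr0, -, hr⟩ := hf.exists_wnorm_le h0 hε
  filter_upwards [eventually_enorm_le hr0] with u hu
  exact (wnorm_mono hu f).trans (hr r le_rfl)

lemma Conv.eventually_ev_subst [Finite σ] [Finite τ] {f : MvPowerSeries σ ℝ} (hf : Conv f)
    {a : σ → MvPowerSeries τ ℝ} (ha : ∀ i, Conv (a i)) (ha0 : ∀ i, constantCoeff (a i) = 0) :
    ∀ᶠ u in 𝓝 0, ev (MvPowerSeries.subst a f) u = ev f fun i => ev (a i) u := by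
  obtain ⟨r, hr0, hr⟩ := hf
  filter_upwards [eventually_all.mpr fun i => (ha i).eventually_ne_top,
    eventually_all.mpr fun i => (ha i).eventually_absNorm_le (ha0 i) hr0] with u h1 h2
  exact ev_subst (hasSubst_of_constantCoeff_zero ha0) h1
    (ne_top_of_le_ne_top hr (wnorm_mono h2 f))

lemma ev_zero_right (f : MvPowerSeries σ ℝ) : ev f 0 = constantCoeff f := by
  rw [ev, tsum_eq_single 0]
  · simp [rmon]
  · intro α hα
    obtain ⟨i, hi⟩ := Finsupp.ne_iff.mp hα
    have : rmon (0 : σ → ℝ) α = 0 := Finset.prod_eq_zero (i := i) (by simpa using hi) (by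
      simpa using hi)
    rw [this, mul_zero]

lemma Conv.isBigO_ev [Fintype σ] {f : MvPowerSeries σ ℝ} (hf : Conv f) {k : ℕ}
    (hk : f ∈ oIdeal σ k) : ev f =O[𝓝 0] fun u => ‖u‖ ^ k := by
  obtain ⟨r, hr0, hr1, hr⟩ := hf.exists_small
  have hrt : r ≠ ⊤ := ne_top_of_le_ne_top ENNReal.one_ne_top hr1
  have hN : wnorm (fun _ => r) f * r⁻¹ ^ k ≠ ⊤ :=
    ENNReal.mul_ne_top (hr r le_rfl) (ENNReal.pow_ne_top (ENNReal.inv_ne_top.mpr hr0))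
  refine IsBigO.of_bound (wnorm (fun _ => r) f * r⁻¹ ^ k).toReal ?_
  have hev : ∀ᶠ u : σ → ℝ in 𝓝 0, ‖u‖ₑ ≤ r := by
    have : Tendsto (fun u : σ → ℝ => ‖u‖ₑ) (𝓝 0) (𝓝 0) := by
      simpa using (continuous_enorm (E := σ → ℝ)).tendsto 0
    exact this.eventually_le_const (pos_iff_ne_zero.mpr hr0)
  filter_upwards [hev] with u hu
  have h1 : ‖ev f u‖ₑ ≤ wnorm (fun _ => r) f * r⁻¹ ^ k * ‖u‖ₑ ^ k := by
    calc ‖ev f u‖ₑ ≤ absNorm u f := enorm_ev_le u f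
      _ ≤ wnorm (fun _ => ‖u‖ₑ * r⁻¹ * r) f := by
          refine wnorm_mono (fun i => ?_) f
          rw [mul_assoc, ENNReal.inv_mul_cancel hr0 hrt, mul_one]
          exact enorm_le_iff_norm_le.mpr (norm_le_pi_norm u i)
      _ ≤ (‖u‖ₑ * r⁻¹) ^ k * wnorm (fun _ => r) f := by
          refine wnorm_scale_le _ ?_ _ (mem_wIdeal_iff_le.mp hk)
          rw [← div_eq_mul_inv]
          exact ENNReal.div_le_of_le_mul (by simpa using hu)
      _ = _ := by rw [mul_pow]; ring
  have h2 := ENNReal.toReal_mono (ENNReal.mul_ne_top hN (ENNReal.pow_ne_top enorm_ne_top)) h1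
  simpa [ENNReal.toReal_mul, ENNReal.toReal_pow] using h2

lemma eval_smul_of_isHomogeneous {q : MvPolynomial σ ℝ} {n : ℕ} (hq : q.IsHomogeneous n)
    (s : ℝ) (c : σ → ℝ) :
    MvPolynomial.eval (s • c) q = s ^ n * MvPolynomial.eval c q := by
  rw [MvPolynomial.eval_eq, MvPolynomial.eval_eq, Finset.mul_sum]
  refine Finset.sum_congr rfl fun α hα => ?_
  have hd : n = ∑ i ∈ α.support, α i := by
    rw [← hq (MvPolynomial.mem_support_iff.mp hα)]
    exact weight_one_eq_degree α
  rw [hd, ← Finset.prod_pow_eq_pow_sum]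
  simp only [Pi.smul_apply, smul_eq_mul, mul_pow, Finset.prod_mul_distrib]
  ring

lemma eq_zero_of_isHomogeneous_of_isBigO [Fintype σ] {q : MvPolynomial σ ℝ} {n : ℕ}
    (hq : q.IsHomogeneous n)
    (h : (fun u : σ → ℝ => MvPolynomial.eval u q) =O[𝓝 0] fun u => ‖u‖ ^ (n + 1)) : q = 0 := by
  refine MvPolynomial.funext fun c => ?_
  rw [map_zero]
  have ht : Tendsto (fun s : ℝ => s • c) (𝓝[≠] 0) (𝓝 0) := by
    have : Continuous fun s : ℝ => s • c := by fun_prop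
    exact (by simpa using this.tendsto 0 :
      Tendsto (fun s : ℝ => s • c) (𝓝 0) (𝓝 0)).mono_left nhdsWithin_le_nhds
  obtain ⟨C, hC⟩ := (h.comp_tendsto ht).bound
  have hlim : Tendsto (fun s : ℝ => C * (|s| * ‖c‖ ^ (n + 1))) (𝓝[≠] 0) (𝓝 0) := by
    have : Continuous fun s : ℝ => C * (|s| * ‖c‖ ^ (n + 1)) := by fun_prop
    exact (by simpa using this.tendsto 0 :
      Tendsto (fun s : ℝ => C * (|s| * ‖c‖ ^ (n + 1))) (𝓝 0) (𝓝 0)).mono_left nhdsWithin_le_nhds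
  refine norm_le_zero_iff.mp (ge_of_tendsto hlim ?_)
  filter_upwards [hC, self_mem_nhdsWithin] with s hs hs0
  simp only [Function.comp_apply, eval_smul_of_isHomogeneous hq, norm_mul, norm_pow, norm_smul,
    Real.norm_eq_abs, abs_abs, abs_norm] at hs ⊢
  have hpos : 0 < |s| ^ n := pow_pos (abs_pos.mpr hs0) n
  refine le_of_mul_le_mul_left (hs.trans_eq ?_) hpos
  ring

lemma Conv.mem_oIdeal_of_isBigO [Fintype σ] {f : MvPowerSeries σ ℝ} (hf : Conv f) {k : ℕ}
    (h : ev f =O[𝓝 0] fun u => ‖u‖ ^ k) : f ∈ oIdeal σ k := by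
  have key : ∀ n ≤ k, f ∈ oIdeal σ n := by
    intro n
    induction n with
    | zero => exact fun _ => mem_wIdeal_zero f
    | succ n ih =>
      intro hn
      obtain ⟨q, hq, hfq⟩ := exists_homogeneous_sub_mem (ih (by omega))
      have h1 : ev f =O[𝓝 0] fun u : σ → ℝ => ‖u‖ ^ (n + 1) := by
        refine h.trans (IsBigO.of_bound 1 ?_)
        filter_upwards [Metric.ball_mem_nhds (0 : σ → ℝ) one_pos] with u hu
        simpa using pow_le_pow_of_le_one (norm_nonneg u) (mem_ball_zero_iff.mp hu).le hn
      have h2 := (hf.sub (conv_coe q)).isBigO_ev hfq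
      have h3 : q = 0 := by
        refine eq_zero_of_isHomogeneous_of_isBigO hq ((h1.sub h2).congr' ?_ EventuallyEq.rfl)
        filter_upwards [hf.eventually_ne_top] with u hu
        rw [ev_sub hu (absNorm_coe_ne_top u q), ev_coe]
        ring
      simpa [h3] using hfq
  exact key k le_rfl

end NearZero

end ArtinApprox

namespace ArtinApprox

open MvPowerSeries Filter Topology
open scoped ENNReal NNReal

section Analytic

variable {σ : Type}

/-- The exponent of the monomial spelled by a word. -/
def content (x : Σ n, Fin n → σ) : σ →₀ ℕ := ∑ k, Finsupp.single (x.2 k) 1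

lemma rmon_content (u : σ → ℝ) (x : Σ n, Fin n → σ) : rmon u (content x) = ∏ k, u (x.2 k) := by
  have h : ∀ s : Finset (Fin x.1),
      rmon u (∑ k ∈ s, Finsupp.single (x.2 k) 1) = ∏ k ∈ s, u (x.2 k) := fun s => by
    induction s using Finset.induction_on with
    | empty => simp [rmon]
    | insert i s hi ih =>
      rw [Finset.sum_insert hi, Finset.prod_insert hi, rmon_add, ih]
      simp [rmon]
  exact h _

lemma degree_content (x : Σ n, Fin n → σ) : (content x).degree = x.1 := by
  rw [content, map_sum]
  simp

lemma exists_content_eq {n : ℕ} {α : σ →₀ ℕ} (hα : α.degree = n) :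
    ∃ w : Fin n → σ, content ⟨n, w⟩ = α := by
  classical
  induction n generalizing α with
  | zero =>
    refine ⟨Fin.elim0, ?_⟩
    rw [(Finsupp.degree_eq_zero_iff α).mp hα]
    simp [content]
  | succ n ih =>
    obtain ⟨i, hi⟩ : ∃ i, α i ≠ 0 := by
      by_contra! h
      have : α = 0 := Finsupp.ext h
      simp [this] at hα
    have hle : Finsupp.single i 1 ≤ α :=
      Finsupp.single_le_iff.mpr (Nat.one_le_iff_ne_zero.mpr hi)
    have hsum := tsub_add_cancel_of_le hle
    have hd : (α - Finsupp.single i 1).degree = n := by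
      have := congrArg Finsupp.degree hsum
      rw [map_add, hα, Finsupp.degree_single] at this
      omega
    obtain ⟨w, hw⟩ := ih hd
    refine ⟨Fin.cons i w, ?_⟩
    rw [← hsum, ← hw]
    simp [content, Fin.sum_univ_succ, add_comm]

lemma enorm_apply_basis_le [Fintype σ] [DecidableEq σ]
    (p : FormalMultilinearSeries ℝ (σ → ℝ) ℝ) (n : ℕ) (w : Fin n → σ) :
    ‖p n fun k => Pi.single (w k) (1 : ℝ)‖ₑ ≤ ‖p n‖ₑ := by
  refine enorm_le_iff_norm_le.mpr (((p n).le_opNorm _).trans_eq ?_)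
  simp [Pi.norm_single]

/-- The Taylor series of an analytic function is a convergent power series. -/
lemma exists_conv_of_analyticAt [Fintype σ] {G : (σ → ℝ) → ℝ} (hG : AnalyticAt ℝ G 0) :
    ∃ f : MvPowerSeries σ ℝ, Conv f ∧ ∀ᶠ u in 𝓝 0, G u = ev f u := by
  classical
  obtain ⟨p, R, hp⟩ := hG
  obtain ⟨r', hr'0, hr'⟩ := ENNReal.lt_iff_exists_nnreal_btwn.mp hp.r_pos
  have hr'0 : 0 < r' := by exact_mod_cast hr'0
  set r : ℝ≥0 := r' / (Fintype.card σ + 1) with hr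
  have hr0 : (r : ℝ≥0∞) ≠ 0 := by
    have : r ≠ 0 := (div_pos hr'0 (by positivity)).ne'
    exact_mod_cast this
  have hcr : (Fintype.card σ : ℝ≥0∞) * r ≤ r' := by
    have : (Fintype.card σ : ℝ≥0) * r ≤ r' := by
      rw [hr, mul_div_assoc']
      refine div_le_of_le_mul₀ (by positivity) (by positivity) ?_
      rw [mul_comm]
      gcongr
      exact le_self_add
    exact_mod_cast this
  set c : (Σ n, Fin n → σ) → ℝ := fun x => p x.1 fun k => Pi.single (x.2 k) (1 : ℝ) with hc
  have hS : ∑' x, ‖c x‖ₑ * (r : ℝ≥0∞) ^ x.1 ≠ ⊤ := by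
    have h1 : ∑' n, ‖p n‖ₑ * (r' : ℝ≥0∞) ^ n ≠ ⊤ := by
      have := p.summable_norm_mul_pow (hr'.trans_le hp.r_le)
      refine ne_of_eq_of_ne (tsum_congr fun n => ?_) (ENNReal.tsum_coe_ne_top_iff_summable_coe
        (f := fun n => ‖p n‖₊ * r' ^ n).mpr (by simpa using this))
      simp [enorm]
    refine ne_top_of_le_ne_top h1 ?_
    rw [ENNReal.tsum_sigma']
    refine ENNReal.tsum_le_tsum fun n => ?_
    calc ∑' w : Fin n → σ, ‖c ⟨n, w⟩‖ₑ * (r : ℝ≥0∞) ^ n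
        ≤ ∑' _ : Fin n → σ, ‖p n‖ₑ * (r : ℝ≥0∞) ^ n := ENNReal.tsum_le_tsum fun w => by
          gcongr
          exact enorm_apply_basis_le p n w
      _ = ‖p n‖ₑ * (Fintype.card σ * r : ℝ≥0∞) ^ n := by
          rw [tsum_fintype, Finset.sum_const, Finset.card_univ, Fintype.card_fun, Fintype.card_fin,
            nsmul_eq_mul, mul_pow]
          push_cast
          ring
      _ ≤ _ := by gcongr
  set f : MvPowerSeries σ ℝ := fun α => ∑' x : content ⁻¹' {α}, c x with hf
  refine ⟨f, ⟨r, hr0, ne_top_of_le_ne_top hS ?_⟩, ?_⟩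
  · rw [← ENNReal.tsum_fiberwise (fun x => ‖c x‖ₑ * (r : ℝ≥0∞) ^ x.1) content]
    refine ENNReal.tsum_le_tsum fun α => ?_
    rw [mon_const]
    calc ‖∑' x : content ⁻¹' {α}, c x‖ₑ * (r : ℝ≥0∞) ^ α.degree
        ≤ (∑' x : content ⁻¹' {α}, ‖c x‖ₑ) * (r : ℝ≥0∞) ^ α.degree := by
          gcongr
          exact enorm_tsum_le_tsum_enorm
      _ = _ := by
          rw [← ENNReal.tsum_mul_right]
          refine tsum_congr fun x => ?_
          rw [← degree_content x.1, x.2]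
  · filter_upwards [eventually_enorm_le hr0, Metric.eball_mem_nhds (0 : σ → ℝ) hp.r_pos]
      with u hu huR
    have hF : Summable fun x : Σ n, Fin n → σ => c x * ∏ k, u (x.2 k) := by
      refine Summable.of_norm (summable_norm_of_tsum_enorm (ne_top_of_le_ne_top hS ?_))
      refine ENNReal.tsum_le_tsum fun x => ?_
      rw [enorm_mul, ← rmon_content, enorm_rmon]
      gcongr
      refine (mon_mono hu _).trans_eq ?_
      rw [mon_const, degree_content]
    have h1 : G u = ∑' n, p n fun _ => u := by simpa using (hp.hasSum huR).tsum_eq.symm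
    have h2 : ∀ n, (p n fun _ => u) = ∑' w : Fin n → σ, c ⟨n, w⟩ * ∏ k, u (w k) := fun n => by
      have hu' : u = ∑ i, u i • Pi.single i (1 : ℝ) := by
        simpa [← Pi.single_smul'] using (Finset.univ_sum_single u).symm
      rw [tsum_fintype]
      conv_lhs => rw [hu']
      rw [(p n).map_sum]
      refine Finset.sum_congr rfl fun w _ => ?_
      rw [(p n).map_smul_univ, smul_eq_mul, mul_comm]
    rw [h1]
    simp_rw [h2]
    rw [← hF.tsum_sigma' fun n => (hasSum_fintype _).summable,
      ← (hF.hasSum.tsum_fiberwise content).tsum_eq]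
    refine tsum_congr fun α => ?_
    have h3 : coeff α f = ∑' x : content ⁻¹' {α}, c x := rfl
    rw [h3, ← tsum_mul_right]
    refine tsum_congr fun x => ?_
    have h4 : content x.1 = α := x.2
    have h5 := rmon_content u x.1
    rw [h4] at h5
    rw [h5]

/-- The product of the coordinates prescribed by a word. -/
def wordProd [Fintype σ] {n : ℕ} (w : Fin n → σ) : (σ → ℝ) [×n]→L[ℝ] ℝ :=
  (ContinuousMultilinearMap.mkPiAlgebraFin ℝ n ℝ).compContinuousLinearMap
    fun k => ContinuousLinearMap.proj (w k)

lemma wordProd_apply [Fintype σ] {n : ℕ} (w : Fin n → σ) (u : σ → ℝ) :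
    (wordProd w fun _ => u) = rmon u (content ⟨n, w⟩) := by
  simp [wordProd, rmon_content, List.prod_ofFn]

lemma norm_wordProd_le [Fintype σ] {n : ℕ} (w : Fin n → σ) : ‖wordProd w‖ ≤ 1 := by
  refine ContinuousMultilinearMap.opNorm_le_bound zero_le_one fun m => ?_
  simp only [wordProd, ContinuousMultilinearMap.compContinuousLinearMap_apply,
    ContinuousMultilinearMap.mkPiAlgebraFin_apply, List.prod_ofFn, norm_prod, one_mul]
  exact Finset.prod_le_prod (fun _ _ => norm_nonneg _) fun k _ => norm_le_pi_norm (m k) (w k)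

/-- The sum of a convergent power series is analytic. -/
lemma Conv.analyticAt_ev [Fintype σ] {f : MvPowerSeries σ ℝ} (hf : Conv f) :
    AnalyticAt ℝ (ev f) 0 := by
  classical
  obtain ⟨r, hr0, hr1, hr⟩ := hf.exists_small
  have hrt : r ≠ ⊤ := ne_top_of_le_ne_top ENNReal.one_ne_top hr1
  have hfin : ∀ n, Finite (Finsupp.degree (R := ℕ) (σ := σ) ⁻¹' {n}) := fun n =>
    (Finsupp.finite_of_degree_le n).subset fun α hα => le_of_eq hα
  have := fun n => Fintype.ofFinite (Finsupp.degree (R := ℕ) (σ := σ) ⁻¹' {n})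
  choose w hw using fun (n : ℕ) (α : Finsupp.degree (R := ℕ) (σ := σ) ⁻¹' {n}) =>
    exists_content_eq (n := n) α.2
  set p : FormalMultilinearSeries ℝ (σ → ℝ) ℝ := fun n => ∑ α, coeff α.1 f • wordProd (w n α) with hp
  have hp_apply : ∀ n u, (p n fun _ => u) =
      ∑' α : Finsupp.degree (R := ℕ) (σ := σ) ⁻¹' {n}, coeff α.1 f * rmon u α := fun n u => by
    simp [hp, tsum_fintype, wordProd_apply, hw]
  have hbound : ∑' n, ‖p n‖ₑ * r ^ n ≠ ⊤ := by
    refine ne_top_of_le_ne_top (hr r le_rfl) ?_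
    rw [wnorm, ← ENNReal.tsum_fiberwise _ (Finsupp.degree (R := ℕ) (σ := σ))]
    refine ENNReal.tsum_le_tsum fun n => ?_
    rw [tsum_fintype]
    calc ‖p n‖ₑ * r ^ n ≤ (∑ α : Finsupp.degree (R := ℕ) (σ := σ) ⁻¹' {n}, ‖coeff α.1 f‖ₑ) * r ^ n := by
          gcongr
          refine (enorm_sum_le Finset.univ fun α => coeff α.1 f • wordProd (w n α)).trans
            (Finset.sum_le_sum fun α _ => ?_)
          refine enorm_le_iff_norm_le.mpr ?_
          rw [norm_smul]
          exact mul_le_of_le_one_right (norm_nonneg _) (norm_wordProd_le _)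
      _ = _ := by
          rw [Finset.sum_mul]
          refine Finset.sum_congr rfl fun α _ => ?_
          rw [mon_const, show α.1.degree = n from α.2]
  lift r to ℝ≥0 using hrt
  refine HasFPowerSeriesAt.analyticAt (p := p) ⟨r, p.le_radius_of_summable ?_,
    pos_iff_ne_zero.mpr hr0, fun {u} hu => ?_⟩
  · simpa using summable_norm_of_tsum_enorm (f := fun n => ‖p n‖ * (r : ℝ) ^ n)
      (by simpa [enorm_mul, enorm_pow] using hbound)
  · have hu' : absNorm u f ≠ ⊤ := by
      refine ne_top_of_le_ne_top (hr r le_rfl) (wnorm_mono (fun i => ?_) f)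
      refine (enorm_le_iff_norm_le.mpr (norm_le_pi_norm u i)).trans ?_
      rw [mem_eball_zero_iff] at hu
      exact hu.le
    rw [zero_add]
    simp_rw [hp_apply]
    exact (summable_norm_ev hu').of_norm.hasSum.tsum_fiberwise Finsupp.degree

end Analytic

end ArtinApprox

namespace ArtinApprox

open MvPowerSeries Filter Topology Asymptotics

section Bridge

variable {σ ι : Type}

/-- The Taylor series at the origin of a product. -/
lemma exists_conv_of_analyticAt_prod [Fintype σ] [Fintype ι] {G : (ι → ℝ) × (σ → ℝ) → ℝ} (hG : AnalyticAt ℝ G 0) :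
    ∃ f : MvPowerSeries (ι ⊕ σ) ℝ, Conv f ∧
      ∀ᶠ v in 𝓝 0, G (fun i => v (Sum.inl i), fun i => v (Sum.inr i)) = ev f v := by
  let L : (ι ⊕ σ → ℝ) →L[ℝ] (ι → ℝ) × (σ → ℝ) :=
    (ContinuousLinearMap.pi fun i => ContinuousLinearMap.proj (Sum.inl i)).prod
      (ContinuousLinearMap.pi fun i => ContinuousLinearMap.proj (Sum.inr i))
  have hL : AnalyticAt ℝ (fun v => G (L v)) 0 :=
    AnalyticAt.fun_comp (by rwa [map_zero]) (L.analyticAt 0)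
  exact exists_conv_of_analyticAt hL

lemma tendsto_ev [Fintype σ] {c : ι → MvPowerSeries σ ℝ} (hc : ∀ i, Conv (c i))
    (h0 : ∀ i, constantCoeff (c i) = 0) :
    Tendsto (fun u i => ev (c i) u) (𝓝 0) (𝓝 (0 : ι → ℝ)) := by
  refine tendsto_pi_nhds.mpr fun i => ?_
  have h := (hc i).analyticAt_ev.continuousAt.tendsto
  rwa [ev_zero_right, h0 i] at h

lemma conv_sumElim {c : ι → MvPowerSeries σ ℝ} (hc : ∀ i, Conv (c i)) (i : ι ⊕ σ) :
    Conv (Sum.elim c X i : MvPowerSeries σ ℝ) := by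
  cases i
  · exact hc _
  · exact conv_X _

lemma eventually_eq_ev_subst [Fintype σ] [Fintype ι] {G : (ι → ℝ) × (σ → ℝ) → ℝ} {f : MvPowerSeries (ι ⊕ σ) ℝ}
    (hf : Conv f)
    (hG : ∀ᶠ v in 𝓝 0, G (fun i => v (Sum.inl i), fun i => v (Sum.inr i)) = ev f v)
    {c : ι → MvPowerSeries σ ℝ} (hc : ∀ i, Conv (c i)) (h0 : ∀ i, constantCoeff (c i) = 0) :
    ∀ᶠ u in 𝓝 0, G (fun i => ev (c i) u, u) = ev (subst (Sum.elim c X) f) u := by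
  have h0' := constantCoeff_sumElim h0 constantCoeff_X
  filter_upwards [hf.eventually_ev_subst (conv_sumElim hc) h0',
    (tendsto_ev (conv_sumElim hc) h0').eventually hG] with u h1 h2
  rw [h1, ← h2]
  simp [ev_X]

end Bridge

section Truncation

variable {γ δ : ℕ}

/-- The truncation of a formal power series as a polynomial. -/
def truncPolynomial (tf : (Fin γ → ℕ) → Fin δ → ℝ) (k : ℕ) (i : Fin δ) : MvPolynomial (Fin γ) ℝ :=
  ∑ dd ∈ (Fintype.piFinset fun _ : Fin γ => Finset.range k).filter (fun dd => (∑ j, dd j) < k),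
    MvPolynomial.monomial (Finsupp.equivFunOnFinite.symm dd) (tf dd i)

lemma ev_truncPolynomial (tf : (Fin γ → ℕ) → Fin δ → ℝ) (k : ℕ) (i : Fin δ) (u : Fin γ → ℝ) :
    ev (truncPolynomial tf k i : MvPowerSeries (Fin γ) ℝ) u = truncPoly γ δ tf k u i := by
  rw [ev_coe, truncPolynomial, truncPoly, map_sum]
  refine Finset.sum_congr rfl fun dd _ => ?_
  rw [MvPolynomial.eval_monomial, Finsupp.prod_fintype _ _ (by simp)]
  rfl

lemma coeff_truncPolynomial (tf : (Fin γ → ℕ) → Fin δ → ℝ) (k : ℕ) (i : Fin δ)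
    (α : Fin γ →₀ ℕ) : coeff α (truncPolynomial tf k i : MvPowerSeries (Fin γ) ℝ) =
      if α.degree < k then tf α i else 0 := by
  classical
  have hiff (dd : Fin γ → ℕ) : Finsupp.equivFunOnFinite.symm dd = α ↔ dd = α := by
    rw [Equiv.symm_apply_eq]
    rfl
  simp only [MvPolynomial.coeff_coe, truncPolynomial, MvPolynomial.coeff_sum,
    MvPolynomial.coeff_monomial, hiff]
  rw [Finset.sum_ite_eq']
  have hmem : (α : Fin γ → ℕ) ∈ (Fintype.piFinset fun _ : Fin γ => Finset.range k).filter
      (fun dd => (∑ j, dd j) < k) ↔ α.degree < k := by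
    rw [Finset.mem_filter, Fintype.mem_piFinset, Finsupp.degree_eq_sum]
    refine ⟨fun h => h.2, fun h => ⟨fun j => ?_, h⟩⟩
    exact Finset.mem_range.mpr ((Finset.single_le_sum (fun _ _ => Nat.zero_le _)
      (Finset.mem_univ j)).trans_lt h)
  simp only [hmem]

end Truncation

end ArtinApprox

open ArtinApprox in
/-- Artin's approximation theorem. -/
theorem statement13 (δ γ j₀ : ℕ)
    (g : Fin j₀ → ((Fin δ → ℝ) × (Fin γ → ℝ)) → ℝ)
    -- the `g_j` are convergent power series (germs at `0` of real-analytic functions)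
    (hg : ∀ j, AnalyticAt ℝ (g j) 0)
    (κ : ℕ) (hκ : 1 ≤ κ)
    -- `t^f` is a formal power series solution with `t^f(0) = 0`
    (tf : (Fin γ → ℕ) → (Fin δ → ℝ)) (htf0 : tf (fun _ => 0) = 0)
    -- `g_j(t^f(u),u) ≡ 0` : for every `k`, the composite with the `k`-truncation of `t^f`
    -- vanishes to order `k` at `0`
    (hsol : ∀ (j : Fin j₀) (k : ℕ), ∃ C ε : ℝ, 0 < ε ∧ ∀ u : Fin γ → ℝ, ‖u‖ < ε →
      |g j (truncPoly γ δ tf k u, u)| ≤ C * ‖u‖ ^ k) :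
    -- there is a convergent solution `t^c` agreeing with `t^f` to order `κ`
    ∃ tc : (Fin γ → ℝ) → (Fin δ → ℝ),
      AnalyticAt ℝ tc 0 ∧ tc 0 = 0 ∧
      (∃ C ε : ℝ, 0 < ε ∧ ∀ u : Fin γ → ℝ, ‖u‖ < ε →
        ‖tc u - truncPoly γ δ tf κ u‖ ≤ C * ‖u‖ ^ κ) ∧
      ∀ j : Fin j₀, ∀ᶠ u in nhds (0 : Fin γ → ℝ), g j (tc u, u) = 0 := by
  open MvPowerSeries Filter Topology Asymptotics in
  set a : Fin δ → MvPowerSeries (Fin γ) ℝ := fun i α => tf α i with ha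
  set P : ℕ → Fin δ → MvPowerSeries (Fin γ) ℝ := fun k i => truncPolynomial tf k i with hP
  have ha0 : ∀ i, constantCoeff (a i) = 0 := fun i => congrFun htf0 i
  have hPc : ∀ k i, Conv (P k i) := fun k i => conv_coe _
  have hP0 : ∀ k i, constantCoeff (P k i) = 0 := fun k i => by
    rw [← coeff_zero_eq_constantCoeff_apply, coeff_truncPolynomial]
    have : tf (⇑(0 : Fin γ →₀ ℕ)) i = 0 := congrFun htf0 i
    rw [this, ite_self]
  have hPa : ∀ k i, a i - P k i ∈ oIdeal (Fin γ) k := fun k i => by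
    rw [mem_oIdeal]
    intro α hα
    rw [map_sub, coeff_truncPolynomial, if_pos hα, sub_eq_zero]
    rfl
  have hPev : ∀ k u, (fun i => ev (P k i) u) = truncPoly γ δ tf k u := fun k u =>
    funext fun i => ev_truncPolynomial tf k i u
  choose G hGc hG using fun j => exists_conv_of_analyticAt_prod (hg j)
  have hGa : ∀ j, subst (Sum.elim a X) (G j) = 0 := fun j => by
    refine eq_zero_of_forall_mem (w := fun _ => 1) fun k => ?_
    have h1 : subst (Sum.elim (P k) X) (G j) ∈ oIdeal (Fin γ) k := by
      refine ((hGc j).subst (conv_sumElim (hPc k))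
        (constantCoeff_sumElim (hP0 k) constantCoeff_X)).mem_oIdeal_of_isBigO ?_
      obtain ⟨C, ε, hε, hC⟩ := hsol j k
      refine IsBigO.of_bound C ?_
      filter_upwards [eventually_eq_ev_subst (hGc j) (hG j) (hPc k) (hP0 k),
        Metric.ball_mem_nhds (0 : Fin γ → ℝ) hε] with u h1 h2
      rw [← h1, hPev]
      simpa using hC u (mem_ball_zero_iff.mp h2)
    have h2 := subst_sub_subst_mem (oIdeal (Fin γ) k)
      (constantCoeff_sumElim ha0 constantCoeff_X)
      (constantCoeff_sumElim (hP0 k) constantCoeff_X) (fun i => by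
        cases i with
        | inl i => exact hPa k i
        | inr i => simp) (G j)
    exact (Submodule.sub_mem_iff_left _ h1).mp h2
  obtain ⟨c, hc, hc0, hca, hcG⟩ := exists_conv_approx ha0 κ
  refine ⟨fun u i => ev (c i) u, analyticAt_pi_iff.mpr fun i => (hc i).analyticAt_ev,
    funext fun i => by simp [ev_zero_right, hc0], ?_, fun j => ?_⟩
  · have h : (fun u => (fun i => ev (c i) u) - truncPoly γ δ tf κ u) =O[𝓝 0]
        fun u => ‖u‖ ^ κ := by
      refine isBigO_pi.mpr fun i => ?_
      have h1 : c i - P κ i ∈ oIdeal (Fin γ) κ := by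
        simpa using add_mem (hca i) (hPa κ i)
      refine (((hc i).sub (hPc κ i)).isBigO_ev h1).congr' ?_ EventuallyEq.rfl
      filter_upwards [(hc i).eventually_ne_top] with u hu
      rw [ev_sub hu (absNorm_coe_ne_top u _), ev_truncPolynomial]
      rfl
    obtain ⟨C, hC⟩ := h.bound
    obtain ⟨ε, hε, hball⟩ := Metric.eventually_nhds_iff_ball.mp hC
    exact ⟨C, ε, hε, fun u hu => by simpa using hball u (mem_ball_zero_iff.mpr hu)⟩
  · filter_upwards [eventually_eq_ev_subst (hGc j) (hG j) hc hc0] with u hu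
    rw [hu, hcG (G j) (hGc j) (hGa j), ev_zero]
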